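/- There exists an infinite-dimensional uniformly convex Banach space X which is hereditarily indecomposable, i.e. no closed infinite-dimensional subspace of X can be written as a topological direct sum of two closed infinite-dimensional subspaces; equivalently, whenever Y and Z are closed infinite-dimensional subspaces of X with Y ∩ Z = {0}, the subspace Y + Z is not closed in X. -/

import Mathlib

set_option linter.unusedVariables false
set_option linter.unusedSimpArgs false
set_option linter.unusedSectionVars false
namespace GMHI
open Finset

/-- The Hilbert space of square summable bi-infinite sequences. -/
abbrev KK : Type := lp (fun _ : ℤ => ℝ) 2
/-- Finitely supported sequences in `KK`. -/
abbrev AA : Type := ℕ →₀ KK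

noncomputable section

lemma two_toReal : (2 : ENNReal).toReal = 2 := by norm_num

lemma memK (f : ℤ → ℝ) (C : ℝ) (h : ∀ s : Finset ℤ, ∑ k ∈ s, f k ^ 2 ≤ C) :
    Memℓp f (2 : ENNReal) := by
  apply memℓp_gen' (C := C)
  intro s
  rw [two_toReal]
  simpa using h s

lemma normK_sq (x : KK) : ‖x‖ ^ 2 = ∑' k, (x k) ^ 2 := by
  have := lp.norm_rpow_eq_tsum (p := 2) (by simp) x
  rw [two_toReal] at this
  simpa using this

lemma summK_sq (x : KK) : Summable (fun k => (x k) ^ 2) := by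
  have := (lp.memℓp x).summable (by simp)
  rw [two_toReal] at this
  simpa using this

lemma normK_sq_le (x : KK) (C : ℝ) (h : ∀ s : Finset ℤ, ∑ k ∈ s, x k ^ 2 ≤ C) :
    ‖x‖ ^ 2 ≤ C := by
  rw [normK_sq]
  exact (summK_sq x).tsum_le_of_sum_le h

lemma absK_le (x : KK) (k : ℤ) : |x k| ≤ ‖x‖ := by
  have := lp.norm_apply_le_norm (p := 2) (by simp) x k
  simpa using this

lemma innerK (x y : KK) : inner ℝ x y = ∑' k, x k * y k := by
  rw [lp.inner_eq_tsum]
  congr 1; ext k; simp [mul_comm]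

/-- shift on `KK` -/
def sK (m : ℤ) : KK →ₗ[ℝ] KK where
  toFun x := ⟨fun k => x (k + m), by
    have h := (Equiv.addRight m).summable_iff.mpr (summK_sq x)
    apply memℓp_gen
    rw [two_toReal]
    simpa [Function.comp_def] using h⟩
  map_add' x y := by ext k; rfl
  map_smul' c x := by ext k; rfl

@[simp] lemma sK_apply (m : ℤ) (x : KK) (k : ℤ) : sK m x k = x (k + m) := rfl

lemma sK_inner (m : ℤ) (x y : KK) : inner ℝ (sK m x) (sK m y) = inner ℝ x y := by
  rw [innerK, innerK]
  exact (Equiv.addRight m).tsum_eq (fun k => x k * y k)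

@[simp] lemma sK_norm (m : ℤ) (x : KK) : ‖sK m x‖ = ‖x‖ := by
  have := sK_inner m x x
  rw [real_inner_self_eq_norm_sq, real_inner_self_eq_norm_sq] at this
  exact (sq_eq_sq₀ (norm_nonneg _) (norm_nonneg _)).mp this

@[simp] lemma sK_sK (m n : ℤ) (x : KK) : sK m (sK n x) = sK (m + n) x := by
  ext k; simp [add_assoc]

@[simp] lemma sK_zero (x : KK) : sK 0 x = x := by ext k; simp

/-- shift on `AA` -/
def sA (m : ℤ) : AA →ₗ[ℝ] AA := Finsupp.mapRange.linearMap (sK m)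

@[simp] lemma sA_apply (m : ℤ) (a : AA) (n : ℕ) : sA m a n = sK m (a n) := rfl

@[simp] lemma sA_sA (m n : ℤ) (a : AA) : sA m (sA n a) = sA (m + n) a := by
  ext1 k; simp

@[simp] lemma sA_zero (a : AA) : sA 0 a = a := by ext1 k; simp

/-- interval projection -/
def Pr {M : Type} [AddCommGroup M] [Module ℝ M] (p q : ℕ) : (ℕ →₀ M) →ₗ[ℝ] (ℕ →₀ M) where
  toFun a := a.filter (fun n => p ≤ n ∧ n < q)
  map_add' a b := Finsupp.filter_add
  map_smul' c a := Finsupp.filter_smul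

section
variable {M : Type} [AddCommGroup M] [Module ℝ M]
lemma Pr_apply (p q : ℕ) (a : ℕ →₀ M) (n : ℕ) :
    Pr p q a n = if p ≤ n ∧ n < q then a n else 0 := rfl

lemma Pr_Pr (p q p' q' : ℕ) (a : ℕ →₀ M) :
    Pr p q (Pr p' q' a) = Pr (max p p') (min q q') a := by
  ext1 n
  simp only [Pr_apply]
  split_ifs <;> first | rfl | omega

lemma Pr_idem (p q : ℕ) (a : ℕ →₀ M) : Pr p q (Pr p q a) = Pr p q a := by
  rw [Pr_Pr, max_self, min_self]

/-- supported in `[p,q)` -/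
def Supp (p q : ℕ) (a : ℕ →₀ M) : Prop := ∀ n, a n ≠ 0 → p ≤ n ∧ n < q

lemma Supp.mono {p q p' q' : ℕ} {a : ℕ →₀ M} (h : Supp p q a) (hp : p' ≤ p) (hq : q ≤ q') :
    Supp p' q' a := fun n hn => ⟨hp.trans (h n hn).1, (h n hn).2.trans_le hq⟩

lemma Pr_eq_self {p q : ℕ} {a : ℕ →₀ M} (h : Supp p q a) : Pr p q a = a := by
  ext1 n
  rw [Pr_apply]
  split_ifs with h1
  · rfl
  · by_contra h2
    exact h1 (h n (Ne.symm h2))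

lemma supp_Pr (p q : ℕ) (a : ℕ →₀ M) : Supp p q (Pr p q a) := by
  intro n hn
  rw [Pr_apply] at hn
  by_contra h
  simp [h] at hn

lemma Supp.zero {p q : ℕ} : Supp p q (0 : ℕ →₀ M) := by intro n hn; simp at hn
lemma Supp.add {p q : ℕ} {a b : ℕ →₀ M} (ha : Supp p q a) (hb : Supp p q b) :
    Supp p q (a + b) := by
  intro n hn
  by_cases h : a n = 0
  · exact hb n (by simpa [h] using hn)
  · exact ha n h
lemma Supp.smul {p q : ℕ} {a : ℕ →₀ M} (c : ℝ) (ha : Supp p q a) : Supp p q (c • a) := by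
  intro n hn
  apply ha n
  intro h; simp [h] at hn
lemma Supp.sum {ι : Type} {p q : ℕ} {f : ι → ℕ →₀ M} {s : Finset ι}
    (h : ∀ i ∈ s, Supp p q (f i)) : Supp p q (∑ i ∈ s, f i) := by
  classical
  induction s using Finset.induction_on with
  | empty => simpa using Supp.zero
  | insert i s hi ih =>
    rw [Finset.sum_insert hi]
    exact (h i (by simp)).add (ih fun j hj => h j (by simp [hj]))

lemma exists_supp (a : ℕ →₀ M) : ∃ q, Supp 0 q a := by
  refine ⟨a.support.sup id + 1, fun n hn => ⟨Nat.zero_le _, ?_⟩⟩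
  have : n ∈ a.support := by simpa using hn
  exact Nat.lt_succ_of_le (Finset.le_sup (f := id) this)

lemma Pr_eq_zero {p q p' q' : ℕ} {a : ℕ →₀ M} (h : Supp p' q' a) (hd : q ≤ p' ∨ q' ≤ p) :
    Pr p q a = 0 := by
  ext1 n
  rw [Pr_apply]
  split_ifs with h1
  · by_contra h2
    have := h n h2
    omega
  · rfl
end

lemma sA_Pr (m : ℤ) (p q : ℕ) (a : AA) : sA m (Pr p q a) = Pr p q (sA m a) := by
  ext1 n
  simp only [sA_apply, Pr_apply]
  split_ifs <;> simp

lemma Supp.sA {p q : ℕ} {a : AA} (m : ℤ) (ha : Supp p q a) : Supp p q (sA m a) := by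
  intro n hn
  apply ha n
  intro h; simp [h] at hn

/-- pairing on `AA` -/
def ip : AA →ₗ[ℝ] AA →ₗ[ℝ] ℝ :=
  Finsupp.lsum ℝ fun n => (LinearMap.lcomp ℝ ℝ (Finsupp.lapply n)).comp (innerₗ KK)

lemma ip_def (a b : AA) : ip a b = ∑ n ∈ a.support, inner ℝ (a n) (b n) := by
  simp only [ip, Finsupp.lsum_apply, Finsupp.sum]
  rw [LinearMap.sum_apply]
  rfl

lemma ip_eq_sum (a b : AA) (s : Finset ℕ) (h : ∀ n, a n ≠ 0 → n ∈ s) :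
    ip a b = ∑ n ∈ s, inner ℝ (a n) (b n) := by
  rw [ip_def]
  apply Finset.sum_subset
  · intro n hn; exact h n (by simpa using hn)
  · intro n _ hn
    have : a n = 0 := by simpa using hn
    simp [this]

lemma ip_symm (a b : AA) : ip a b = ip b a := by
  rw [ip_eq_sum a b (a.support ∪ b.support) (by intro n hn; simp [hn]),
    ip_eq_sum b a (a.support ∪ b.support) (by intro n hn; simp [hn])]
  apply Finset.sum_congr rfl
  intro n _
  exact real_inner_comm _ _

lemma ip_self (a : AA) : ip a a = ∑ n ∈ a.support, ‖a n‖ ^ 2 := by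
  rw [ip_def]; simp

lemma ip_self_eq_sum (a : AA) (s : Finset ℕ) (h : ∀ n, a n ≠ 0 → n ∈ s) :
    ip a a = ∑ n ∈ s, ‖a n‖ ^ 2 := by
  rw [ip_eq_sum a a s h]; simp

lemma ip_nonneg (a : AA) : 0 ≤ ip a a := by rw [ip_self]; positivity

lemma ip_sA (m : ℤ) (a b : AA) : ip (sA m a) (sA m b) = ip a b := by
  rw [ip_eq_sum (sA m a) _ a.support, ip_def]
  · simp [sK_inner]
  · intro n hn
    simp only [Finsupp.mem_support_iff]
    intro h; simp [h] at hn

lemma norm_sq_le_ip (a : AA) (n : ℕ) : ‖a n‖ ^ 2 ≤ ip a a := by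
  rw [ip_self]
  by_cases h : a n = 0
  · simp [h]; positivity
  · exact Finset.single_le_sum (f := fun n => ‖a n‖ ^ 2) (fun i _ => by positivity) (by simpa using h)

lemma ip_Pr_le (p q : ℕ) (a : AA) : ip (Pr p q a) (Pr p q a) ≤ ip a a := by
  rw [ip_self_eq_sum (Pr p q a) a.support, ip_self]
  · apply Finset.sum_le_sum
    intro n _
    rw [Pr_apply]
    split_ifs <;> simp
  · intro n hn
    rw [Pr_apply] at hn
    simp only [Finsupp.mem_support_iff]
    intro h; simp [h] at hn

lemma ip_Pr_left (p q : ℕ) (a b : AA) : ip (Pr p q a) b = ip a (Pr p q b) := by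
  rw [ip_eq_sum (Pr p q a) b a.support, ip_def]
  · apply Finset.sum_congr rfl
    intro n _
    simp only [Pr_apply]
    split_ifs <;> simp
  · intro n hn
    rw [Pr_apply] at hn
    simp only [Finsupp.mem_support_iff]
    intro h; simp [h] at hn

/-- the `ℓ₁` norm -/
def n1 (a : AA) : ℝ := ∑ n ∈ a.support, ‖a n‖

lemma n1_eq_sum (a : AA) (s : Finset ℕ) (h : ∀ n, a n ≠ 0 → n ∈ s) :
    n1 a = ∑ n ∈ s, ‖a n‖ := by
  apply Finset.sum_subset
  · intro n hn; exact h n (by simpa using hn)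
  · intro n _ hn
    have : a n = 0 := by simpa using hn
    simp [this]

lemma n1_nonneg (a : AA) : 0 ≤ n1 a := by unfold n1; positivity
lemma norm_le_n1 (a : AA) (n : ℕ) : ‖a n‖ ≤ n1 a := by
  by_cases h : a n = 0
  · simp [h]; exact n1_nonneg a
  · exact Finset.single_le_sum (f := fun n => ‖a n‖) (fun i _ => by positivity) (by simpa using h)
lemma n1_add (a b : AA) : n1 (a + b) ≤ n1 a + n1 b := by
  rw [n1_eq_sum (a + b) (a.support ∪ b.support), n1_eq_sum a (a.support ∪ b.support),
    n1_eq_sum b (a.support ∪ b.support), ← Finset.sum_add_distrib]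
  · exact Finset.sum_le_sum fun n _ => norm_add_le _ _
  · intro n hn; simp [hn]
  · intro n hn; simp [hn]
  · intro n hn
    by_contra h
    simp at h
    simp [h] at hn
lemma n1_smul (c : ℝ) (a : AA) : n1 (c • a) = |c| * n1 a := by
  rw [n1_eq_sum (c • a) a.support, n1, Finset.mul_sum]
  · simp [norm_smul]
  · intro n hn
    by_contra h
    simp at h
    simp [h] at hn
lemma n1_sA (m : ℤ) (a : AA) : n1 (sA m a) = n1 a := by
  rw [n1_eq_sum (sA m a) a.support, n1]
  · simp
  · intro n hn
    by_contra h
    simp at h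
    simp [h] at hn
lemma n1_Pr (p q : ℕ) (a : AA) : n1 (Pr p q a) ≤ n1 a := by
  rw [n1_eq_sum (Pr p q a) a.support, n1]
  · apply Finset.sum_le_sum
    intro n _
    rw [Pr_apply]
    split_ifs <;> simp
  · intro n hn
    rw [Pr_apply] at hn
    by_contra h
    simp at h
    simp [h] at hn

/-- `(a,b)` is a path of `x`. -/
def IsPath (x : ℕ →₀ ℝ) (a b : AA) : Prop :=
  ∀ n (k : ℤ), (2 : ℝ) ^ k * a n k + (2 : ℝ) ^ (-k) * b n k = x n

lemma IsPath.add {x y : ℕ →₀ ℝ} {a b a' b' : AA} (h : IsPath x a b) (h' : IsPath y a' b') :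
    IsPath (x + y) (a + a') (b + b') := by
  intro n k
  have := h n k
  have := h' n k
  simp only [Finsupp.add_apply, lp.coeFn_add, Pi.add_apply]
  linarith

lemma IsPath.smul {x : ℕ →₀ ℝ} {a b : AA} (c : ℝ) (h : IsPath x a b) :
    IsPath (c • x) (c • a) (c • b) := by
  intro n k
  have := h n k
  simp only [Finsupp.smul_apply, lp.coeFn_smul, Pi.smul_apply, smul_eq_mul]
  rw [← this]; ring

lemma IsPath.zero : IsPath 0 0 0 := by
  intro n k
  simp

lemma IsPath.sub {x y : ℕ →₀ ℝ} {a b a' b' : AA} (h : IsPath x a b) (h' : IsPath y a' b') :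
    IsPath (x - y) (a - a') (b - b') := by
  have := h.add (h'.smul (-1))
  simpa [sub_eq_add_neg] using this

lemma IsPath.sum {ι : Type} {s : Finset ι} {x : ι → ℕ →₀ ℝ} {a b : ι → AA}
    (h : ∀ i ∈ s, IsPath (x i) (a i) (b i)) :
    IsPath (∑ i ∈ s, x i) (∑ i ∈ s, a i) (∑ i ∈ s, b i) := by
  classical
  induction s using Finset.induction_on with
  | empty => simpa using IsPath.zero
  | insert i s hi ih =>
    rw [Finset.sum_insert hi, Finset.sum_insert hi, Finset.sum_insert hi]
    exact (h i (by simp)).add (ih fun j hj => h j (by simp [hj]))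

lemma IsPath.Pr {x : ℕ →₀ ℝ} {a b : AA} (h : IsPath x a b) (p q : ℕ) :
    IsPath (Pr p q x) (Pr p q a) (Pr p q b) := by
  intro n k
  have := h n k
  simp only [Pr_apply]
  split_ifs
  · exact this
  · simp

lemma IsPath.dil {x : ℕ →₀ ℝ} {a b : AA} (h : IsPath x a b) (m : ℤ) :
    IsPath x ((2 : ℝ) ^ m • sA m a) ((2 : ℝ) ^ (-m) • sA m b) := by
  intro n k
  have := h n (k + m)
  simp only [Finsupp.smul_apply, lp.coeFn_smul, Pi.smul_apply, smul_eq_mul, sA_apply, sK_apply]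
  rw [← this, neg_add, zpow_add₀ (two_ne_zero), zpow_add₀ (two_ne_zero)]
  ring

/-- the scalar sequence `u` -/
def uf (k : ℤ) : ℝ := ((2 : ℝ) ^ k + (2 : ℝ) ^ (-k))⁻¹

lemma uf_pos (k : ℤ) : 0 < uf k := by unfold uf; positivity
lemma uf_neg (k : ℤ) : uf (-k) = uf k := by unfold uf; rw [neg_neg, add_comm]
lemma uf_le (k : ℤ) : uf k ≤ (2 : ℝ) ^ (-k) := by
  unfold uf
  rw [zpow_neg]
  apply inv_anti₀ (by positivity)
  have : (0:ℝ) < ((2 : ℝ) ^ k)⁻¹ := by positivity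
  linarith
lemma uf_le_abs (k : ℤ) : uf k ≤ (2 : ℝ)⁻¹ ^ k.natAbs := by
  obtain ⟨n, rfl | rfl⟩ := k.eq_nat_or_neg
  · have := uf_le (n : ℤ)
    simpa [zpow_neg] using this
  · have := uf_le (n : ℤ)
    rw [uf_neg]
    simpa [zpow_neg] using this
lemma uf_spec (k : ℤ) : (2 : ℝ) ^ k * uf k + (2 : ℝ) ^ (-k) * uf k = 1 := by
  rw [← add_mul, uf]
  apply mul_inv_cancel₀
  positivity
lemma uf_zero : uf 0 = 1 / 2 := by norm_num [uf]

/-- sum of geometric weights over any finite set of integers -/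
lemma sum_half_natAbs (s : Finset ℤ) : ∑ k ∈ s, (2 : ℝ)⁻¹ ^ k.natAbs ≤ 3 := by
  have key : ∀ n : ℕ, ∑ k ∈ Finset.Icc (-(n : ℤ)) n, (2 : ℝ)⁻¹ ^ k.natAbs ≤ 3 - 2 * 2⁻¹ ^ n := by
    intro n
    induction n with
    | zero => norm_num
    | succ n ih =>
      have : Finset.Icc (-((n + 1 : ℕ) : ℤ)) ((n + 1 : ℕ) : ℤ)
          = insert (-((n + 1 : ℕ) : ℤ)) (insert ((n + 1 : ℕ) : ℤ) (Finset.Icc (-(n : ℤ)) n)) := by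
        ext k; simp; omega
      rw [this, Finset.sum_insert, Finset.sum_insert]
      · rw [Int.natAbs_neg, Int.natAbs_natCast, pow_succ]
        linarith
      · simp
      · simp; omega
  obtain ⟨n, hn⟩ : ∃ n : ℕ, s ⊆ Finset.Icc (-(n : ℤ)) n := by
    refine ⟨s.sup Int.natAbs, fun k hk => ?_⟩
    have : k.natAbs ≤ s.sup Int.natAbs := Finset.le_sup (f := Int.natAbs) hk
    simp; omega
  have h1 := Finset.sum_le_sum_of_subset_of_nonneg (f := fun k : ℤ => (2 : ℝ)⁻¹ ^ k.natAbs) hn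
    (fun i _ _ => by positivity)
  have h2 := key n
  have : (0:ℝ) < 2⁻¹ ^ n := by positivity
  linarith

/-- `u` as an element of `KK` -/
def uK : KK := ⟨uf, memK uf 3 fun s => by
  refine le_trans (Finset.sum_le_sum fun k _ => ?_) (sum_half_natAbs s)
  have h1 := uf_le_abs k
  have h2 := uf_pos k
  have h3 : (2 : ℝ)⁻¹ ^ k.natAbs ≤ 1 := pow_le_one₀ (by norm_num) (by norm_num)
  nlinarith⟩

@[simp] lemma uK_apply (k : ℤ) : uK k = uf k := rfl

lemma uK_norm : ‖uK‖ ≤ 2 := by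
  have : ‖uK‖ ^ 2 ≤ 3 := by
    apply normK_sq_le
    intro s
    refine le_trans (Finset.sum_le_sum fun k _ => ?_) (sum_half_natAbs s)
    have h1 := uf_le_abs k
    have h2 := uf_pos k
    have h3 : (2 : ℝ)⁻¹ ^ k.natAbs ≤ 1 := pow_le_one₀ (by norm_num) (by norm_num)
    rw [uK_apply]
    nlinarith
  nlinarith [norm_nonneg uK]

/-- canonical path -/
def cp : (ℕ →₀ ℝ) →ₗ[ℝ] AA :=
  Finsupp.mapRange.linearMap (LinearMap.toSpanSingleton ℝ KK uK)

@[simp] lemma cp_apply (x : ℕ →₀ ℝ) (n : ℕ) : cp x n = x n • uK := rfl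

lemma cp_path (x : ℕ →₀ ℝ) : IsPath x (cp x) (cp x) := by
  intro n k
  simp only [cp_apply, lp.coeFn_smul, Pi.smul_apply, smul_eq_mul, uK_apply]
  have := uf_spec k
  linear_combination (x n) * this
end
end GMHI

set_option linter.unusedVariables false
set_option linter.unusedSimpArgs false
namespace GMHI
open Finset
noncomputable section

/-- hypotheses on a left norm -/
structure IsLN (L : AA → ℝ) : Prop where
  add : ∀ a b, L (a + b) ≤ L a + L b
  smul : ∀ (c : ℝ) a, L (c • a) = |c| * L a
  shift : ∀ m a, L (sA m a) = L a
  low : ∀ a n, ‖a n‖ ≤ L a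
  up : ∀ a, L a ≤ n1 a
  proj : ∀ p q a, L (Pr p q a) ≤ L a
  dual : ∀ a (ε : ℝ), 0 < ε → ∃ T : AA →ₗ[ℝ] KK, (∀ m a', T (sA m a') = sK m (T a')) ∧
    (∀ a', ‖T a'‖ ≤ L a') ∧ L a - ε ≤ ‖T a‖

lemma IsLN.nonneg {L : AA → ℝ} (h : IsLN L) (a : AA) : 0 ≤ L a := (norm_nonneg _).trans (h.low a 0)
lemma IsLN.zero {L : AA → ℝ} (h : IsLN L) : L 0 = 0 := by
  have := h.smul 0 0
  simpa using this
lemma IsLN.sum {L : AA → ℝ} (h : IsLN L) {ι : Type} (s : Finset ι) (f : ι → AA) :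
    L (∑ i ∈ s, f i) ≤ ∑ i ∈ s, L (f i) := by
  classical
  induction s using Finset.induction_on with
  | empty => simp [h.zero]
  | insert i s hi ih =>
    rw [Finset.sum_insert hi, Finset.sum_insert hi]
    exact (h.add _ _).trans (by linarith)

lemma psd_cs (A : AA →ₗ[ℝ] AA →ₗ[ℝ] ℝ) (hs : ∀ a b, A a b = A b a) (hp : ∀ a, 0 ≤ A a a)
    (a b : AA) : A a b ^ 2 ≤ A a a * A b b := by
  have h : ∀ t : ℝ, 0 ≤ A b b * (t * t) + (2 * A a b) * t + A a a := by
    intro t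
    have := hp (a + t • b)
    simp only [map_add, map_smul, LinearMap.add_apply, LinearMap.smul_apply, smul_eq_mul] at this
    rw [hs b a] at this
    linarith
  have := discrim_le_zero h
  unfold discrim at this
  nlinarith

lemma psd_cs_sqrt (A : AA →ₗ[ℝ] AA →ₗ[ℝ] ℝ) (hs : ∀ a b, A a b = A b a) (hp : ∀ a, 0 ≤ A a a)
    (a b : AA) : |A a b| ≤ √(A a a) * √(A b b) := by
  rw [← Real.sqrt_mul (hp a)]
  exact Real.abs_le_sqrt (psd_cs A hs hp a b)

variable (L : AA → ℝ)
/-- cost of a path -/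
def cost (a b : AA) : ℝ := L a ^ 2 + ip b b

lemma cost_nonneg (a b : AA) : 0 ≤ cost L a b := by
  have := ip_nonneg b
  unfold cost; positivity

/-- The interpolated norm. -/
def NN (x : ℕ →₀ ℝ) : ℝ := sInf {r | ∃ a b, IsPath x a b ∧ r = √(cost L a b)}

lemma NN_bdd (x : ℕ →₀ ℝ) : BddBelow {r | ∃ a b, IsPath x a b ∧ r = √(cost L a b)} :=
  ⟨0, by rintro r ⟨a, b, _, rfl⟩; positivity⟩

lemma NN_nonneg (x : ℕ →₀ ℝ) : 0 ≤ NN L x := by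
  apply Real.sInf_nonneg
  rintro r ⟨a, b, _, rfl⟩; positivity

lemma NN_le {x : ℕ →₀ ℝ} {a b : AA} (h : IsPath x a b) : NN L x ≤ √(cost L a b) :=
  csInf_le (NN_bdd L x) ⟨a, b, h, rfl⟩

lemma NN_sq_le {x : ℕ →₀ ℝ} {a b : AA} (h : IsPath x a b) : NN L x ^ 2 ≤ cost L a b := by
  have := NN_le L h
  have h2 := Real.sq_sqrt (cost_nonneg L a b)
  have := NN_nonneg L x
  nlinarith

lemma NN_le_of {x : ℕ →₀ ℝ} {a b : AA} (h : IsPath x a b) {r : ℝ} (hr : 0 ≤ r)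
    (hc : cost L a b ≤ r ^ 2) : NN L x ≤ r :=
  (NN_le L h).trans (Real.sqrt_le_iff.mpr ⟨hr, hc⟩)

lemma exists_path {x : ℕ →₀ ℝ} {r : ℝ} (h : NN L x < r) :
    ∃ a b, IsPath x a b ∧ cost L a b < r ^ 2 := by
  obtain ⟨_, ⟨a, b, hp, rfl⟩, hr⟩ := exists_lt_of_csInf_lt (s := {r | ∃ a b, IsPath x a b ∧ r = √(cost L a b)})
    ⟨_, _, _, cp_path x, rfl⟩ h
  refine ⟨a, b, hp, ?_⟩
  have h0 := Real.sqrt_nonneg (cost L a b)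
  rw [Real.sqrt_lt' (by linarith)] at hr
  exact hr

variable {L} (hL : IsLN L)
include hL

lemma cost_Pr (p q : ℕ) (a b : AA) : cost L (Pr p q a) (Pr p q b) ≤ cost L a b := by
  unfold cost
  have h1 := hL.proj p q a
  have h2 := hL.nonneg (Pr p q a)
  have h3 := ip_Pr_le p q b
  nlinarith

lemma exists_path_supp {x : ℕ →₀ ℝ} {r : ℝ} (h : NN L x < r) {p q : ℕ} (hx : Supp p q x) :
    ∃ a b, IsPath x a b ∧ cost L a b < r ^ 2 ∧ Supp p q a ∧ Supp p q b := by
  obtain ⟨a, b, h1, h2⟩ := exists_path L h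
  refine ⟨Pr p q a, Pr p q b, ?_, (cost_Pr hL p q a b).trans_lt h2, supp_Pr _ _ _, supp_Pr _ _ _⟩
  have := h1.Pr p q
  rwa [Pr_eq_self hx] at this

lemma NN_Pr (p q : ℕ) (x : ℕ →₀ ℝ) : NN L (Pr p q x) ≤ NN L x := by
  apply le_of_forall_gt
  intro r hr
  obtain ⟨a, b, h1, h2⟩ := exists_path L hr
  have h0 := NN_nonneg L x
  have := NN_sq_le L (h1.Pr p q)
  have h3 := cost_Pr hL p q a b
  have : NN L (Pr p q x) ^ 2 < r ^ 2 := by linarith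
  exact lt_of_pow_lt_pow_left₀ 2 (by linarith) this

lemma cost_smul (c : ℝ) (a b : AA) : cost L (c • a) (c • b) = c ^ 2 * cost L a b := by
  simp only [cost, hL.smul, map_smul, LinearMap.smul_apply, smul_eq_mul, mul_pow, sq_abs]
  ring

lemma cost_dil (s : ℤ) (a b : AA) : cost L ((2 : ℝ) ^ s • sA s a) ((2 : ℝ) ^ (-s) • sA s b)
    = ((2 : ℝ) ^ s * L a) ^ 2 + ((2 : ℝ) ^ (-s)) ^ 2 * ip b b := by
  simp only [cost, hL.smul, map_smul, LinearMap.smul_apply, smul_eq_mul, mul_pow, sq_abs, hL.shift,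
    ip_sA]
  ring

lemma NN_le_dil {x : ℕ →₀ ℝ} {a b : AA} (h : IsPath x a b) (s : ℤ) :
    NN L x ≤ (2 : ℝ) ^ s * L a + (2 : ℝ) ^ (-s) * √(ip b b) := by
  have h0 := hL.nonneg a
  have h1 : (0 : ℝ) < (2 : ℝ) ^ s := by positivity
  have h2 : (0 : ℝ) < (2 : ℝ) ^ (-s) := by positivity
  have h3 := Real.sqrt_nonneg (ip b b)
  apply NN_le_of L (h.dil s) (by positivity)
  rw [cost_dil hL]
  have h4 := Real.sq_sqrt (ip_nonneg b)
  have : 0 ≤ ((2 : ℝ) ^ s * L a) * ((2 : ℝ) ^ (-s) * √(ip b b)) := by positivity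
  nlinarith

lemma NN_smul_le (c : ℝ) (x : ℕ →₀ ℝ) : NN L (c • x) ≤ |c| * NN L x := by
  have key : ∀ r, NN L x < r → NN L (c • x) ≤ |c| * r := by
    intro r hr
    obtain ⟨a, b, h1, h2⟩ := exists_path L hr
    have h0 := NN_nonneg L x
    apply NN_le_of L (h1.smul c) (mul_nonneg (abs_nonneg _) (by linarith))
    rw [cost_smul hL, mul_pow, sq_abs]
    nlinarith [sq_nonneg c]
  apply le_of_forall_pos_le_add
  intro ε hε
  have h := key (NN L x + ε / (|c| + 1)) (by
    have : 0 < ε / (|c| + 1) := by positivity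
    linarith)
  refine h.trans ?_
  rw [mul_add]
  have : |c| * (ε / (|c| + 1)) ≤ ε := by
    rw [mul_div_assoc', div_le_iff₀ (by positivity)]
    nlinarith [abs_nonneg c]
  linarith

lemma NN_smul (c : ℝ) (x : ℕ →₀ ℝ) : NN L (c • x) = |c| * NN L x := by
  apply le_antisymm (NN_smul_le hL c x)
  by_cases hc : c = 0
  · simp [hc, NN_nonneg]
  have h := NN_smul_le hL c⁻¹ (c • x)
  rw [smul_smul, inv_mul_cancel₀ hc, one_smul, abs_inv] at h
  have : 0 < |c| := abs_pos.mpr hc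
  rwa [← div_eq_inv_mul, le_div_iff₀' this] at h

lemma NN_add (x y : ℕ →₀ ℝ) : NN L (x + y) ≤ NN L x + NN L y := by
  have key : ∀ r s, NN L x < r → NN L y < s → NN L (x + y) ≤ r + s := by
    intro r s hr hs
    obtain ⟨a, b, h1, h2⟩ := exists_path L hr
    obtain ⟨a', b', h1', h2'⟩ := exists_path L hs
    have h0 := NN_nonneg L x
    have h0' := NN_nonneg L y
    apply NN_le_of L (h1.add h1') (by linarith)
    have e1 := hL.add a a'
    have e2 := hL.nonneg a
    have e3 := hL.nonneg a'
    have e4 := hL.nonneg (a + a')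
    have e5 := le_of_abs_le (psd_cs_sqrt ip ip_symm ip_nonneg b b')
    have e6 := Real.sq_sqrt (ip_nonneg b)
    have e7 := Real.sq_sqrt (ip_nonneg b')
    unfold cost at *
    have e8 : ip (b + b') (b + b') = ip b b + ip b' b' + 2 * ip b b' := by
      simp only [map_add, LinearMap.add_apply]
      rw [ip_symm b' b]; ring
    rw [e8]
    set s1 := √(ip b b)
    set s2 := √(ip b' b')
    rw [← e6] at h2 ⊢
    rw [← e7] at h2' ⊢
    have e9 : L a * L a' + s1 * s2 ≤ r * s := by
      apply le_of_abs_le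
      apply abs_le_of_sq_le_sq _ (by nlinarith)
      have : (L a ^ 2 + s1 ^ 2) * (L a' ^ 2 + s2 ^ 2) ≤ r ^ 2 * s ^ 2 := by
        apply mul_le_mul h2.le h2'.le (by positivity) (by positivity)
      nlinarith [sq_nonneg (L a * s2 - L a' * s1)]
    nlinarith
  apply le_of_forall_pos_le_add
  intro ε hε
  have := key (NN L x + ε / 2) (NN L y + ε / 2) (by linarith) (by linarith)
  linarith

lemma NN_coord (x : ℕ →₀ ℝ) (n : ℕ) : |x n| ≤ 2 * NN L x := by
  rw [← sub_nonneg]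
  apply le_of_forall_pos_le_add
  intro ε hε
  obtain ⟨a, b, h1, h2⟩ := exists_path L (show NN L x < NN L x + ε / 2 by linarith)
  have h := h1 n 0
  simp only [zpow_zero, one_mul, neg_zero] at h
  have h3 := absK_le (a n) 0
  have h4 := absK_le (b n) 0
  have h5 := hL.low a n
  have h6 := norm_sq_le_ip b n
  have h0 := NN_nonneg L x
  unfold cost at h2
  have h7 : |b n 0| ≤ NN L x + ε / 2 := by
    apply abs_le_of_sq_le_sq _ (by linarith)
    have := abs_le_abs_of_nonneg (abs_nonneg _) h4
    have : (b n 0) ^ 2 ≤ ‖b n‖ ^ 2 := by rw [← sq_abs]; gcongr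
    nlinarith
  have h8 : |a n 0| ≤ NN L x + ε / 2 := by
    apply abs_le_of_sq_le_sq _ (by linarith)
    have : (a n 0) ^ 2 ≤ L a ^ 2 := by rw [← sq_abs]; gcongr; linarith
    have := ip_nonneg b
    nlinarith
  have := abs_add_le (a n 0) (b n 0)
  rw [h] at this
  linarith

lemma NN_zero : NN L 0 = 0 := by simpa using NN_smul hL 0 0

lemma NN_eq_zero {x : ℕ →₀ ℝ} (h : NN L x = 0) : x = 0 := by
  ext n
  have := NN_coord hL x n
  rw [h] at this
  simpa using this

lemma NN_sum {ι : Type} (s : Finset ι) (f : ι → ℕ →₀ ℝ) :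
    NN L (∑ i ∈ s, f i) ≤ ∑ i ∈ s, NN L (f i) := by
  classical
  induction s using Finset.induction_on with
  | empty => simp [NN_zero hL]
  | insert i s hi ih =>
    rw [Finset.sum_insert hi, Finset.sum_insert hi]
    exact (NN_add hL _ _).trans (by linarith)
end
end GMHI

set_option linter.unusedVariables false
set_option linter.unusedSimpArgs false
namespace GMHI
open Finset
noncomputable section

/-- admissible forms -/
structure Form (L : AA → ℝ) (A : AA →ₗ[ℝ] AA →ₗ[ℝ] ℝ) : Prop where
  symm : ∀ a b, A a b = A b a
  shift : ∀ m a b, A (sA m a) (sA m b) = A a b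
  nonneg : ∀ a, 0 ≤ A a a
  le : ∀ a, A a a ≤ L a ^ 2

/-- coercive localized forms -/
structure CForm (L : AA → ℝ) (p q : ℕ) (κ : ℝ) (A : AA →ₗ[ℝ] AA →ₗ[ℝ] ℝ) : Prop
    extends Form L A where
  loc : ∀ a b, A (Pr p q a) (Pr p q b) = A a b
  coer : ∀ a, κ * ∑ n ∈ Ico p q, ‖a n‖ ^ 2 ≤ A a a

lemma ip_le_n1 (b : AA) : √(ip b b) ≤ n1 b := by
  rw [Real.sqrt_le_iff]
  refine ⟨n1_nonneg b, ?_⟩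
  rw [ip_self]
  exact Finset.sum_sq_le_sq_sum_of_nonneg fun i _ => norm_nonneg _

/-- the auxiliary Hilbert space -/
abbrev HH (p q : ℕ) : Type := PiLp 2 (fun _ : Bool × ↥(Ico p q) => KK)

/-- evaluation -/
def evK (k : ℤ) : KK →L[ℝ] ℝ :=
  LinearMap.mkContinuous { toFun := fun x : KK => x k, map_add' := fun x y => rfl, map_smul' := fun c x => rfl } 1
    (fun x => by rw [one_mul]; exact absK_le x k)

lemma evK_apply (k : ℤ) (x : KK) : evK k x = x k := rfl

/-- embedding of components -/
def eH (p q : ℕ) (c : Bool) : HH p q →ₗ[ℝ] AA :=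
  ∑ i : ↥(Ico p q), (Finsupp.lsingle (i : ℕ)).comp (PiLp.projₗ 2 (fun _ : Bool × ↥(Ico p q) => KK) (c, i))

lemma eH_apply (p q : ℕ) (c : Bool) (h : HH p q) (i : ↥(Ico p q)) : eH p q c h i = h (c, i) := by
  simp only [eH, LinearMap.sum_apply, LinearMap.comp_apply, Finsupp.lsingle_apply,
    PiLp.projₗ_apply, Finsupp.finsetSum_apply]
  rw [Finset.sum_eq_single i]
  · simp
  · intro j _ hj
    rw [Finsupp.single_apply, if_neg]
    intro h; exact hj (Subtype.ext h)
  · simp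

lemma eH_supp (p q : ℕ) (c : Bool) (h : HH p q) : Supp p q (eH p q c h) := by
  intro n hn
  by_contra hc
  apply hn
  simp only [eH, LinearMap.sum_apply, LinearMap.comp_apply, Finsupp.lsingle_apply,
    PiLp.projₗ_apply, Finsupp.finsetSum_apply]
  apply Finset.sum_eq_zero
  intro i _
  rw [Finsupp.single_apply, if_neg]
  rintro rfl
  exact hc (Finset.mem_Ico.mp i.2)

lemma eH_mem {p q : ℕ} {a : AA} (ha : Supp p q a) : ∀ n, a n ≠ 0 → n ∈ Ico p q := by
  intro n hn; simpa using ha n hn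

lemma eH_n1 (p q : ℕ) (c : Bool) (h : HH p q) : n1 (eH p q c h) ≤ (q - p : ℕ) * ‖h‖ := by
  rw [n1_eq_sum _ (Ico p q) (eH_mem (eH_supp p q c h))]
  calc ∑ n ∈ Ico p q, ‖eH p q c h n‖ ≤ ∑ n ∈ Ico p q, ‖h‖ := by
        apply Finset.sum_le_sum
        intro n hn
        rw [show eH p q c h n = h (c, ⟨n, hn⟩) from eH_apply p q c h ⟨n, hn⟩]
        exact PiLp.norm_apply_le h _
    _ = _ := by simp

/-- zero path submodule -/
def ZH (p q : ℕ) : Submodule ℝ (HH p q) where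
  carrier := {h | ∀ (i : ↥(Ico p q)) (k : ℤ),
    (2 : ℝ) ^ k * evK k (h (false, i)) + (2 : ℝ) ^ (-k) * evK k (h (true, i)) = 0}
  add_mem' := by
    intro x y hx hy i k
    have h1 := hx i k
    have h2 := hy i k
    simp only [PiLp.add_apply, map_add]
    linarith
  zero_mem' := by intro i k; simp
  smul_mem' := by
    intro c x hx i k
    have h1 := hx i k
    simp only [PiLp.smul_apply, map_smul, smul_eq_mul]
    linear_combination c * h1

lemma ZH_closed (p q : ℕ) : IsClosed (ZH p q : Set (HH p q)) := by
  have : (ZH p q : Set (HH p q)) = ⋂ (i : ↥(Ico p q)), ⋂ (k : ℤ), {h |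
    (2 : ℝ) ^ k * evK k (h (false, i)) + (2 : ℝ) ^ (-k) * evK k (h (true, i)) = 0} := by
    ext h; simp only [Set.mem_iInter]; rfl
  rw [this]
  refine isClosed_iInter fun i => isClosed_iInter fun k => isClosed_eq ?_ continuous_const
  have h1 : ∀ c, Continuous fun h : HH p q => h (c, i) := fun c =>
    PiLp.continuous_apply 2 (fun _ : Bool × ↥(Ico p q) => KK) (c, i)
  have h2 : ∀ c, Continuous fun h : HH p q => evK k (h (c, i)) := fun c =>
    (evK k).continuous.comp (h1 c)
  exact (continuous_const.mul (h2 false)).add (continuous_const.mul (h2 true))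

lemma ZH_path {p q : ℕ} {h : HH p q} (hh : h ∈ ZH p q) : IsPath 0 (eH p q false h) (eH p q true h) := by
  intro n k
  by_cases hn : n ∈ Ico p q
  · have := hh ⟨n, hn⟩ k
    rw [← eH_apply, ← eH_apply] at this
    exact this
  · have h1 : ∀ c, eH p q c h n = 0 := by
      intro c
      by_contra h2
      exact hn (eH_mem (eH_supp p q c h) n h2)
    simp [h1]

lemma ZH_of_path {p q : ℕ} {a b : AA} (hp : IsPath 0 a b) (ha : Supp p q a) (hb : Supp p q b) :
    ∃ h ∈ ZH p q, eH p q false h = a ∧ eH p q true h = b := by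
  let h : HH p q := WithLp.toLp 2 (fun ci => if ci.1 then b ci.2 else a ci.2)
  have e0 : ∀ i, h (false, i) = a i := fun i => rfl
  have e1 : ∀ i, h (true, i) = b i := fun i => rfl
  refine ⟨h, ?_, ?_, ?_⟩
  · intro i k
    rw [e0, e1]
    exact hp i k
  · ext1 n
    by_cases hn : n ∈ Ico p q
    · rw [show eH p q false h n = h (false, ⟨n, hn⟩) from eH_apply p q false h ⟨n, hn⟩, e0]
    · have h1 : eH p q false h n = 0 := by
        by_contra h2
        exact hn (eH_mem (eH_supp p q _ h) n h2)
      have h3 : a n = 0 := by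
        by_contra h2
        exact hn (eH_mem ha n h2)
      rw [h1, h3]
  · ext1 n
    by_cases hn : n ∈ Ico p q
    · rw [show eH p q true h n = h (true, ⟨n, hn⟩) from eH_apply p q true h ⟨n, hn⟩, e1]
    · have h1 : eH p q true h n = 0 := by
        by_contra h2
        exact hn (eH_mem (eH_supp p q _ h) n h2)
      have h3 : b n = 0 := by
        by_contra h2
        exact hn (eH_mem hb n h2)
      rw [h1, h3]

lemma Form.abs_le {L : AA → ℝ} (hL : IsLN L) {A : AA →ₗ[ℝ] AA →ₗ[ℝ] ℝ} (hA : Form L A) (a b : AA) :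
    |A a b| ≤ L a * L b := by
  refine (psd_cs_sqrt A hA.symm hA.nonneg a b).trans ?_
  have h1 : ∀ a, √(A a a) ≤ L a := fun a => Real.sqrt_le_iff.mpr ⟨hL.nonneg a, hA.le a⟩
  exact mul_le_mul (h1 a) (h1 b) (Real.sqrt_nonneg _) (hL.nonneg a)

theorem minimizer {L : AA → ℝ} (hL : IsLN L) {p q : ℕ} {κ : ℝ} (hκ : 0 < κ)
    {A : AA →ₗ[ℝ] AA →ₗ[ℝ] ℝ} (hA : CForm L p q κ A) {x : ℕ →₀ ℝ} (hx : Supp p q x) :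
    ∃ a b, IsPath x a b ∧ Supp p q a ∧ Supp p q b ∧
      ∀ a' b', IsPath 0 a' b' → A a a' + ip b b' = 0 := by
  have : CompleteSpace (ZH p q) := (ZH_closed p q).completeSpace_coe
  set M : ℝ := ((q - p : ℕ) : ℝ) with hM
  have hM0 : 0 ≤ M := by positivity
  let ea : ZH p q →ₗ[ℝ] AA := (eH p q false).comp (ZH p q).subtype
  let eb : ZH p q →ₗ[ℝ] AA := (eH p q true).comp (ZH p q).subtype
  have hbA : ∀ a b : AA, |A a b| ≤ n1 a * n1 b := fun a b =>
    (hA.toForm.abs_le hL a b).trans (mul_le_mul (hL.up a) (hL.up b) (hL.nonneg _) (n1_nonneg _))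
  have hbI : ∀ a b : AA, |ip a b| ≤ n1 a * n1 b := fun a b =>
    (psd_cs_sqrt ip ip_symm ip_nonneg a b).trans
      (mul_le_mul (ip_le_n1 a) (ip_le_n1 b) (Real.sqrt_nonneg _) (n1_nonneg _))
  have hna : ∀ h : ZH p q, n1 (ea h) ≤ M * ‖h‖ := fun h => eH_n1 p q false h
  have hnb : ∀ h : ZH p q, n1 (eb h) ≤ M * ‖h‖ := fun h => eH_n1 p q true h
  let B0 : ZH p q →ₗ[ℝ] ZH p q →ₗ[ℝ] ℝ := A.compl₁₂ ea ea + ip.compl₁₂ eb eb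
  have hB0 : ∀ h h', B0 h h' = A (ea h) (ea h') + ip (eb h) (eb h') := fun h h' => rfl
  have hBb : ∀ h h', ‖B0 h h'‖ ≤ (2 * M * M) * ‖h‖ * ‖h'‖ := by
    intro h h'
    rw [hB0, Real.norm_eq_abs]
    refine (abs_add_le _ _).trans ?_
    have h1 := (hbA (ea h) (ea h')).trans (mul_le_mul (hna h) (hna h') (n1_nonneg _) (by positivity))
    have h2 := (hbI (eb h) (eb h')).trans (mul_le_mul (hnb h) (hnb h') (n1_nonneg _) (by positivity))
    linarith
  let B : ZH p q →L[ℝ] ZH p q →L[ℝ] ℝ := B0.mkContinuous₂ (2 * M * M) hBb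
  have hB : ∀ h h', B h h' = A (ea h) (ea h') + ip (eb h) (eb h') := fun h h' => rfl
  have hco : IsCoercive B := by
    refine ⟨min κ 1, lt_min hκ one_pos, fun h => ?_⟩
    rw [hB]
    have e1 := hA.coer (ea h)
    have e2 : ip (eb h) (eb h) = ∑ n ∈ Ico p q, ‖eb h n‖ ^ 2 :=
      ip_self_eq_sum _ _ (eH_mem (eH_supp p q _ _))
    have e3 : ‖h‖ * ‖h‖ = ∑ n ∈ Ico p q, ‖ea h n‖ ^ 2 + ∑ n ∈ Ico p q, ‖eb h n‖ ^ 2 := by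
      rw [← sq, Submodule.coe_norm, PiLp.norm_sq_eq_of_L2, Fintype.sum_prod_type, Fintype.sum_bool,
        add_comm, ← Finset.sum_coe_sort (Ico p q), ← Finset.sum_coe_sort (Ico p q)]
      congr 1
      · apply Finset.sum_congr rfl; intro i _
        rw [show ea h i = (h : HH p q) (false, i) from eH_apply p q false h i]
      · apply Finset.sum_congr rfl; intro i _
        rw [show eb h i = (h : HH p q) (true, i) from eH_apply p q true h i]
    rw [mul_assoc, e3, e2, mul_add]
    have e4 : 0 ≤ ∑ n ∈ Ico p q, ‖ea h n‖ ^ 2 := by positivity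
    have e5 : 0 ≤ ∑ n ∈ Ico p q, ‖eb h n‖ ^ 2 := by positivity
    have := mul_le_mul_of_nonneg_right (min_le_left κ 1) e4
    have := mul_le_mul_of_nonneg_right (min_le_right κ 1) e5
    linarith
  have hx0 : IsPath x (Pr p q (cp x)) (Pr p q (cp x)) := by
    have := (cp_path x).Pr p q
    rwa [Pr_eq_self hx] at this
  set a0 := Pr p q (cp x) with ha0
  have hs0 : Supp p q a0 := supp_Pr _ _ _
  let f0 : ZH p q →ₗ[ℝ] ℝ := (A a0).comp ea + (ip a0).comp eb
  let f : ZH p q →L[ℝ] ℝ := f0.mkContinuous (2 * n1 a0 * M) (by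
    intro h
    rw [show f0 h = A a0 (ea h) + ip a0 (eb h) from rfl, Real.norm_eq_abs]
    refine (abs_add_le _ _).trans ?_
    have h1 := (hbA a0 (ea h)).trans (mul_le_mul_of_nonneg_left (hna h) (n1_nonneg _))
    have h2 := (hbI a0 (eb h)).trans (mul_le_mul_of_nonneg_left (hnb h) (n1_nonneg _))
    linarith)
  have hf : ∀ h, f h = A a0 (ea h) + ip a0 (eb h) := fun h => rfl
  let r := (InnerProductSpace.toDual ℝ (ZH p q)).symm f
  have hr : ∀ h, inner ℝ r h = f h := fun h => InnerProductSpace.toDual_symm_apply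
  let v := hco.continuousLinearEquivOfBilin.symm r
  have hv : ∀ h, B v h = f h := by
    intro h
    rw [← hr, ← hco.continuousLinearEquivOfBilin_apply v h]
    simp [v]
  refine ⟨a0 - ea v, a0 - eb v, ?_, ?_, ?_, ?_⟩
  · have := hx0.sub (ZH_path v.2)
    rwa [sub_zero] at this
  · rw [sub_eq_add_neg, ← neg_one_smul ℝ]
    exact hs0.add ((eH_supp p q false v).smul _)
  · rw [sub_eq_add_neg, ← neg_one_smul ℝ]
    exact hs0.add ((eH_supp p q true v).smul _)
  · intro a' b' hp'
    have hsa : Supp p q (a0 - ea v) := by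
      rw [sub_eq_add_neg, ← neg_one_smul ℝ]
      exact hs0.add ((eH_supp p q false v).smul _)
    have hsb : Supp p q (a0 - eb v) := by
      rw [sub_eq_add_neg, ← neg_one_smul ℝ]
      exact hs0.add ((eH_supp p q true v).smul _)
    have hp2 := hp'.Pr p q
    rw [map_zero] at hp2
    obtain ⟨h, hh, h1, h2⟩ := ZH_of_path hp2 (supp_Pr _ _ _) (supp_Pr _ _ _)
    have e1 : A (a0 - ea v) a' = A (a0 - ea v) (ea ⟨h, hh⟩) := by
      rw [show ea ⟨h, hh⟩ = Pr p q a' from h1, ← hA.loc, ← hA.loc (a0 - ea v) (Pr p q a'), Pr_idem]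
    have e2 : ip (a0 - eb v) b' = ip (a0 - eb v) (eb ⟨h, hh⟩) := by
      rw [show eb ⟨h, hh⟩ = Pr p q b' from h2, ← ip_Pr_left, Pr_eq_self hsb]
    have e3 := hv ⟨h, hh⟩
    rw [hf, hB] at e3
    rw [e1, e2, map_sub, map_sub, LinearMap.sub_apply, LinearMap.sub_apply]
    linarith
end
end GMHI

set_option linter.unusedVariables false
set_option linter.unusedSimpArgs false
namespace GMHI
open Finset
noncomputable section

/-- total form -/
def cF (A : AA →ₗ[ℝ] AA →ₗ[ℝ] ℝ) (a b a' b' : AA) : ℝ := A a a' + ip b b'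

lemma cF_add_self {A : AA →ₗ[ℝ] AA →ₗ[ℝ] ℝ} (hs : ∀ a b, A a b = A b a) (a b a' b' : AA) :
    cF A (a + a') (b + b') (a + a') (b + b') = cF A a b a b + 2 * cF A a b a' b' + cF A a' b' a' b' := by
  simp only [cF, map_add, LinearMap.add_apply]
  rw [hs a' a, ip_symm b' b]; ring

lemma cF_nonneg {A : AA →ₗ[ℝ] AA →ₗ[ℝ] ℝ} (hp : ∀ a, 0 ≤ A a a) (a b : AA) : 0 ≤ cF A a b a b :=
  add_nonneg (hp a) (ip_nonneg b)

lemma cF_quad {A : AA →ₗ[ℝ] AA →ₗ[ℝ] ℝ} (hs : ∀ a b, A a b = A b a) (hp : ∀ a, 0 ≤ A a a)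
    (a b a' b' : AA) (t θ : ℝ) (hθ : 0 < θ) :
    - (t ^ 2 / θ * cF A a b a b) ≤ 2 * t * cF A a b a' b' + θ * cF A a' b' a' b' := by
  have h := cF_nonneg hp (t • a + θ • a') (t • b + θ • b')
  rw [cF_add_self hs] at h
  have e1 : cF A (t • a) (t • b) (t • a) (t • b) = t ^ 2 * cF A a b a b := by
    simp only [cF, map_smul, LinearMap.smul_apply, smul_eq_mul]; ring
  have e2 : cF A (t • a) (t • b) (θ • a') (θ • b') = t * θ * cF A a b a' b' := by
    simp only [cF, map_smul, LinearMap.smul_apply, smul_eq_mul]; ring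
  have e3 : cF A (θ • a') (θ • b') (θ • a') (θ • b') = θ ^ 2 * cF A a' b' a' b' := by
    simp only [cF, map_smul, LinearMap.smul_apply, smul_eq_mul]; ring
  rw [e1, e2, e3] at h
  have : t ^ 2 / θ * cF A a b a b + (2 * t * cF A a b a' b' + θ * cF A a' b' a' b')
    = (t ^ 2 * cF A a b a b + 2 * (t * θ * cF A a b a' b') + θ ^ 2 * cF A a' b' a' b') / θ := by
    field_simp
    ring
  have h2 := div_nonneg h hθ.le
  rw [← this] at h2
  linarith

/-- with exact minimizer the cost splits -/
lemma cF_split {A : AA →ₗ[ℝ] AA →ₗ[ℝ] ℝ} (hs : ∀ a b, A a b = A b a) {x : ℕ →₀ ℝ} {a b : AA}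
    (hp : IsPath x a b) (ho : ∀ a' b', IsPath 0 a' b' → A a a' + ip b b' = 0) {a' b' : AA}
    (hp' : IsPath x a' b') : cF A a' b' a' b' = cF A a b a b + cF A (a' - a) (b' - b) (a' - a) (b' - b) := by
  have h := cF_add_self hs a b (a' - a) (b' - b)
  have h2 := hp'.sub hp
  rw [sub_self] at h2
  have h3 : cF A a b (a' - a) (b' - b) = 0 := ho _ _ h2
  rw [h3] at h
  simpa using h

variable {L : AA → ℝ}

lemma Form.comb {A A' : AA →ₗ[ℝ] AA →ₗ[ℝ] ℝ} (hA : Form L A) (hA' : Form L A') {t : ℝ} (h0 : 0 ≤ t)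
    (h1 : t ≤ 1) : Form L ((1 - t) • A + t • A') where
  symm a b := by
    simp only [LinearMap.add_apply, LinearMap.smul_apply]; rw [hA.symm, hA'.symm]
  shift m a b := by
    simp only [LinearMap.add_apply, LinearMap.smul_apply]; rw [hA.shift, hA'.shift]
  nonneg a := by
    simp only [LinearMap.add_apply, LinearMap.smul_apply, smul_eq_mul]
    exact add_nonneg (mul_nonneg (by linarith) (hA.nonneg a)) (mul_nonneg h0 (hA'.nonneg a))
  le a := by
    simp only [LinearMap.add_apply, LinearMap.smul_apply, smul_eq_mul]
    have := mul_le_mul_of_nonneg_left (hA.le a) (show 0 ≤ 1 - t by linarith)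
    have := mul_le_mul_of_nonneg_left (hA'.le a) h0
    linarith

lemma CForm.comb {A A' : AA →ₗ[ℝ] AA →ₗ[ℝ] ℝ} {p q : ℕ} {κ : ℝ}
    (hA : CForm L p q κ A) (hA' : CForm L p q κ A') {t : ℝ} (h0 : 0 ≤ t)
    (h1 : t ≤ 1) : CForm L p q κ ((1 - t) • A + t • A') where
  toForm := hA.toForm.comb hA'.toForm h0 h1
  loc a b := by
    simp only [LinearMap.add_apply, LinearMap.smul_apply]; rw [hA.loc, hA'.loc]
  coer a := by
    simp only [LinearMap.add_apply, LinearMap.smul_apply, smul_eq_mul]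
    have := mul_le_mul_of_nonneg_left (hA.coer a) (show 0 ≤ 1 - t by linarith)
    have := mul_le_mul_of_nonneg_left (hA'.coer a) h0
    linarith

/-- coordinate form -/
def A00 (p q : ℕ) : AA →ₗ[ℝ] AA →ₗ[ℝ] ℝ := ip.compl₁₂ (Pr p q) (Pr p q)

lemma A00_apply (p q : ℕ) (a b : AA) : A00 p q a b = ip (Pr p q a) (Pr p q b) := rfl

lemma A00_self (p q : ℕ) (a : AA) : A00 p q a a = ∑ n ∈ Ico p q, ‖a n‖ ^ 2 := by
  rw [A00_apply, ip_self_eq_sum _ (Ico p q) (eH_mem (supp_Pr p q a))]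
  apply Finset.sum_congr rfl
  intro n hn
  rw [Pr_apply, if_pos (by simpa using hn)]

/-- form attached to an operator -/
def AT (T : AA →ₗ[ℝ] KK) (p q : ℕ) : AA →ₗ[ℝ] AA →ₗ[ℝ] ℝ :=
  (innerₗ KK).compl₁₂ (T.comp (Pr p q)) (T.comp (Pr p q))

lemma AT_apply (T : AA →ₗ[ℝ] KK) (p q : ℕ) (a b : AA) :
    AT T p q a b = inner ℝ (T (Pr p q a)) (T (Pr p q b)) := rfl

lemma cform_mk (hL : IsLN L) {T : AA →ₗ[ℝ] KK} (hT : ∀ m a', T (sA m a') = sK m (T a'))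
    (hb : ∀ a', ‖T a'‖ ≤ L a') (p q : ℕ) {δ : ℝ} (h0 : 0 ≤ δ) (h1 : δ ≤ 1) :
    CForm L p q (δ / ((q - p : ℕ) + 1)) ((1 - δ) • AT T p q + δ • ((((q - p : ℕ) : ℝ) + 1)⁻¹ • A00 p q)) := by
  have hF1 : Form L (AT T p q) := by
    refine ⟨fun a b => ?_, fun m a b => ?_, fun a => ?_, fun a => ?_⟩
    · rw [AT_apply, AT_apply, real_inner_comm]
    · rw [AT_apply, AT_apply, ← sA_Pr, ← sA_Pr, hT, hT, sK_inner]
    · rw [AT_apply]; exact real_inner_self_nonneg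
    · rw [AT_apply, real_inner_self_eq_norm_sq]
      have := (hb (Pr p q a)).trans (hL.proj p q a)
      gcongr
  have hF2 : Form L ((((q - p : ℕ) : ℝ) + 1)⁻¹ • A00 p q) := by
    refine ⟨fun a b => ?_, fun m a b => ?_, fun a => ?_, fun a => ?_⟩
    · simp only [LinearMap.smul_apply, A00_apply]; rw [ip_symm]
    · simp only [LinearMap.smul_apply, A00_apply]; rw [← sA_Pr, ← sA_Pr, ip_sA]
    · simp only [LinearMap.smul_apply, A00_apply, smul_eq_mul]
      exact mul_nonneg (by positivity) (ip_nonneg _)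
    · simp only [LinearMap.smul_apply, A00_self, smul_eq_mul]
      rw [inv_mul_le_iff₀ (by positivity)]
      calc ∑ n ∈ Ico p q, ‖a n‖ ^ 2 ≤ ∑ n ∈ Ico p q, L a ^ 2 := by
            apply Finset.sum_le_sum; intro n _
            have := hL.low a n
            gcongr
        _ = (q - p : ℕ) * L a ^ 2 := by simp
        _ ≤ _ := by nlinarith [sq_nonneg (L a)]
  refine ⟨hF1.comb hF2 h0 h1, fun a b => ?_, fun a => ?_⟩
  · simp only [LinearMap.add_apply, LinearMap.smul_apply, AT_apply, A00_apply, Pr_idem]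
  · simp only [LinearMap.add_apply, LinearMap.smul_apply, A00_self, smul_eq_mul]
    have := mul_nonneg (show 0 ≤ 1 - δ by linarith) (hF1.nonneg a)
    rw [div_eq_mul_inv, mul_assoc]
    linarith

lemma sq_sum_le (p q : ℕ) (f : ℕ → ℝ) : (∑ n ∈ Ico p q, f n) ^ 2 ≤ ((q - p : ℕ) + 1) * ∑ n ∈ Ico p q, f n ^ 2 := by
  have h := sq_sum_le_card_mul_sum_sq (s := Ico p q) (f := f)
  simp only [Nat.card_Ico] at h
  have : 0 ≤ ∑ n ∈ Ico p q, f n ^ 2 := by positivity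
  linarith

set_option maxHeartbeats 2000000 in
theorem minimax (hL : IsLN L) {p q : ℕ} {x : ℕ →₀ ℝ} (hx : Supp p q x) {ε : ℝ} (hε : 0 < ε) :
    ∃ A κ, 0 < κ ∧ CForm L p q κ A ∧ ∀ a b, IsPath x a b → NN L x ^ 2 - ε ≤ cF A a b a b := by
  set M : ℝ := ((q - p : ℕ) : ℝ) + 1 with hM
  have hM0 : 0 < M := by positivity
  set δ : ℝ := min (1 / 2) (ε / (4 * (NN L x ^ 2 + 1))) with hδ
  have hδ0 : 0 < δ := by rw [hδ]; positivity
  have hδ1 : δ ≤ 1 := (min_le_left _ _).trans (by norm_num)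
  have hδ2 : δ * NN L x ^ 2 ≤ ε / 4 := by
    have h1 : δ ≤ ε / (4 * (NN L x ^ 2 + 1)) := min_le_right _ _
    have h2 : ε / (4 * (NN L x ^ 2 + 1)) * (NN L x ^ 2 + 1) = ε / 4 := by field_simp
    nlinarith [sq_nonneg (NN L x)]
  set κ : ℝ := δ / M with hκ
  have hκ0 : 0 < κ := by positivity
  set C0 : ℝ := cost L (cp x) (cp x) with hC0
  have hC00 : 0 ≤ C0 := cost_nonneg _ _ _
  have hcle : ∀ A, CForm L p q κ A → cF A (cp x) (cp x) (cp x) (cp x) ≤ C0 := by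
    intro A hA
    have := hA.le (cp x)
    simp only [cF, hC0, cost]; linarith
  let S : Set ℝ := {r | ∃ A, CForm L p q κ A ∧ ∀ a b, IsPath x a b → r ≤ cF A a b a b}
  have hSb : ∀ r ∈ S, r ≤ C0 := by
    rintro r ⟨A, hA, h⟩
    exact (h _ _ (cp_path x)).trans (hcle A hA)
  have hS0 : (0 : ℝ) ∈ S := by
    obtain ⟨T, hT1, hT2, -⟩ := hL.dual 0 1 one_pos
    exact ⟨_, cform_mk hL hT1 hT2 p q hδ0.le hδ1, fun a b _ =>
      cF_nonneg (cform_mk hL hT1 hT2 p q hδ0.le hδ1).nonneg a b⟩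
  have hbdd : BddAbove S := ⟨C0, hSb⟩
  set s := sSup S with hs
  have hs0 : 0 ≤ s := le_csSup hbdd hS0
  have hsC : s ≤ C0 := csSup_le ⟨0, hS0⟩ hSb
  set θ : ℝ := min 1 (κ / (2 * M)) with hθ
  have hθ0 : 0 < θ := by rw [hθ]; positivity
  set η : ℝ := ε / 8 with hη
  have hη0 : 0 < η := by positivity
  set t : ℝ := min (min (1 / 2) (θ / 2)) (min η (η / (1 + 2 * (C0 + 1) / θ))) with ht
  have ht0 : 0 < t := by rw [ht]; positivity
  have ht1 : t ≤ 1 / 2 := (min_le_left _ _).trans (min_le_left _ _)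
  have ht2 : t ≤ θ / 2 := (min_le_left _ _).trans (min_le_right _ _)
  have ht3 : t ≤ η := (min_le_right _ _).trans (min_le_left _ _)
  have ht4 : t * (1 + 2 * (C0 + 1) / θ) ≤ η := by
    have : t ≤ η / (1 + 2 * (C0 + 1) / θ) := (min_le_right _ _).trans (min_le_right _ _)
    rwa [le_div_iff₀ (by positivity)] at this
  obtain ⟨r, ⟨A₁, hA₁, hr⟩, hrs⟩ := exists_lt_of_lt_csSup ⟨0, hS0⟩ (show s - t ^ 2 < s by nlinarith)
  obtain ⟨a₁, b₁, hp₁, hsa, hsb, ho⟩ := minimizer hL hκ0 hA₁ hx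
  set Q := cF A₁ a₁ b₁ a₁ b₁ with hQ
  have hQr : r ≤ Q := hr _ _ hp₁
  have hQs : Q ≤ s := by
    apply le_csSup hbdd
    refine ⟨A₁, hA₁, fun a b hp => ?_⟩
    rw [cF_split hA₁.symm hp₁ ho hp]
    have := cF_nonneg hA₁.nonneg (a - a₁) (b - b₁)
    linarith
  have main : ∀ A, CForm L p q κ A → cF A a₁ b₁ a₁ b₁ ≤ s + η := by
    intro A hA
    set A' := (1 - t) • A₁ + t • A with hA'
    have hA'c : CForm L p q κ A' := hA₁.comb hA ht0.le (by linarith)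
    have hcomb : ∀ a b a' b', cF A' a b a' b' = (1 - t) * cF A₁ a b a' b' + t * cF A a b a' b' := by
      intro a b a' b'
      simp only [cF, hA', LinearMap.add_apply, LinearMap.smul_apply, smul_eq_mul]; ring
    have hdom : ∀ a b, θ * cF A a b a b ≤ cF A' a b a b := by
      intro a b
      rw [hcomb]
      have e1 : A a a ≤ M * ∑ n ∈ Ico p q, ‖a n‖ ^ 2 := by
        rw [← hA.loc]
        refine (hA.le _).trans ?_
        have h1 := hL.up (Pr p q a)
        have h2 := hL.nonneg (Pr p q a)
        rw [n1_eq_sum _ (Ico p q) (eH_mem (supp_Pr p q a))] at h1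
        have h3 : ∑ n ∈ Ico p q, ‖Pr p q a n‖ = ∑ n ∈ Ico p q, ‖a n‖ := by
          apply Finset.sum_congr rfl
          intro n hn
          rw [Pr_apply, if_pos (by simpa using hn)]
        rw [h3] at h1
        calc L (Pr p q a) ^ 2 ≤ (∑ n ∈ Ico p q, ‖a n‖) ^ 2 := by gcongr
          _ ≤ _ := sq_sum_le p q fun n => ‖a n‖
      have e2 := hA₁.coer a
      have e3 : 0 ≤ ∑ n ∈ Ico p q, ‖a n‖ ^ 2 := by positivity
      have e4 := ip_nonneg b
      have e5 := hA.nonneg a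
      have e6 : θ * A a a ≤ 1 / 2 * A₁ a a := by
        calc θ * A a a ≤ κ / (2 * M) * (M * ∑ n ∈ Ico p q, ‖a n‖ ^ 2) := by
              apply mul_le_mul (min_le_right _ _) e1 e5 (by positivity)
          _ = 1 / 2 * (κ * ∑ n ∈ Ico p q, ‖a n‖ ^ 2) := by field_simp
          _ ≤ _ := by linarith
      have e7 : θ * ip b b ≤ ip b b := by
        have : θ ≤ 1 := min_le_left _ _
        nlinarith
      have e8 := hA₁.nonneg a
      have e9 : 0 ≤ t * A a a := by positivity
      have e10 : 1 / 2 * A₁ a a ≤ (1 - t) * A₁ a a := mul_le_mul_of_nonneg_right (by linarith) e8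
      simp only [cF]
      linarith
    have hmem : cF A' a₁ b₁ a₁ b₁ - t ^ 2 / θ * cF A a₁ b₁ a₁ b₁ ≤ s := by
      apply le_csSup hbdd
      refine ⟨A', hA'c, fun a b hp => ?_⟩
      have e1 := cF_add_self hA'c.symm a₁ b₁ (a - a₁) (b - b₁)
      rw [add_sub_cancel, add_sub_cancel] at e1
      have h2 := hp.sub hp₁
      rw [sub_self] at h2
      have h3 : cF A₁ a₁ b₁ (a - a₁) (b - b₁) = 0 := ho _ _ h2
      rw [e1, hcomb a₁ b₁ (a - a₁), h3]
      have e2 := cF_quad hA.symm hA.nonneg a₁ b₁ (a - a₁) (b - b₁) t θ hθ0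
      have e3 := hdom (a - a₁) (b - b₁)
      linarith
    rw [hcomb, ← hQ] at hmem
    set c := cF A a₁ b₁ a₁ b₁ with hc
    have hc0 : 0 ≤ c := cF_nonneg hA.nonneg _ _
    have e1 : c ≤ s + t + t / θ * c := by
      have e2 : t * c ≤ t * (s + t + t / θ * c) := by
        have : t * (t / θ * c) = t ^ 2 / θ * c := by ring
        nlinarith
      exact le_of_mul_le_mul_left e2 ht0
    have e2 : t / θ ≤ 1 / 2 := by rw [div_le_iff₀ hθ0]; linarith
    have e3 : c ≤ 2 * (C0 + 1) := by nlinarith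
    have e4 : t / θ * c ≤ t / θ * (2 * (C0 + 1)) := mul_le_mul_of_nonneg_left e3 (by positivity)
    have e5 : t * (1 + 2 * (C0 + 1) / θ) = t + t / θ * (2 * (C0 + 1)) := by ring
    linarith
  have hfin : (1 - δ) * L a₁ ^ 2 + ip b₁ b₁ ≤ s + 2 * η := by
    have hL0 := hL.nonneg a₁
    obtain ⟨T, hT1, hT2, hT3⟩ := hL.dual a₁ (η / (2 * L a₁ + 1)) (by positivity)
    have h1 := main _ (cform_mk hL hT1 hT2 p q hδ0.le hδ1)
    simp only [cF, LinearMap.add_apply, LinearMap.smul_apply, smul_eq_mul, AT_apply, A00_self,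
      real_inner_self_eq_norm_sq, Pr_eq_self hsa] at h1
    have h2 : 0 ≤ δ * ((((q - p : ℕ) : ℝ) + 1)⁻¹ * ∑ n ∈ Ico p q, ‖a₁ n‖ ^ 2) := by positivity
    have h3 : L a₁ ^ 2 ≤ ‖T a₁‖ ^ 2 + η := by
      have h4 := hT2 a₁
      have h5 := norm_nonneg (T a₁)
      have h6 : η / (2 * L a₁ + 1) * (2 * L a₁ + 1) = η := by field_simp
      have h7 : 0 < η / (2 * L a₁ + 1) := by positivity
      nlinarith
    have h4 := mul_le_mul_of_nonneg_left h3 (show 0 ≤ 1 - δ by linarith)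
    nlinarith
  refine ⟨A₁, κ, hκ0, hA₁, fun a b hp => le_trans ?_ (hr a b hp)⟩
  have h1 := NN_sq_le L hp₁
  unfold cost at h1
  have h2 := ip_nonneg b₁
  have h3 : (1 - δ) * NN L x ^ 2 ≤ (1 - δ) * (L a₁ ^ 2 + ip b₁ b₁) :=
    mul_le_mul_of_nonneg_left h1 (by linarith)
  have h4 : (1 - δ) * (L a₁ ^ 2 + ip b₁ b₁) ≤ (1 - δ) * L a₁ ^ 2 + ip b₁ b₁ := by nlinarith
  have h5 : t ^ 2 ≤ η := by nlinarith
  linarith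
end
end GMHI

set_option linter.unusedVariables false
set_option linter.unusedSimpArgs false
namespace GMHI
open Finset
noncomputable section
variable {L : AA → ℝ}

lemma cF_par (A : AA →ₗ[ℝ] AA →ₗ[ℝ] ℝ) (a b a' b' : AA) :
    cF A ((2 : ℝ)⁻¹ • (a + a')) ((2 : ℝ)⁻¹ • (b + b')) ((2 : ℝ)⁻¹ • (a + a')) ((2 : ℝ)⁻¹ • (b + b')) +
    cF A ((2 : ℝ)⁻¹ • (a - a')) ((2 : ℝ)⁻¹ • (b - b')) ((2 : ℝ)⁻¹ • (a - a')) ((2 : ℝ)⁻¹ • (b - b'))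
    = (cF A a b a b + cF A a' b' a' b') / 2 := by
  simp only [cF, map_smul, map_add, map_sub, LinearMap.smul_apply, LinearMap.add_apply,
    LinearMap.sub_apply, smul_eq_mul]
  ring

lemma Form.cF_le {A : AA →ₗ[ℝ] AA →ₗ[ℝ] ℝ} (hA : Form L A) (a b : AA) : cF A a b a b ≤ cost L a b := by
  have := hA.le a
  unfold cF cost; linarith

set_option maxHeartbeats 1000000 in
theorem uc_ineq (hL : IsLN L) (x y : ℕ →₀ ℝ) (m : ℕ) :
    (1 - (16 : ℝ)⁻¹ ^ m) * NN L x ^ 2 + (4 : ℝ)⁻¹ ^ m * NN L y ^ 2 ≤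
      (NN L (x + y) ^ 2 + NN L (x - y) ^ 2) / 2 := by
  obtain ⟨q1, hq1⟩ := exists_supp x
  obtain ⟨q2, hq2⟩ := exists_supp y
  set h : ℝ := (4 : ℝ)⁻¹ ^ m with hh
  have hη : (16 : ℝ)⁻¹ ^ m = h ^ 2 := by rw [hh, ← pow_mul, mul_comm, pow_mul]; norm_num
  have h0 : 0 < h := by positivity
  have h1 : h ≤ 1 := pow_le_one₀ (by norm_num) (by norm_num)
  rw [hη]
  apply le_of_forall_pos_le_add
  intro ε hε
  have hpath : ∀ z : ℕ →₀ ℝ, ∃ a b, IsPath z a b ∧ cost L a b ≤ NN L z ^ 2 + ε / 4 := by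
    intro z
    have hz := NN_nonneg L z
    have hlt : NN L z < √(NN L z ^ 2 + ε / 4) := by
      apply Real.lt_sqrt_of_sq_lt; linarith
    obtain ⟨a, b, e1, e2⟩ := exists_path L hlt
    rw [Real.sq_sqrt (by positivity)] at e2
    exact ⟨a, b, e1, e2.le⟩
  obtain ⟨a1, b1, p1, c1⟩ := hpath (x + y)
  obtain ⟨a2, b2, p2, c2⟩ := hpath (x - y)
  obtain ⟨A1, κ1, -, hA1, hm1⟩ := minimax hL hq1 (show 0 < ε / 4 by linarith)
  obtain ⟨A2, κ2, -, hA2, hm2⟩ := minimax hL hq2 (show 0 < ε / 4 by linarith)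
  have hA : Form L ((1 - h ^ 2) • A1 + h ^ 2 • A2) :=
    hA1.toForm.comb hA2.toForm (by positivity) (by nlinarith)
  have hpx : IsPath x ((2 : ℝ)⁻¹ • (a1 + a2)) ((2 : ℝ)⁻¹ • (b1 + b2)) := by
    have := (p1.add p2).smul (2 : ℝ)⁻¹
    convert this using 1
    ext n; simp; ring
  have hpy : IsPath y ((2 : ℝ)⁻¹ • (a1 - a2)) ((2 : ℝ)⁻¹ • (b1 - b2)) := by
    have := (p1.sub p2).smul (2 : ℝ)⁻¹
    convert this using 1
    ext n; simp; ring
  have e0 := cF_par ((1 - h ^ 2) • A1 + h ^ 2 • A2) a1 b1 a2 b2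
  have e1 := hA.cF_le a1 b1
  have e2 := hA.cF_le a2 b2
  have e3 := hm1 _ _ hpx
  have e4 := hm2 _ _ (hpy.dil (-(m : ℤ)))
  set ax := (2 : ℝ)⁻¹ • (a1 + a2)
  set bx := (2 : ℝ)⁻¹ • (b1 + b2)
  set ay := (2 : ℝ)⁻¹ • (a1 - a2)
  set by' := (2 : ℝ)⁻¹ • (b1 - b2)
  have g1 : (2 : ℝ) ^ (-(m : ℤ)) * (2 : ℝ) ^ (-(m : ℤ)) = h := by
    rw [← zpow_add₀ two_ne_zero, hh, inv_pow, zpow_add₀ two_ne_zero, zpow_neg, zpow_natCast, ← mul_inv,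
      ← mul_pow]; norm_num
  have g2 : (2 : ℝ) ^ (m : ℤ) * (2 : ℝ) ^ (m : ℤ) * h = 1 := by
    rw [hh, zpow_natCast, ← mul_pow, ← mul_pow]; norm_num
  have e5 : cF A2 ((2 : ℝ) ^ (-(m : ℤ)) • sA (-(m : ℤ)) ay) ((2 : ℝ) ^ (-(-(m : ℤ))) • sA (-(m : ℤ)) by')
      ((2 : ℝ) ^ (-(m : ℤ)) • sA (-(m : ℤ)) ay) ((2 : ℝ) ^ (-(-(m : ℤ))) • sA (-(m : ℤ)) by') * h
      = h ^ 2 * A2 ay ay + ip by' by' := by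
    simp only [cF, map_smul, LinearMap.smul_apply, smul_eq_mul, ip_sA, hA2.shift, neg_neg]
    linear_combination (h * A2 ay ay) * g1 + (ip by' by') * g2
  have e6 : cF ((1 - h ^ 2) • A1 + h ^ 2 • A2) ax bx ax bx ≥ (1 - h ^ 2) * cF A1 ax bx ax bx := by
    simp only [cF, LinearMap.add_apply, LinearMap.smul_apply, smul_eq_mul]
    have := ip_nonneg bx
    have := hA2.nonneg ax
    nlinarith [mul_nonneg (sq_nonneg h) this]
  have e7 : cF ((1 - h ^ 2) • A1 + h ^ 2 • A2) ay by' ay by' ≥ h ^ 2 * A2 ay ay + ip by' by' := by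
    simp only [cF, LinearMap.add_apply, LinearMap.smul_apply, smul_eq_mul]
    have := mul_nonneg (show 0 ≤ 1 - h ^ 2 by nlinarith) (hA1.nonneg ay)
    linarith
  have e8 := mul_le_mul_of_nonneg_left e3 (show 0 ≤ 1 - h ^ 2 by nlinarith)
  have e9 := mul_le_mul_of_nonneg_right e4 h0.le
  rw [e5] at e9
  nlinarith

/-- morphisms of paths -/
structure IsMor (T B : AA →ₗ[ℝ] KK) (g : (ℕ →₀ ℝ) →ₗ[ℝ] ℝ) : Prop where
  ts : ∀ m a, T (sA m a) = sK m (T a)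
  bs : ∀ m a, B (sA m a) = sK m (B a)
  eq : ∀ x a b, IsPath x a b → ∀ m : ℤ, (2 : ℝ) ^ m * T a m + (2 : ℝ) ^ (-m) * B b m = g x

lemma IsMor.add {T B T' B' : AA →ₗ[ℝ] KK} {g g' : (ℕ →₀ ℝ) →ₗ[ℝ] ℝ} (h : IsMor T B g) (h' : IsMor T' B' g') :
    IsMor (T + T') (B + B') (g + g') where
  ts m a := by simp [h.ts, h'.ts]
  bs m a := by simp [h.bs, h'.bs]
  eq x a b hp m := by
    have := h.eq x a b hp m
    have := h'.eq x a b hp m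
    simp only [LinearMap.add_apply, lp.coeFn_add, Pi.add_apply]
    linarith

lemma IsMor.smul {T B : AA →ₗ[ℝ] KK} {g : (ℕ →₀ ℝ) →ₗ[ℝ] ℝ} (c : ℝ) (h : IsMor T B g) :
    IsMor (c • T) (c • B) (c • g) where
  ts m a := by simp [h.ts]
  bs m a := by simp [h.bs]
  eq x a b hp m := by
    have := h.eq x a b hp m
    simp only [LinearMap.smul_apply, lp.coeFn_smul, Pi.smul_apply, smul_eq_mul]
    rw [← this]; ring

lemma IsMor.zero : IsMor 0 0 0 where
  ts m a := by simp
  bs m a := by simp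
  eq x a b hp m := by simp

lemma IsMor.sum {ι : Type} {s : Finset ι} {T B : ι → AA →ₗ[ℝ] KK} {g : ι → (ℕ →₀ ℝ) →ₗ[ℝ] ℝ}
    (h : ∀ i ∈ s, IsMor (T i) (B i) (g i)) :
    IsMor (∑ i ∈ s, T i) (∑ i ∈ s, B i) (∑ i ∈ s, g i) := by
  classical
  induction s using Finset.induction_on with
  | empty => simpa using IsMor.zero
  | insert i s hi ih =>
    rw [Finset.sum_insert hi, Finset.sum_insert hi, Finset.sum_insert hi]
    exact (h i (by simp)).add (ih fun j hj => h j (by simp [hj]))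

lemma IsMor.dil {T B : AA →ₗ[ℝ] KK} {g : (ℕ →₀ ℝ) →ₗ[ℝ] ℝ} (h : IsMor T B g) (j : ℤ) :
    IsMor ((2 : ℝ) ^ j • (sK j).comp T) ((2 : ℝ) ^ (-j) • (sK j).comp B) g where
  ts m a := by simp [h.ts, add_comm]
  bs m a := by simp [h.bs, add_comm]
  eq x a b hp m := by
    have := h.eq x a b hp (m + j)
    simp only [LinearMap.smul_apply, lp.coeFn_smul, Pi.smul_apply, smul_eq_mul, LinearMap.comp_apply,
      sK_apply]
    rw [← this, neg_add, zpow_add₀ two_ne_zero, zpow_add₀ two_ne_zero]; ring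

lemma IsMor.g_le (hL : IsLN L) {T B : AA →ₗ[ℝ] KK} {g : (ℕ →₀ ℝ) →ₗ[ℝ] ℝ} (h : IsMor T B g)
    (hT : ∀ a, ‖T a‖ ≤ L a) (hB : ∀ b, ‖B b‖ ≤ √(ip b b)) (x : ℕ →₀ ℝ) : g x ≤ 2 * NN L x := by
  apply le_of_forall_pos_le_add
  intro ε hε
  obtain ⟨a, b, h1, h2⟩ := exists_path L (show NN L x < NN L x + ε / 2 by linarith)
  have h3 := h.eq x a b h1 0
  simp only [zpow_zero, one_mul, neg_zero] at h3
  have h4 := le_of_abs_le (absK_le (T a) 0)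
  have h5 := le_of_abs_le (absK_le (B b) 0)
  have h6 := hT a
  have h7 := hB b
  have h0 := NN_nonneg L x
  unfold cost at h2
  have h8 : L a ≤ NN L x + ε / 2 := by
    apply le_of_abs_le; apply abs_le_of_sq_le_sq _ (by linarith)
    nlinarith [ip_nonneg b]
  have h9 : √(ip b b) ≤ NN L x + ε / 2 := by
    rw [Real.sqrt_le_iff]
    exact ⟨by linarith, by nlinarith [sq_nonneg (L a)]⟩
  linarith

/-- Bessel type inequality -/
lemma bessel {A : AA →ₗ[ℝ] AA →ₗ[ℝ] ℝ} (hs : ∀ a b, A a b = A b a) (hp : ∀ a, 0 ≤ A a a)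
    (hsh : ∀ m a b, A (sA m a) (sA m b) = A a b) {a₀ : AA} {Q : ℝ} (hQ : 0 ≤ Q)
    (hb : ∀ m : ℤ, |A a₀ (sA m a₀)| ≤ Q * (2 : ℝ)⁻¹ ^ m.natAbs) (a : AA) (s : Finset ℤ) :
    ∑ m ∈ s, A a₀ (sA m a) ^ 2 ≤ 3 * Q * A a a := by
  set c : ℤ → ℝ := fun m => A a₀ (sA m a) with hc
  set v : AA := ∑ m ∈ s, c m • sA (-m) a₀ with hv
  set σ := ∑ m ∈ s, c m ^ 2 with hσ
  have hσ0 : 0 ≤ σ := by positivity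
  have e1 : A v a = σ := by
    rw [hv, map_sum, LinearMap.sum_apply]
    apply Finset.sum_congr rfl
    intro m _
    rw [map_smul, LinearMap.smul_apply, smul_eq_mul, ← hsh m, sA_sA, add_neg_cancel, sA_zero, sq]
  have e2 : A v v = ∑ m ∈ s, ∑ k ∈ s, c m * c k * A a₀ (sA (m - k) a₀) := by
    have h0 : A v v = ∑ m ∈ s, A (c m • sA (-m) a₀) v := by
      conv_lhs => rw [hv]
      rw [LinearMap.map_sum₂]
    rw [h0]
    apply Finset.sum_congr rfl
    intro m _
    rw [hv, map_sum]
    apply Finset.sum_congr rfl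
    intro k _
    simp only [map_smul, LinearMap.smul_apply, smul_eq_mul]
    rw [← hsh m, sA_sA, sA_sA, add_neg_cancel, sA_zero, ← sub_eq_add_neg]
    ring
  have e3 : A v v ≤ 3 * Q * σ := by
    rw [e2]
    have h1 : ∀ m ∈ s, ∀ k ∈ s, c m * c k * A a₀ (sA (m - k) a₀) ≤
        c m ^ 2 / 2 * (Q * (2 : ℝ)⁻¹ ^ (m - k).natAbs) + c k ^ 2 / 2 * (Q * (2 : ℝ)⁻¹ ^ (m - k).natAbs) := by
      intro m _ k _
      have hw : 0 ≤ Q * (2 : ℝ)⁻¹ ^ (m - k).natAbs := by positivity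
      have h2 : c m * c k * A a₀ (sA (m - k) a₀) ≤ |c m * c k| * (Q * (2 : ℝ)⁻¹ ^ (m - k).natAbs) := by
        refine (le_abs_self _).trans ?_
        rw [abs_mul]
        exact mul_le_mul_of_nonneg_left (hb _) (abs_nonneg _)
      have h3 : |c m * c k| ≤ c m ^ 2 / 2 + c k ^ 2 / 2 := by
        rw [abs_le]; constructor <;> nlinarith [sq_nonneg (c m - c k), sq_nonneg (c m + c k)]
      nlinarith [mul_le_mul_of_nonneg_right h3 hw]
    have hrow : ∀ m : ℤ, ∑ k ∈ s, (2 : ℝ)⁻¹ ^ (m - k).natAbs ≤ 3 := by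
      intro m
      have := sum_half_natAbs (s.image fun k => m - k)
      rwa [Finset.sum_image (by intro a _ b _ h; simpa using h)] at this
    refine (Finset.sum_le_sum fun m hm => Finset.sum_le_sum fun k hk => h1 m hm k hk).trans ?_
    have h4 : ∑ m ∈ s, ∑ k ∈ s, c m ^ 2 / 2 * (Q * (2 : ℝ)⁻¹ ^ (m - k).natAbs) ≤ 3 * Q * σ / 2 := by
      rw [hσ, Finset.mul_sum, Finset.sum_div]
      apply Finset.sum_le_sum
      intro m _
      rw [← Finset.mul_sum, ← Finset.mul_sum]
      have := mul_le_mul_of_nonneg_left (hrow m) (show 0 ≤ c m ^ 2 / 2 * Q by positivity)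
      linarith
    have h5 : ∑ m ∈ s, ∑ k ∈ s, c k ^ 2 / 2 * (Q * (2 : ℝ)⁻¹ ^ (m - k).natAbs) ≤ 3 * Q * σ / 2 := by
      rw [Finset.sum_comm]
      have : ∀ m k : ℤ, (m - k).natAbs = (k - m).natAbs := by intro m k; omega
      simp_rw [this]
      simpa [this] using h4
    simp_rw [Finset.sum_add_distrib]
    linarith
  have e4 := psd_cs A hs hp v a
  rw [e1] at e4
  rcases hσ0.eq_or_lt with h | h
  · rw [← h]; exact mul_nonneg (by positivity) (hp a)
  · have : σ * σ ≤ σ * (3 * Q * A a a) := by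
      have := mul_le_mul_of_nonneg_right e3 (hp a)
      nlinarith
    exact le_of_mul_le_mul_left this h

/-- operator from a form and a vector -/
lemma exists_op {A : AA →ₗ[ℝ] AA →ₗ[ℝ] ℝ} (hs : ∀ a b, A a b = A b a) (hp : ∀ a, 0 ≤ A a a)
    (hsh : ∀ m a b, A (sA m a) (sA m b) = A a b) {a₀ : AA} {Q : ℝ} (hQ : 0 ≤ Q)
    (hb : ∀ m : ℤ, |A a₀ (sA m a₀)| ≤ Q * (2 : ℝ)⁻¹ ^ m.natAbs) :
    ∃ T : AA →ₗ[ℝ] KK, (∀ a m, T a m = A a₀ (sA m a)) ∧ ∀ a, ‖T a‖ ^ 2 ≤ 3 * Q * A a a := by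
  refine ⟨{ toFun := fun a => ⟨fun m => A a₀ (sA m a), memK _ _ (bessel hs hp hsh hQ hb a)⟩
            map_add' := fun a b => by ext m; simp only [map_add]; rfl
            map_smul' := fun c a => by ext m; simp only [map_smul]; rfl }, fun a m => rfl, fun a => ?_⟩
  apply normK_sq_le
  exact bessel hs hp hsh hQ hb a

/-- unit vector at zero -/
def dK : KK := lp.single 2 0 1
lemma dK_apply (k : ℤ) : dK k = if k = 0 then 1 else 0 := by
  rw [dK, lp.single_apply, Pi.single_apply]

set_option maxHeartbeats 1000000 in
theorem morph (hL : IsLN L) {p q : ℕ} {x : ℕ →₀ ℝ} (hx : Supp p q x) {ε : ℝ} (hε : 0 < ε) (hε1 : ε ≤ 1)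
    (h1 : 1 - ε ≤ NN L x) (h2 : NN L x ≤ 1) :
    ∃ T B g, ∃ t : ℝ, IsMor T B g ∧ (∀ a, T (Pr p q a) = T a) ∧ (∀ b, B (Pr p q b) = B b) ∧
      (∀ a, ‖T a‖ ≤ 2 * L a) ∧ (∀ b, ‖B b‖ ≤ 2 * √(ip b b)) ∧ |t| ≤ 1 ∧ 1 - 3 * ε ≤ g x ∧
      ∀ a b, IsPath x a b → cost L a b ≤ 1 → ‖T a - (uK + t • dK)‖ ≤ 11 * √ε := by
  obtain ⟨A, κ, hκ, hA, hmm⟩ := minimax hL hx hε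
  obtain ⟨a₀, b₀, hp₀, hsa, hsb, ho⟩ := minimizer hL hκ hA hx
  set Q := cF A a₀ b₀ a₀ b₀ with hQ
  have hQ1 : 1 - 3 * ε ≤ Q := by
    have := hmm _ _ hp₀
    nlinarith
  have hQ0 : 0 ≤ Q := cF_nonneg hA.nonneg _ _
  have hQle : ∀ a b, IsPath x a b → Q ≤ cF A a b a b := by
    intro a b hp
    rw [cF_split hA.symm hp₀ ho hp]
    have := cF_nonneg hA.nonneg (a - a₀) (b - b₀)
    linarith
  have hQ2 : Q ≤ 1 := by
    apply le_of_forall_pos_le_add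
    intro e he
    have hlt : NN L x < √(1 + e) := by
      apply Real.lt_sqrt_of_sq_lt
      have := NN_nonneg L x
      nlinarith
    obtain ⟨a, b, e1, e2⟩ := exists_path L hlt
    rw [Real.sq_sqrt (by positivity)] at e2
    exact (hQle a b e1).trans ((hA.toForm.cF_le a b).trans e2.le)
  set pf : ℤ → ℝ := fun m => A a₀ (sA m a₀) with hpf
  set qf : ℤ → ℝ := fun m => ip b₀ (sA m b₀) with hqf
  have hpn : ∀ m, pf (-m) = pf m := by
    intro m
    simp only [hpf]
    rw [← hA.shift m, sA_sA, add_neg_cancel, sA_zero, hA.symm]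
  have hqn : ∀ m, qf (-m) = qf m := by
    intro m
    simp only [hqf]
    rw [← ip_sA m, sA_sA, add_neg_cancel, sA_zero, ip_symm]
  have hrel : ∀ m : ℤ, (2 : ℝ) ^ m * pf m + (2 : ℝ) ^ (-m) * qf m = Q := by
    intro m
    have hz := (hp₀.dil m).sub hp₀
    rw [sub_self] at hz
    have := ho _ _ hz
    simp only [map_sub, map_smul, smul_eq_mul] at this
    simp only [hQ, cF, hpf, hqf]
    linarith
  have hu : ∀ m : ℤ, m ≠ 0 → pf m = Q * uf m ∧ qf m = Q * uf m := by
    intro m hm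
    have r1 := hrel m
    have r2 := hrel (-m)
    rw [hpn, hqn, neg_neg] at r2
    have hne : (2 : ℝ) ^ m - (2 : ℝ) ^ (-m) ≠ 0 := by
      intro h
      have h3 : (2 : ℝ) ^ m = (2 : ℝ) ^ (-m) := by linarith
      have := zpow_right_injective₀ (show (0:ℝ) < 2 by norm_num) (by norm_num) h3
      omega
    have heq : pf m = qf m := by
      have : ((2 : ℝ) ^ m - (2 : ℝ) ^ (-m)) * (pf m - qf m) = 0 := by linear_combination r1 - r2
      rcases mul_eq_zero.mp this with h | h
      · exact absurd h hne
      · linarith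
    rw [← heq] at r1 ⊢
    have : pf m = Q * uf m := by
      unfold uf
      rw [eq_mul_inv_iff_mul_eq₀ (by positivity)]
      linarith
    exact ⟨this, this⟩
  have hp0 : 0 ≤ pf 0 := by simp only [hpf, sA_zero]; exact hA.nonneg _
  have hq0 : 0 ≤ qf 0 := by simp only [hqf, sA_zero]; exact ip_nonneg _
  have hpq0 : pf 0 + qf 0 = Q := by
    have := hrel 0
    simpa using this
  have hbp : ∀ m : ℤ, |pf m| ≤ Q * (2 : ℝ)⁻¹ ^ m.natAbs := by
    intro m
    by_cases hm : m = 0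
    · rw [hm, abs_of_nonneg hp0]; simp; linarith
    · rw [(hu m hm).1, abs_of_nonneg (mul_nonneg hQ0 (uf_pos m).le)]
      exact mul_le_mul_of_nonneg_left (uf_le_abs m) hQ0
  have hbq : ∀ m : ℤ, |qf m| ≤ Q * (2 : ℝ)⁻¹ ^ m.natAbs := by
    intro m
    by_cases hm : m = 0
    · rw [hm, abs_of_nonneg hq0]; simp; linarith
    · rw [(hu m hm).2, abs_of_nonneg (mul_nonneg hQ0 (uf_pos m).le)]
      exact mul_le_mul_of_nonneg_left (uf_le_abs m) hQ0
  obtain ⟨T, hT1, hT2⟩ := exists_op hA.symm hA.nonneg hA.shift hQ0 hbp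
  obtain ⟨B, hB1, hB2⟩ := exists_op ip_symm ip_nonneg ip_sA hQ0 hbq
  have hg : ∀ x' a b, IsPath x' a b → A a₀ a + ip b₀ b = A a₀ (cp x') + ip b₀ (cp x') := by
    intro x' a b h
    have hz := h.sub (cp_path x')
    rw [sub_self] at hz
    have := ho _ _ hz
    simp only [map_sub] at this
    linarith
  refine ⟨T, B, (A a₀).comp cp + (ip b₀).comp cp, pf 0 - 1 / 2, ⟨?_, ?_, ?_⟩, ?_, ?_, ?_, ?_, ?_, ?_, ?_⟩
  · intro m a; ext k; rw [sK_apply, hT1, hT1, sA_sA]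
  · intro m a; ext k; rw [sK_apply, hB1, hB1, sA_sA]
  · intro x' a b h m
    have := hg x' _ _ (h.dil m)
    simp only [map_smul, smul_eq_mul] at this
    rw [hT1, hB1, this]; rfl
  · intro a; ext k
    rw [hT1, hT1, sA_Pr, ← hA.loc, Pr_idem, hA.loc]
  · intro b; ext k
    rw [hB1, hB1, sA_Pr, ← ip_Pr_left, Pr_eq_self hsb]
  · intro a
    have e1 := hT2 a
    have e2 := hA.le a
    have e3 := hL.nonneg a
    have e4 := hA.nonneg a
    apply le_of_abs_le; apply abs_le_of_sq_le_sq _ (by linarith)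
    nlinarith
  · intro b
    have e1 := hB2 b
    have e2 := Real.sq_sqrt (ip_nonneg b)
    have e4 := ip_nonneg b
    apply le_of_abs_le; apply abs_le_of_sq_le_sq _ (by positivity)
    rw [mul_pow, e2]
    nlinarith
  · rw [abs_le]; constructor <;> linarith
  · have := hg x _ _ hp₀
    rw [LinearMap.add_apply, LinearMap.comp_apply, LinearMap.comp_apply, ← this]
    exact hQ1
  · intro a b hp hc
    have e1 : ‖T (a - a₀)‖ ≤ 3 * √ε := by
      have h3 := cF_split hA.symm hp₀ ho hp
      have h4 := hA.toForm.cF_le a b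
      have h5 := ip_nonneg (b - b₀)
      have h6 := hT2 (a - a₀)
      have h7 : A (a - a₀) (a - a₀) ≤ 3 * ε := by
        have : A (a - a₀) (a - a₀) + ip (b - b₀) (b - b₀) = cF A (a - a₀) (b - b₀) (a - a₀) (b - b₀) := rfl
        linarith
      have h8 := Real.sq_sqrt hε.le
      apply le_of_abs_le; apply abs_le_of_sq_le_sq _ (by positivity)
      rw [mul_pow, h8]
      have := hA.nonneg (a - a₀)
      nlinarith
    have e2 : T a₀ - (uK + (pf 0 - 1 / 2) • dK) = (Q - 1) • uK + (-(Q - 1) / 2) • dK := by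
      ext m
      simp only [lp.coeFn_sub, lp.coeFn_add, lp.coeFn_smul, Pi.sub_apply, Pi.add_apply, Pi.smul_apply,
        smul_eq_mul, uK_apply, dK_apply]
      rw [hT1]
      by_cases hm : m = 0
      · rw [hm]; simp only [if_true, uf_zero]
        show pf 0 - _ = _
        ring
      · rw [if_neg hm]
        have := (hu m hm).1
        simp only [hpf] at this
        rw [this]; ring
    have hdn : ‖dK‖ = 1 := by
      rw [dK, lp.norm_single (by norm_num)]; simp
    have hs : ε ≤ √ε := by
      have h8 := Real.sq_sqrt hε.le
      have := Real.sqrt_nonneg ε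
      have h9 : √ε ≤ 1 := Real.sqrt_le_one.mpr hε1
      nlinarith
    have e3 : ‖T a₀ - (uK + (pf 0 - 1 / 2) • dK)‖ ≤ 7.5 * ε := by
      rw [e2]
      refine (norm_add_le _ _).trans ?_
      rw [norm_smul, norm_smul, hdn, Real.norm_eq_abs, Real.norm_eq_abs, abs_of_nonpos (by linarith),
        abs_of_nonneg (by linarith)]
      have := uK_norm
      have := mul_le_mul_of_nonneg_left uK_norm (show 0 ≤ -(Q - 1) by linarith)
      linarith
    have e4 : T a - (uK + (pf 0 - 1 / 2) • dK) = T (a - a₀) + (T a₀ - (uK + (pf 0 - 1 / 2) • dK)) := by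
      rw [map_sub]; abel
    rw [e4]
    refine (norm_add_le _ _).trans ?_
    linarith
end
end GMHI

set_option linter.unusedVariables false
set_option linter.unusedSimpArgs false
namespace GMHI
open Finset
noncomputable section

/-! ### Parameters -/
def mu : ℕ → ℕ
  | 0 => 1
  | w + 1 => 4 * (mu w) ^ 2 + 1

def mm (w : ℕ) : ℝ := 4 ^ mu w
def nn (w : ℕ) : ℕ := 16 ^ ((mu w) ^ 2)

lemma mu_pos (w : ℕ) : 1 ≤ mu w := by
  cases w <;> simp [mu]
lemma mu_lt (w : ℕ) : mu w < mu (w + 1) := by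
  have := mu_pos w
  simp only [mu]; nlinarith
lemma mu_strictMono : StrictMono mu := strictMono_nat_of_lt_succ mu_lt
lemma lt_mu (w : ℕ) : w < mu w := by
  induction w with
  | zero => simp [mu]
  | succ w ih => have := mu_lt w; omega
lemma mm_pos (w : ℕ) : 0 < mm w := by unfold mm; positivity
lemma mm_ge (w : ℕ) : 4 ≤ mm w := by
  unfold mm
  calc (4 : ℝ) = 4 ^ 1 := by norm_num
    _ ≤ _ := pow_le_pow_right₀ (by norm_num) (mu_pos w)
lemma nn_pos (w : ℕ) : 0 < nn w := by unfold nn; positivity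
lemma mm_mono {w w' : ℕ} (h : w ≤ w') : mm w ≤ mm w' :=
  pow_le_pow_right₀ (by norm_num) (mu_strictMono.monotone h)
lemma nn_mono {w w' : ℕ} (h : w ≤ w') : nn w ≤ nn w' := by
  have := mu_strictMono.monotone h
  exact Nat.pow_le_pow_right (by norm_num) (Nat.pow_le_pow_left this 2)
lemma mm_nn {w w' : ℕ} (h : w < w') : (nn w : ℝ) ^ 2 ≤ mm w' := by
  refine le_trans ?_ (mm_mono (Nat.succ_le_of_lt h))
  unfold nn mm
  simp only [mu]
  push_cast
  rw [show (16 : ℝ) = 4 ^ 2 by norm_num, ← pow_mul, ← pow_mul]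
  exact pow_le_pow_right₀ (by norm_num) (by omega)

/-! ### dense codes -/
lemma sepKK : TopologicalSpace.SeparableSpace KK := by
  rw [← TopologicalSpace.isSeparable_univ_iff]
  have h1 : TopologicalSpace.IsSeparable (Set.range fun k : ℤ => (lp.single 2 k (1 : ℝ) : KK)) :=
    (Set.countable_range _).isSeparable
  have h2 := (h1.span (R := ℝ)).closure
  refine h2.mono ?_
  intro x _
  have h3 := lp.hasSum_single (p := 2) (by simp) x
  refine mem_closure_of_tendsto h3 (Filter.Eventually.of_forall fun s => ?_)
  apply Submodule.sum_mem
  intro k _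
  have : (lp.single 2 k (x k) : KK) = x k • lp.single 2 k (1 : ℝ) := by
    rw [← lp.single_smul]; simp
  rw [this]
  exact Submodule.smul_mem _ _ (Submodule.subset_span ⟨k, rfl⟩)

lemma n1_zero : n1 0 = 0 := by simp [n1]
lemma n1_neg (a : AA) : n1 (-a) = n1 a := by
  have := n1_smul (-1) a
  simpa using this
lemma n1_sum {ι : Type} (s : Finset ι) (f : ι → AA) : n1 (∑ i ∈ s, f i) ≤ ∑ i ∈ s, n1 (f i) := by
  classical
  induction s using Finset.induction_on with
  | empty => simp [n1_zero]
  | insert i s hi ih =>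
    rw [Finset.sum_insert hi, Finset.sum_insert hi]
    exact (n1_add _ _).trans (by linarith)
lemma n1_single (n : ℕ) (x : KK) : n1 (Finsupp.single n x) = ‖x‖ := by
  rw [n1_eq_sum _ {n}]
  · simp
  · intro k hk
    by_contra h
    apply hk
    rw [Finsupp.single_apply, if_neg]
    intro h'; exact h (by simp [h'])

lemma exists_dense : ∃ d : ℕ → AA, ∀ a, ∀ ε : ℝ, 0 < ε → ∃ i, n1 (a - d i) < ε := by
  haveI := sepKK
  let D : List ℕ → AA := fun c => ∑ n ∈ range c.length,
    Finsupp.single n (TopologicalSpace.denseSeq KK (c.getD n 0))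
  refine ⟨fun i => D ((Encodable.decode i : Option (List ℕ)).getD []), fun a ε hε => ?_⟩
  obtain ⟨q, hq⟩ := exists_supp a
  have hd : ∀ n, ∃ i, ‖a n - TopologicalSpace.denseSeq KK i‖ < ε / (q + 1) := by
    intro n
    have := (TopologicalSpace.denseRange_denseSeq KK).exists_dist_lt (a n) (show 0 < ε / (q + 1) by positivity)
    obtain ⟨i, hi⟩ := this
    exact ⟨i, by rwa [dist_eq_norm] at hi⟩
  choose i hi using hd
  refine ⟨Encodable.encode ((List.range q).map i), ?_⟩
  simp only [Encodable.encodek, Option.getD_some, D, List.length_map, List.length_range]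
  have ha : a = ∑ n ∈ range q, Finsupp.single n (a n) := by
    conv_lhs => rw [← Finsupp.sum_single a, Finsupp.sum]
    apply Finset.sum_subset
    · intro n hn
      have := hq n (by simpa using hn)
      simp; omega
    · intro n _ hn
      have : a n = 0 := by simpa using hn
      simp [this]
  conv_lhs => rw [ha]
  rw [← Finset.sum_sub_distrib]
  refine (n1_sum _ _).trans_lt ?_
  have : ∀ n ∈ range q, n1 (Finsupp.single n (a n) - Finsupp.single n
      (TopologicalSpace.denseSeq KK (((List.range q).map i).getD n 0))) ≤ ε / (q + 1) := by
    intro n hn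
    rw [← Finsupp.single_sub, n1_single]
    have hn' : n < q := by simpa using hn
    have : ((List.range q).map i).getD n 0 = i n := by
      simp [List.getD, hn']
    rw [this]; exact (hi n).le
  refine (Finset.sum_le_sum this).trans_lt ?_
  simp only [Finset.sum_const, card_range, nsmul_eq_mul]
  rw [← mul_div_assoc, div_lt_iff₀ (by positivity)]
  nlinarith

/-- dense sequence -/
def dd : ℕ → AA := exists_dense.choose
lemma dd_dense (a : AA) {ε : ℝ} (hε : 0 < ε) : ∃ i, n1 (a - dd i) < ε := exists_dense.choose_spec a ε hε

/-! ### The norming family -/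
abbrev Op : Type := AA →ₗ[ℝ] KK

def node (w : ℕ) (T : ℕ → Op) (p q : ℕ → ℕ) : Op :=
  (mm w)⁻¹ • ∑ l ∈ range (nn w), (T l).comp (Pr (p l) (q l))

lemma node_apply (w : ℕ) (T : ℕ → Op) (p q : ℕ → ℕ) (a : AA) :
    node w T p q a = (mm w)⁻¹ • ∑ l ∈ range (nn w), T l (Pr (p l) (q l) a) := by
  simp [node, LinearMap.sum_apply]

/-- successive intervals -/
def Suc (n : ℕ) (p q : ℕ → ℕ) : Prop := ∀ l l', l < l' → l' < n → q l ≤ p l'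

/-- weights of special sequences -/
def tt (j : ℕ) (d : ℕ → ℕ) (l : ℕ) : ℕ := j + 1 + Encodable.encode ((List.range l).map d)

inductive Mem : Op → Prop
  | coord (n : ℕ) : Mem (Finsupp.lapply n)
  | hull (T : Op) (f : AA → ℕ → Op) (hT : ∀ m a, T (sA m a) = sK m (T a))
      (hf : ∀ a i, Mem (f a i)) (h : ∀ a, ∀ ε : ℝ, 0 < ε → ∃ i, ‖T a‖ ≤ ‖f a i a‖ + ε) : Mem T
  | even (j : ℕ) (T : ℕ → Op) (p q : ℕ → ℕ) (hs : Suc (nn (2 * j)) p q)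
      (hT : ∀ l, l < nn (2 * j) → Mem (T l)) : Mem (node (2 * j) T p q)
  | odd (j : ℕ) (d : ℕ → ℕ) (T : ℕ → Op) (Tc : ℕ → ℕ → Op) (pc qc : ℕ → ℕ → ℕ) (p q : ℕ → ℕ) (e e' : ℕ)
      (hT : ∀ l, l < nn (2 * j + 1) → T l = node (2 * tt j d l) (Tc l) (pc l) (qc l))
      (hsc : ∀ l, l < nn (2 * j + 1) → Suc (nn (2 * tt j d l)) (pc l) (qc l))
      (hTc : ∀ l, l < nn (2 * j + 1) → ∀ k, k < nn (2 * tt j d l) → Mem (Tc l k))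
      (hMT : ∀ l, l < nn (2 * j + 1) → Mem (T l))
      (hs : Suc (nn (2 * j + 1)) p q)
      (hc : ∀ l l', l < nn (2 * j + 1) → l' < nn (2 * j + 1) →
        ‖T l (Pr (p l) (q l) (dd (d l))) - T l' (Pr (p l') (q l') (dd (d l')))‖ ≤ (nn (2 * j + 1) : ℝ)⁻¹) :
      Mem (node (2 * j + 1) T (fun l => max (p l) e) (fun l => min (q l) e'))

def EvenNode (j : ℕ) (S : Op) : Prop := ∃ T p q, Suc (nn (2 * j)) p q ∧
  (∀ l, l < nn (2 * j) → Mem (T l)) ∧ S = node (2 * j) T p q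

def OddNode (j : ℕ) (S : Op) : Prop := ∃ (d : ℕ → ℕ) (T : ℕ → Op) (p q : ℕ → ℕ) (e e' : ℕ),
  (∀ l, l < nn (2 * j + 1) → EvenNode (tt j d l) (T l)) ∧
  Suc (nn (2 * j + 1)) p q ∧
  (∀ l l', l < nn (2 * j + 1) → l' < nn (2 * j + 1) →
        ‖T l (Pr (p l) (q l) (dd (d l))) - T l' (Pr (p l') (q l') (dd (d l')))‖ ≤ (nn (2 * j + 1) : ℝ)⁻¹) ∧
  S = node (2 * j + 1) T (fun l => max (p l) e) (fun l => min (q l) e')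

def IsNode (w : ℕ) (S : Op) : Prop := (∃ j, w = 2 * j ∧ EvenNode j S) ∨ (∃ j, w = 2 * j + 1 ∧ OddNode j S)

lemma EvenNode.mem {j : ℕ} {S : Op} (h : EvenNode j S) : Mem S := by
  obtain ⟨T, p, q, h1, h2, rfl⟩ := h
  exact Mem.even j T p q h1 h2

lemma EvenNode.isNode {j : ℕ} {S : Op} (h : EvenNode j S) : IsNode (2 * j) S := Or.inl ⟨j, rfl, h⟩
lemma OddNode.isNode {j : ℕ} {S : Op} (h : OddNode j S) : IsNode (2 * j + 1) S := Or.inr ⟨j, rfl, h⟩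

lemma OddNode.mem {j : ℕ} {S : Op} (h : OddNode j S) : Mem S := by
  obtain ⟨d, T, p, q, e, e', h1, h2, h3, rfl⟩ := h
  have h1' : ∀ l, ∃ (Tc : ℕ → Op) (pc qc : ℕ → ℕ), l < nn (2 * j + 1) → Suc (nn (2 * tt j d l)) pc qc ∧
    (∀ k, k < nn (2 * tt j d l) → Mem (Tc k)) ∧ T l = node (2 * tt j d l) Tc pc qc := by
    intro l
    by_cases hl : l < nn (2 * j + 1)
    · obtain ⟨Tc, pc, qc, h⟩ := h1 l hl
      exact ⟨Tc, pc, qc, fun _ => h⟩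
    · exact ⟨0, 0, 0, fun h => absurd h hl⟩
  choose Tc pc qc h using h1'
  exact Mem.odd j d T Tc pc qc p q e e' (fun l hl => (h l hl).2.2) (fun l hl => (h l hl).1)
    (fun l hl => (h l hl).2.1) (fun l hl => (h1 l hl).mem) h2 h3

lemma IsNode.mem {w : ℕ} {S : Op} (h : IsNode w S) : Mem S := by
  rcases h with ⟨j, _, h⟩ | ⟨j, _, h⟩
  · exact h.mem
  · exact h.mem

lemma Suc.cut {n : ℕ} {p q : ℕ → ℕ} (h : Suc n p q) (e e' : ℕ) :
    Suc n (fun l => max (p l) e) (fun l => min (q l) e') := by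
  intro l l' h1 h2
  have := h l l' h1 h2
  exact (min_le_left _ _).trans (this.trans (le_max_left _ _))

lemma IsNode.form {w : ℕ} {S : Op} (h : IsNode w S) : ∃ T p q, Suc (nn w) p q ∧
    (∀ l, l < nn w → Mem (T l)) ∧ S = node w T p q := by
  rcases h with ⟨j, rfl, h⟩ | ⟨j, rfl, d, T, p, q, e, e', h1, h2, h3, rfl⟩
  · exact h
  · exact ⟨T, _, _, h2.cut e e', fun l hl => (h1 l hl).mem, rfl⟩

theorem Mem.ind {P : Op → Prop} (hc : ∀ n, P (Finsupp.lapply n))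
    (hh : ∀ T : Op, (∀ m a, T (sA m a) = sK m (T a)) → ∀ f : AA → ℕ → Op, (∀ a i, P (f a i)) →
      (∀ a, ∀ ε : ℝ, 0 < ε → ∃ i, ‖T a‖ ≤ ‖f a i a‖ + ε) → P T)
    (hn : ∀ w T p q, IsNode w (node w T p q) → Suc (nn w) p q → (∀ l, l < nn w → P (T l)) →
      P (node w T p q)) {T : Op} (hT : Mem T) : P T := by
  induction hT with
  | coord n => exact hc n
  | hull T f hT hf h ih => exact hh T hT f ih h
  | even j T p q hs hT ih => exact hn _ T p q (Or.inl ⟨j, rfl, T, p, q, hs, hT, rfl⟩) hs ih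
  | odd j d T Tc pc qc p q e e' hT hsc hTc hMT hs hc ih1 ih2 =>
    refine hn _ T _ _ (Or.inr ⟨j, rfl, d, T, p, q, e, e', ?_, hs, hc, rfl⟩) (hs.cut e e') ih2
    intro l hl
    exact ⟨Tc l, pc l, qc l, hsc l hl, hTc l hl, hT l hl⟩

lemma Mem.zero : Mem 0 := by
  refine Mem.hull 0 (fun _ _ => Finsupp.lapply 0) (by simp) (fun _ _ => Mem.coord 0) ?_
  intro a ε hε
  refine ⟨0, ?_⟩
  simp; positivity

lemma node_comp_Pr (w : ℕ) (T : ℕ → Op) (p q : ℕ → ℕ) (e e' : ℕ) :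
    (node w T p q).comp (Pr e e') = node w T (fun l => max (p l) e) (fun l => min (q l) e') := by
  ext1 n; ext1 x
  simp only [LinearMap.comp_apply, node_apply, Pr_Pr]

lemma EvenNode.comp_Pr {j : ℕ} {S : Op} (h : EvenNode j S) (e e' : ℕ) : EvenNode j (S.comp (Pr e e')) := by
  obtain ⟨T, p, q, h1, h2, rfl⟩ := h
  exact ⟨T, _, _, h1.cut e e', h2, node_comp_Pr _ _ _ _ _ _⟩

lemma OddNode.comp_Pr {j : ℕ} {S : Op} (h : OddNode j S) (e e' : ℕ) : OddNode j (S.comp (Pr e e')) := by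
  obtain ⟨d, T, p, q, E, E', h1, h2, h3, rfl⟩ := h
  refine ⟨d, T, p, q, max E e, min E' e', h1, h2, h3, ?_⟩
  rw [node_comp_Pr]
  simp only [max_assoc, min_assoc]

lemma IsNode.comp_Pr {w : ℕ} {S : Op} (h : IsNode w S) (e e' : ℕ) : IsNode w (S.comp (Pr e e')) := by
  rcases h with ⟨j, rfl, h⟩ | ⟨j, rfl, h⟩
  · exact (h.comp_Pr e e').isNode
  · exact (h.comp_Pr e e').isNode

lemma Mem.comp_Pr {T : Op} (hT : Mem T) (e e' : ℕ) : Mem (T.comp (Pr e e')) := by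
  refine Mem.ind (P := fun T => (∀ m a, T (sA m a) = sK m (T a)) ∧ Mem (T.comp (Pr e e'))) ?_ ?_ ?_ hT |>.2
  · intro n
    refine ⟨fun m a => rfl, ?_⟩
    by_cases h : e ≤ n ∧ n < e'
    · convert Mem.coord n using 1
      ext1 k; ext1 x
      simp [Pr_apply, h]
    · convert Mem.zero using 1
      ext1 k; ext1 x
      simp [Pr_apply, h]
  · intro T hT f hf h
    refine ⟨hT, Mem.hull _ (fun a i => (f (Pr e e' a) i).comp (Pr e e')) ?_ (fun a i => (hf _ _).2) ?_⟩
    · intro m a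
      simp only [LinearMap.comp_apply]
      rw [← sA_Pr, hT]
    · intro a ε hε
      obtain ⟨i, hi⟩ := h (Pr e e' a) ε hε
      exact ⟨i, hi⟩
  · intro w T p q h hs ih
    refine ⟨?_, (h.comp_Pr e e').mem⟩
    intro m a
    simp only [node_apply]
    rw [map_smul, map_sum]
    congr 1
    apply Finset.sum_congr rfl
    intro l hl
    rw [← sA_Pr, (ih l (by simpa using hl)).1]

lemma Mem.shift {T : Op} (hT : Mem T) (m : ℤ) (a : AA) : T (sA m a) = sK m (T a) := by
  refine Mem.ind (P := fun T => (∀ m a, T (sA m a) = sK m (T a))) ?_ ?_ ?_ hT m a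
  · intro n m a; rfl
  · intro T hT f hf h; exact hT
  · intro w T p q h hs ih m a
    simp only [node_apply]
    rw [map_smul, map_sum]
    congr 1
    apply Finset.sum_congr rfl
    intro l hl
    rw [← sA_Pr, ih l (by simpa using hl)]

lemma sum_n1_Pr {n : ℕ} {p q : ℕ → ℕ} (h : Suc n p q) (a : AA) :
    ∑ l ∈ range n, n1 (Pr (p l) (q l) a) ≤ n1 a := by
  have h1 : ∀ l, n1 (Pr (p l) (q l) a) = ∑ k ∈ a.support, if p l ≤ k ∧ k < q l then ‖a k‖ else 0 := by
    intro l
    rw [n1_eq_sum _ a.support]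
    · apply Finset.sum_congr rfl
      intro k _
      rw [Pr_apply]; split_ifs <;> simp
    · intro k hk
      rw [Pr_apply] at hk
      simp only [Finsupp.mem_support_iff]
      intro h0; apply hk; simp [h0]
  simp_rw [h1]
  rw [Finset.sum_comm]
  apply Finset.sum_le_sum
  intro k _
  rw [← Finset.sum_filter, Finset.sum_const, nsmul_eq_mul]
  have : (filter (fun l => p l ≤ k ∧ k < q l) (range n)).card ≤ 1 := by
    rw [Finset.card_le_one]
    intro l hl l' hl'
    simp only [mem_filter, mem_range] at hl hl'
    by_contra hne
    rcases Nat.lt_or_gt_of_ne hne with h' | h'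
    · have := h l l' h' hl'.1; omega
    · have := h l' l h' hl.1; omega
  have h2 : ((filter (fun l => p l ≤ k ∧ k < q l) (range n)).card : ℝ) ≤ 1 := by exact_mod_cast this
  nlinarith [norm_nonneg (a k)]

lemma node_n1 {w : ℕ} {T : ℕ → Op} {p q : ℕ → ℕ} (hs : Suc (nn w) p q)
    (hT : ∀ l, l < nn w → ∀ a, ‖T l a‖ ≤ n1 a) (a : AA) : ‖node w T p q a‖ ≤ (mm w)⁻¹ * n1 a := by
  rw [node_apply, norm_smul, norm_inv, Real.norm_of_nonneg (mm_pos w).le]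
  apply mul_le_mul_of_nonneg_left _ (inv_nonneg.mpr (mm_pos w).le)
  refine (norm_sum_le _ _).trans (le_trans ?_ (sum_n1_Pr hs a))
  exact Finset.sum_le_sum fun l hl => hT l (by simpa using hl) _

lemma Mem.le_n1 {T : Op} (hT : Mem T) (a : AA) : ‖T a‖ ≤ n1 a := by
  refine Mem.ind (P := fun T => ∀ a, ‖T a‖ ≤ n1 a) ?_ ?_ ?_ hT a
  · intro n a; exact norm_le_n1 a n
  · intro T _ f hf h a
    apply le_of_forall_pos_le_add
    intro ε hε
    obtain ⟨i, hi⟩ := h a ε hε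
    have := hf a i a
    linarith
  · intro w T p q h hs ih a
    refine (node_n1 hs ih a).trans ?_
    have h1 : (mm w)⁻¹ ≤ 1 := inv_le_one_of_one_le₀ (by linarith [mm_ge w])
    nlinarith [n1_nonneg a]

lemma IsNode.le_n1 {w : ℕ} {S : Op} (h : IsNode w S) (a : AA) : ‖S a‖ ≤ (mm w)⁻¹ * n1 a := by
  obtain ⟨T, p, q, h1, h2, rfl⟩ := h.form
  exact node_n1 h1 (fun l hl => (h2 l hl).le_n1) a

/-- the left norm -/
def LL (a : AA) : ℝ := sSup {r | ∃ T, Mem T ∧ r = ‖T a‖}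

lemma Mem.le_LL {T : Op} (hT : Mem T) (a : AA) : ‖T a‖ ≤ LL a := by
  apply le_csSup
  · refine ⟨n1 a, ?_⟩
    rintro r ⟨T, hT, rfl⟩
    exact hT.le_n1 a
  · exact ⟨T, hT, rfl⟩

lemma LL_le {a : AA} {C : ℝ} (h : ∀ T, Mem T → ‖T a‖ ≤ C) : LL a ≤ C := by
  apply csSup_le
  · exact ⟨_, _, Mem.zero, rfl⟩
  · rintro r ⟨T, hT, rfl⟩; exact h T hT

lemma exists_LL (a : AA) {ε : ℝ} (hε : 0 < ε) : ∃ T, Mem T ∧ LL a - ε < ‖T a‖ := by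
  obtain ⟨r, ⟨T, hT, rfl⟩, h⟩ := exists_lt_of_lt_csSup (s := {r | ∃ T, Mem T ∧ r = ‖T a‖}) 
    ⟨_, _, Mem.zero, rfl⟩ (show LL a - ε < sSup {r | ∃ T, Mem T ∧ r = ‖T a‖} by
      have : LL a = sSup {r | ∃ T, Mem T ∧ r = ‖T a‖} := rfl
      linarith)
  exact ⟨T, hT, h⟩

lemma mem_of_le {T : Op} (hs : ∀ m a, T (sA m a) = sK m (T a)) (h : ∀ a, ‖T a‖ ≤ LL a) : Mem T := by
  have : ∀ a : AA, ∀ i : ℕ, ∃ T, Mem T ∧ LL a - 1 / ((i : ℝ) + 1) < ‖T a‖ := fun a i =>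
    exists_LL a (by positivity)
  choose f hf using this
  refine Mem.hull T f hs (fun a i => (hf a i).1) ?_
  intro a ε hε
  obtain ⟨i, hi⟩ := exists_nat_one_div_lt hε
  refine ⟨i, ?_⟩
  have := (hf a i).2
  have := h a
  linarith

lemma LL_smul_le (c : ℝ) (a : AA) : LL (c • a) ≤ |c| * LL a := by
  apply LL_le
  intro T hT
  rw [map_smul, norm_smul]
  exact mul_le_mul_of_nonneg_left (hT.le_LL a) (abs_nonneg _)

theorem LL_isLN : IsLN LL where
  add a b := by
    apply LL_le
    intro T hT
    rw [map_add]
    exact (norm_add_le _ _).trans (add_le_add (hT.le_LL a) (hT.le_LL b))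
  smul c a := by
    apply le_antisymm (LL_smul_le c a)
    by_cases hc : c = 0
    · subst hc
      simp only [abs_zero, zero_mul]
      exact (norm_nonneg _).trans (Mem.zero.le_LL _)
    · have := LL_smul_le c⁻¹ (c • a)
      rw [smul_smul, inv_mul_cancel₀ hc, one_smul, abs_inv] at this
      rwa [le_inv_mul_iff₀ (abs_pos.mpr hc)] at this
  shift m a := by
    have h : ∀ m a, LL (sA m a) ≤ LL a := by
      intro m a
      apply LL_le
      intro T hT
      rw [hT.shift, sK_norm]
      exact hT.le_LL a
    apply le_antisymm (h m a)
    have := h (-m) (sA m a)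
    rwa [sA_sA, neg_add_cancel, sA_zero] at this
  low a n := (Mem.coord n).le_LL a
  up a := LL_le fun T hT => hT.le_n1 a
  proj p q a := LL_le fun T hT => (hT.comp_Pr p q).le_LL a
  dual a ε hε := by
    obtain ⟨T, hT, h⟩ := exists_LL a hε
    exact ⟨T, hT.shift, hT.le_LL, h.le⟩

end
end GMHI

set_option linter.unusedVariables false
set_option linter.unusedSimpArgs false
namespace GMHI
open Finset
noncomputable section

lemma card_inside (n : ℕ) (r : ℕ → ℕ) {s : ℕ → ℕ} (hs : StrictMono s) (F : Finset ℕ) :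
    (F.filter fun k => ∃ l, l < n ∧ s k < r l ∧ r l < s (k + 1)).card ≤ n := by
  classical
  have : ∀ k ∈ F.filter (fun k => ∃ l, l < n ∧ s k < r l ∧ r l < s (k + 1)),
      ∃ l, l < n ∧ s k < r l ∧ r l < s (k + 1) := fun k hk => (mem_filter.mp hk).2
  choose! g hg using this
  calc _ ≤ (range n).card := Finset.card_le_card_of_injOn g (fun k hk => by simpa using (hg k hk).1) ?_
    _ = n := card_range n
  intro k hk k' hk' h
  have h1 := hg k hk
  have h2 := hg k' hk'
  rw [← h] at h2
  by_contra hne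
  rcases Nat.lt_or_gt_of_ne hne with h' | h'
  · have := hs.monotone (Nat.succ_le_of_lt h'); simp only [Nat.succ_eq_add_one] at this; omega
  · have := hs.monotone (Nat.succ_le_of_lt h'); simp only [Nat.succ_eq_add_one] at this; omega

/-- order connected finite set -/
def OC (F : Finset ℕ) : Prop := ∀ x ∈ F, ∀ z ∈ F, ∀ y, x ≤ y → y ≤ z → y ∈ F

theorem split_node {w : ℕ} (T : ℕ → Op) {p q : ℕ → ℕ} (hs : Suc (nn w) p q) {s : ℕ → ℕ} (hm : StrictMono s)
    {a : ℕ → AA} {F : Finset ℕ} (ha : ∀ k ∈ F, Supp (s k) (s (k + 1)) (a k)) :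
    ∃ (Fl : ℕ → Finset ℕ) (bad : Finset ℕ), bad ⊆ F ∧ (∀ l, Fl l ⊆ F) ∧ (OC F → ∀ l, l < nn w → OC (Fl l)) ∧
      ∑ l ∈ range (nn w), (Fl l).card ≤ F.card ∧ bad.card ≤ 2 * nn w ∧
      node w T p q (∑ k ∈ F, a k) = (mm w)⁻¹ • ∑ l ∈ range (nn w), T l (∑ k ∈ Fl l, a k)
        + ∑ k ∈ bad, node w T p q (a k) := by
  classical
  set n := nn w with hn
  let c : ℕ → ℕ → Prop := fun k l => p l ≤ s k ∧ s (k + 1) ≤ q l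
  let U := F.filter fun k => ∃ l, l < n ∧ c k l
  let Fl : ℕ → Finset ℕ := fun l => U.filter fun k => c k l
  let bad := (F \ U).filter fun k => node w T p q (a k) ≠ 0
  have huniq : ∀ k l l', l < n → l' < n → c k l → c k l' → l = l' := by
    intro k l l' h1 h2 h3 h4
    by_contra hne
    have h5 := hm (Nat.lt_succ_self k)
    simp only [Nat.succ_eq_add_one] at h5
    simp only [c] at h3 h4
    rcases Nat.lt_or_gt_of_ne hne with h' | h'
    · have := hs l l' h' h2; omega
    · have := hs l' l h' h1; omega
  have hkey : ∀ k ∈ U, ∀ l ∈ range n, T l (Pr (p l) (q l) (a k)) = if c k l then T l (a k) else 0 := by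
    intro k hk l hl
    have hk' := mem_filter.mp hk
    have hl' : l < n := by simpa using hl
    obtain ⟨l0, h0, h1⟩ := hk'.2
    split_ifs with h
    · rw [Pr_eq_self ((ha k hk'.1).mono h.1 h.2)]
    · have hne : l ≠ l0 := fun e => h (e ▸ h1)
      rw [Pr_eq_zero (ha k hk'.1), map_zero]
      simp only [c] at h1
      rcases Nat.lt_or_gt_of_ne hne with h' | h'
      · have := hs l l0 h' h0; left; omega
      · have := hs l0 l h' hl'; right; omega
  refine ⟨Fl, bad, (filter_subset _ _).trans sdiff_subset, fun l => (filter_subset _ _).trans (filter_subset _ _),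
    ?_, ?_, ?_, ?_⟩
  · intro hF l hl x hx z hz y hxy hyz
    simp only [Fl, U, c, mem_filter] at hx hz ⊢
    have e1 := hm.monotone hxy
    have e2 := hm.monotone (Nat.succ_le_succ hyz)
    simp only [Nat.succ_eq_add_one] at e2
    exact ⟨⟨hF x hx.1.1 z hz.1.1 y hxy hyz, l, hl, by omega, by omega⟩, by omega, by omega⟩
  · rw [← Finset.card_biUnion]
    · apply Finset.card_le_card
      intro k hk
      simp only [mem_biUnion] at hk
      obtain ⟨l, _, h⟩ := hk
      exact (mem_filter.mp (mem_filter.mp h).1).1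
    · intro l hl l' hl' hne
      show Disjoint (Fl l) (Fl l')
      rw [Finset.disjoint_left]
      intro k hk hk'
      exact hne (huniq k l l' (by simpa using hl) (by simpa using hl') (mem_filter.mp hk).2 (mem_filter.mp hk').2)
  · have hsub : bad ⊆ (F.filter fun k => ∃ l, l < n ∧ s k < p l ∧ p l < s (k + 1)) ∪
        (F.filter fun k => ∃ l, l < n ∧ s k < q l ∧ q l < s (k + 1)) := by
      intro k hk
      simp only [bad, mem_filter, mem_sdiff] at hk
      obtain ⟨⟨hF, hU⟩, hne⟩ := hk
      have hex : ∃ l ∈ range n, T l (Pr (p l) (q l) (a k)) ≠ 0 := by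
        by_contra h
        push Not at h
        apply hne
        rw [node_apply, Finset.sum_eq_zero h, smul_zero]
      obtain ⟨l, hl, h⟩ := hex
      have hl' : l < n := by simpa using hl
      have hpz : Pr (p l) (q l) (a k) ≠ 0 := fun e => h (by rw [e, map_zero])
      have h1 : ¬ (q l ≤ s k ∨ s (k + 1) ≤ p l) := fun e => hpz (Pr_eq_zero (ha k hF) e)
      have h2 : ¬ c k l := by
        intro e
        exact hU (mem_filter.mpr ⟨hF, l, hl', e⟩)
      simp only [c] at h2
      simp only [mem_union, mem_filter]
      by_cases h3 : s k < p l
      · left; exact ⟨hF, l, hl', h3, by omega⟩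
      · right; exact ⟨hF, l, hl', by omega, by omega⟩
    have e1 := card_inside n p hm F
    have e2 := card_inside n q hm F
    have e3 := (Finset.card_le_card hsub).trans (Finset.card_union_le _ _)
    omega
  · have h1 : ∑ k ∈ F, node w T p q (a k) = ∑ k ∈ U, node w T p q (a k) + ∑ k ∈ F \ U, node w T p q (a k) := by
      rw [add_comm, Finset.sum_sdiff (filter_subset _ _)]
    have h2 : ∑ k ∈ F \ U, node w T p q (a k) = ∑ k ∈ bad, node w T p q (a k) := by
      rw [Finset.sum_filter_ne_zero]
    rw [map_sum, h1, h2]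
    congr 1
    simp_rw [node_apply]
    rw [← Finset.smul_sum, Finset.sum_comm]
    congr 1
    apply Finset.sum_congr rfl
    intro l hl
    have e0 : T l (∑ k ∈ Fl l, a k) = ∑ k ∈ U, if c k l then T l (a k) else 0 := by
      rw [map_sum]
      show ∑ k ∈ U.filter (fun k => c k l), T l (a k) = _
      rw [Finset.sum_filter (fun k => c k l)]
    rw [e0]
    apply Finset.sum_congr rfl
    intro k hk
    exact hkey k hk l hl

/-! numeric lemmas -/
lemma sum_rpow_le (n : ℕ) (f : ℕ → ℕ) {δ : ℝ} (h0 : 0 ≤ δ) (h1 : δ ≤ 1) :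
    ∑ l ∈ range n, (f l : ℝ) ^ (1 - δ) ≤ (n : ℝ) ^ δ * (∑ l ∈ range n, (f l : ℝ)) ^ (1 - δ) := by
  rcases Nat.eq_zero_or_pos n with rfl | hn
  · simp; positivity
  have hn' : (0 : ℝ) < n := by exact_mod_cast hn
  have := (Real.concaveOn_rpow (p := 1 - δ) (by linarith) (by linarith)).le_map_sum (t := range n)
    (w := fun _ => (n : ℝ)⁻¹) (p := fun l => (f l : ℝ)) (fun _ _ => by positivity)
    (by simp [hn'.ne']) (fun i _ => by simp)
  simp only [smul_eq_mul] at this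
  rw [← Finset.mul_sum, ← Finset.mul_sum, Real.mul_rpow (by positivity) (by positivity),
    Real.inv_rpow (by positivity)] at this
  have e : (n : ℝ) ^ δ = n * ((n : ℝ) ^ (1 - δ))⁻¹ := by
    rw [Real.rpow_sub hn', Real.rpow_one]; field_simp
  rw [e, mul_assoc]
  rwa [inv_mul_le_iff₀ hn'] at this

lemma le_rpow_mul {x A ℓ δ : ℝ} (hx : 0 ≤ x) (hA : x ≤ A) (hl : x ≤ ℓ) (h0 : 0 ≤ δ) (h1 : δ ≤ 1) :
    x ≤ A ^ δ * ℓ ^ (1 - δ) := by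
  have hA0 : 0 ≤ A := hx.trans hA
  have hl0 : 0 ≤ ℓ := hx.trans hl
  rcases hx.eq_or_lt with rfl | hx
  · positivity
  calc x = x ^ δ * x ^ (1 - δ) := by rw [← Real.rpow_add hx]; simp
    _ ≤ _ := by
      apply mul_le_mul (Real.rpow_le_rpow hx.le hA h0) (Real.rpow_le_rpow hx.le hl (by linarith))
        (by positivity) (by positivity)

def dl (j : ℕ) : ℝ := 1 / (mu j : ℝ)
lemma dl_nonneg (j : ℕ) : 0 ≤ dl j := by unfold dl; positivity
lemma dl_le (j : ℕ) : dl j ≤ 1 := by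
  unfold dl
  rw [div_le_one (by exact_mod_cast mu_pos j)]
  exact_mod_cast mu_pos j
lemma two_nn_rpow {w j : ℕ} (h : w < j) : ((2 : ℝ) * nn w) ^ dl j ≤ 2 := by
  have h1 : (2 : ℝ) * nn w ≤ 2 ^ (mu j) := by
    have e : (2 : ℝ) * nn w = 2 ^ (mu (w + 1)) := by
      unfold nn; simp only [mu]; push_cast
      rw [show (16 : ℝ) = 2 ^ 4 by norm_num, ← pow_mul, pow_succ]; ring
    rw [e]
    exact pow_le_pow_right₀ (by norm_num) (mu_strictMono.monotone h)
  refine (Real.rpow_le_rpow (by positivity) h1 (dl_nonneg j)).trans ?_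
  rw [← Real.rpow_natCast, ← Real.rpow_mul (by norm_num), dl, mul_one_div_cancel, Real.rpow_one]
  have := mu_pos j
  positivity
lemma nn_rpow {w j : ℕ} (h : w < j) : (nn w : ℝ) ^ dl j ≤ 2 := by
  refine le_trans ?_ (two_nn_rpow h)
  apply Real.rpow_le_rpow (by positivity) _ (dl_nonneg j)
  have : (0 : ℝ) ≤ nn w := by positivity
  linarith
lemma nn_rpow_self (j : ℕ) : (nn j : ℝ) ^ (1 - dl j) = nn j / mm j ^ 2 := by
  have hp : (0 : ℝ) < nn j := by exact_mod_cast nn_pos j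
  rw [Real.rpow_sub hp, Real.rpow_one]
  congr 1
  have : (nn j : ℝ) = (mm j ^ 2) ^ (mu j) := by
    unfold nn mm; push_cast
    rw [show (16 : ℝ) = 4 ^ 2 by norm_num, ← pow_mul, ← pow_mul, ← pow_mul]; ring_nf
  rw [this, ← Real.rpow_natCast, ← Real.rpow_mul (by positivity), dl, mul_one_div_cancel, Real.rpow_one]
  have := mu_pos j
  positivity

/-- The bound function -/
def bd (j : ℕ) (θ : ℝ) (F : Finset ℕ) : ℝ := (F.card : ℝ) ^ (1 - dl j) + θ * F.card

lemma bd_nonneg (j : ℕ) {θ : ℝ} (hθ : 0 ≤ θ) (F : Finset ℕ) : 0 ≤ bd j θ F := by unfold bd; positivity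

lemma node_step {j : ℕ} {w : ℕ} (hw : w < j) {T : ℕ → Op} {p q : ℕ → ℕ} (hs : Suc (nn w) p q) {s : ℕ → ℕ}
    (hm : StrictMono s) {a : ℕ → AA} {F : Finset ℕ} (ha : ∀ k ∈ F, Supp (s k) (s (k + 1)) (a k))
    {C θ : ℝ} (hC : 0 ≤ C) (hθ : 0 ≤ θ)
    (hF : OC F)
    (hT : ∀ l, l < nn w → ∀ F', F' ⊆ F → OC F' → ‖T l (∑ k ∈ F', a k)‖ ≤ 2 * C * bd j θ F')
    (hb : ∀ k ∈ F, ‖node w T p q (a k)‖ ≤ C * (mm w)⁻¹) :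
    ‖node w T p q (∑ k ∈ F, a k)‖ ≤ (mm w)⁻¹ * (6 * C * bd j θ F) := by
  obtain ⟨Fl, bad, h1, h2, h2', h3, h4, h5⟩ := split_node T hs hm ha
  rw [h5]
  have hmi : 0 ≤ (mm w)⁻¹ := inv_nonneg.mpr (mm_pos w).le
  have e1 : ‖(mm w)⁻¹ • ∑ l ∈ range (nn w), T l (∑ k ∈ Fl l, a k)‖ ≤
      (mm w)⁻¹ * (2 * C * (2 * (F.card : ℝ) ^ (1 - dl j) + θ * F.card)) := by
    rw [norm_smul, Real.norm_of_nonneg hmi]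
    apply mul_le_mul_of_nonneg_left _ hmi
    refine (norm_sum_le _ _).trans ?_
    refine (Finset.sum_le_sum fun l hl => hT l (mem_range.mp hl) (Fl l) (h2 l)
      (h2' hF l (mem_range.mp hl))).trans ?_
    rw [← Finset.mul_sum]
    apply mul_le_mul_of_nonneg_left _ (by positivity)
    unfold bd
    rw [Finset.sum_add_distrib, ← Finset.mul_sum]
    have h3' : ∑ l ∈ range (nn w), ((Fl l).card : ℝ) ≤ F.card := by exact_mod_cast h3
    apply add_le_add
    · refine (sum_rpow_le _ _ (dl_nonneg j) (dl_le j)).trans ?_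
      have hs0 : (0 : ℝ) ≤ ∑ l ∈ range (nn w), ((Fl l).card : ℝ) := Finset.sum_nonneg fun _ _ => Nat.cast_nonneg _
      have hd := dl_le j
      exact mul_le_mul (nn_rpow hw) (Real.rpow_le_rpow hs0 h3' (by linarith)) (Real.rpow_nonneg hs0 _) two_pos.le
    · exact mul_le_mul_of_nonneg_left h3' hθ
  have e2 : ‖∑ k ∈ bad, node w T p q (a k)‖ ≤ (mm w)⁻¹ * (C * (2 * (F.card : ℝ) ^ (1 - dl j))) := by
    refine (norm_sum_le _ _).trans ?_
    refine (Finset.sum_le_sum fun k hk => hb k (h1 hk)).trans ?_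
    rw [Finset.sum_const, nsmul_eq_mul]
    have h6 : (bad.card : ℝ) ≤ 2 * (F.card : ℝ) ^ (1 - dl j) := by
      refine (le_rpow_mul (A := 2 * nn w) (ℓ := F.card) (by positivity) (by exact_mod_cast h4)
        (by exact_mod_cast Finset.card_le_card h1) (dl_nonneg j) (dl_le j)).trans ?_
      apply mul_le_mul_of_nonneg_right (two_nn_rpow hw) (by positivity)
    have := mul_le_mul_of_nonneg_right h6 (show 0 ≤ C * (mm w)⁻¹ by positivity)
    linarith
  refine (norm_add_le _ _).trans ((add_le_add e1 e2).trans ?_)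
  rw [← mul_add]
  apply mul_le_mul_of_nonneg_left _ hmi
  unfold bd
  have : 0 ≤ C * (θ * F.card) := by positivity
  nlinarith

theorem main_est {j : ℕ} {s : ℕ → ℕ} (hm : StrictMono s) {a : ℕ → AA} {G : Finset ℕ}
    (ha : ∀ k ∈ G, Supp (s k) (s (k + 1)) (a k)) {C θ : ℝ} (hC : 0 ≤ C) (hθ : 0 ≤ θ)
    (h1 : ∀ k ∈ G, ∀ n, ‖a k n‖ ≤ C)
    (h2 : ∀ w, w < j → ∀ T, IsNode w T → ∀ k ∈ G, ‖T (a k)‖ ≤ C * (mm w)⁻¹)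
    (h3 : ∀ w, j ≤ w → ∀ T, IsNode w T → ∀ F, F ⊆ G → OC F → ‖T (∑ k ∈ F, a k)‖ ≤ C * (1 + θ * F.card))
    {T : Op} (hT : Mem T) : ∀ F, F ⊆ G → OC F → ‖T (∑ k ∈ F, a k)‖ ≤ 2 * C * bd j θ F := by
  have hcard : ∀ F : Finset ℕ, F.Nonempty → (1 : ℝ) ≤ (F.card : ℝ) ^ (1 - dl j) := by
    intro F hF
    apply Real.one_le_rpow _ (by linarith [dl_le j])
    exact_mod_cast hF.card_pos
  refine Mem.ind (P := fun T => ∀ F, F ⊆ G → OC F → ‖T (∑ k ∈ F, a k)‖ ≤ 2 * C * bd j θ F) ?_ ?_ ?_ hT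
  · intro n F hF hFo
    rcases F.eq_empty_or_nonempty with rfl | hne
    · simp only [Finset.sum_empty, map_zero, norm_zero]
      exact mul_nonneg (by positivity) (bd_nonneg j hθ _)
    have hb1 : 1 ≤ bd j θ F := by
      unfold bd
      have := hcard F hne
      have : 0 ≤ θ * F.card := by positivity
      linarith
    have hle : ‖(Finsupp.lapply n : Op) (∑ k ∈ F, a k)‖ ≤ C := by
      rw [map_sum]
      by_cases hex : ∃ k ∈ F, a k n ≠ 0
      · obtain ⟨k, hk, hk'⟩ := hex
        rw [Finset.sum_eq_single k]
        · exact h1 k (hF hk) n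
        · intro k' hk1 hk2
          by_contra hk3
          have e1 := ha k (hF hk) n hk'
          have e2 := ha k' (hF hk1) n hk3
          rcases Nat.lt_or_gt_of_ne hk2 with h' | h'
          · have := hm.monotone (Nat.succ_le_of_lt h'); simp only [Nat.succ_eq_add_one] at this; omega
          · have := hm.monotone (Nat.succ_le_of_lt h'); simp only [Nat.succ_eq_add_one] at this; omega
        · intro h; exact absurd hk h
      · push Not at hex
        rw [Finset.sum_eq_zero (fun k hk => show (Finsupp.lapply n : Op) (a k) = 0 from hex k hk)]
        simpa using hC
    nlinarith
  · intro T _ f hf h F hF hFo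
    apply le_of_forall_pos_le_add
    intro ε hε
    obtain ⟨i, hi⟩ := h (∑ k ∈ F, a k) ε hε
    have := hf (∑ k ∈ F, a k) i F hF hFo
    linarith
  · intro w T p q hnode hs ih F hF hFo
    have hb0 := bd_nonneg j hθ F
    by_cases hw : w < j
    · have := node_step hw hs hm (fun k hk => ha k (hF hk)) hC hθ hFo (fun l hl F' hF' hFo' => ih l hl F' (hF'.trans hF) hFo')
        (fun k hk => h2 w hw _ hnode k (hF hk))
      refine this.trans ?_
      have hm4 : (mm w)⁻¹ ≤ 1 / 4 := by
        rw [one_div]; exact inv_anti₀ (by norm_num) (mm_ge w)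
      have := mul_le_mul_of_nonneg_right hm4 (show 0 ≤ 6 * C * bd j θ F by positivity)
      have : 0 ≤ C * bd j θ F := by positivity
      nlinarith
    · rcases F.eq_empty_or_nonempty with rfl | hne
      · simp only [Finset.sum_empty, map_zero, norm_zero]
        exact mul_nonneg (by positivity) (bd_nonneg j hθ _)
      have h4 := h3 w (not_lt.mp hw) _ hnode F hF hFo
      have h5 := hcard F hne
      have : C * (1 + θ * F.card) ≤ C * bd j θ F := by
        apply mul_le_mul_of_nonneg_left _ hC
        unfold bd; linarith
      have : 0 ≤ C * bd j θ F := by positivity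
      linarith

/-- node version of `main_est` -/
theorem main_est_node {j : ℕ} {s : ℕ → ℕ} (hm : StrictMono s) {a : ℕ → AA} {G : Finset ℕ}
    (ha : ∀ k ∈ G, Supp (s k) (s (k + 1)) (a k)) {C θ : ℝ} (hC : 0 ≤ C) (hθ : 0 ≤ θ)
    (h1 : ∀ k ∈ G, ∀ n, ‖a k n‖ ≤ C)
    (h2 : ∀ w, w < j → ∀ T, IsNode w T → ∀ k ∈ G, ‖T (a k)‖ ≤ C * (mm w)⁻¹)
    (h3 : ∀ w, j ≤ w → ∀ T, IsNode w T → ∀ F, F ⊆ G → OC F → ‖T (∑ k ∈ F, a k)‖ ≤ C * (1 + θ * F.card))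
    (hG : OC G) {w : ℕ} (hw : w < j) {T : Op} (hT : IsNode w T) :
    ‖T (∑ k ∈ G, a k)‖ ≤ (mm w)⁻¹ * (6 * C * bd j θ G) := by
  obtain ⟨Tc, p, q, hs, hM, rfl⟩ := hT.form
  exact node_step hw hs hm ha hC hθ hG
    (fun l hl F' hF' hFo' => main_est hm ha hC hθ h1 h2 h3 (hM l hl) F' hF' hFo')
    (fun k hk => h2 w hw _ hT k hk)

/-- Level 1: averages. -/
theorem avg_est {w : ℕ} {T : Op} (hT : IsNode w T) {s : ℕ → ℕ} (hm : StrictMono s) {α : ℕ → AA} {N : ℕ}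
    (hα : ∀ k, k < N → Supp (s k) (s (k + 1)) (α k)) (hL : ∀ k, k < N → LL (α k) ≤ 1)
    (hN : 2 * nn w * mm w ≤ N) : ‖T ((N : ℝ)⁻¹ • ∑ k ∈ range N, α k)‖ ≤ 2 * (mm w)⁻¹ := by
  have hN0 : (0 : ℝ) < N := by
    have h1 := mm_pos w
    have h2 : (0 : ℝ) < nn w := by exact_mod_cast nn_pos w
    have : 0 < 2 * nn w * mm w := by positivity
    linarith
  obtain ⟨Tc, p, q, hs, hM, hTeq⟩ := hT.form
  obtain ⟨Fl, bad, h1, h2, h2', h3, h4, h5⟩ := split_node (w := w) Tc hs hm (a := α) (F := range N)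
    (fun k hk => hα k (by simpa using hk))
  rw [← hTeq] at h5
  have hmi : 0 ≤ (mm w)⁻¹ := inv_nonneg.mpr (mm_pos w).le
  have e1 : ‖(mm w)⁻¹ • ∑ l ∈ range (nn w), Tc l (∑ k ∈ Fl l, α k)‖ ≤ (mm w)⁻¹ * N := by
    rw [norm_smul, Real.norm_of_nonneg hmi]
    apply mul_le_mul_of_nonneg_left _ hmi
    refine (norm_sum_le _ _).trans ?_
    have : ∀ l ∈ range (nn w), ‖Tc l (∑ k ∈ Fl l, α k)‖ ≤ ((Fl l).card : ℝ) := by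
      intro l hl
      rw [map_sum]
      refine (norm_sum_le _ _).trans ?_
      refine (Finset.sum_le_sum (g := fun _ => (1 : ℝ)) fun k hk => ?_).trans (by simp)
      exact ((hM l (mem_range.mp hl)).le_LL _).trans (hL k (by simpa using h2 l hk))
    refine (Finset.sum_le_sum this).trans ?_
    rw [card_range] at h3
    exact_mod_cast h3
  have e2 : ‖∑ k ∈ bad, T (α k)‖ ≤ (mm w)⁻¹ * N := by
    refine (norm_sum_le _ _).trans ?_
    refine (Finset.sum_le_sum (g := fun _ => (1 : ℝ)) fun k hk => ?_).trans ?_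
    · exact (hT.mem.le_LL _).trans (hL k (by simpa using h1 hk))
    · have h4' : (bad.card : ℝ) ≤ 2 * nn w := by exact_mod_cast h4
      simp only [Finset.sum_const, nsmul_eq_mul, mul_one]
      rw [le_inv_mul_iff₀ (mm_pos w)]
      have := mul_le_mul_of_nonneg_right h4' (mm_pos w).le
      linarith
  rw [map_smul, norm_smul, norm_inv, Real.norm_of_nonneg hN0.le, h5, inv_mul_le_iff₀ hN0]
  refine (norm_add_le _ _).trans ?_
  linarith
end
end GMHI

set_option linter.unusedVariables false
set_option linter.unusedSimpArgs false
namespace GMHI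
open Finset
noncomputable section

lemma OC_range (n : ℕ) : OC (range n) := by
  intro x _ z hz y _ hyz
  simp only [mem_range] at hz ⊢; omega

lemma nn_ge_mm_sq (w : ℕ) : mm w ^ 2 ≤ nn w := by
  unfold nn mm; push_cast
  rw [show (16 : ℝ) = 4 ^ 2 by norm_num, ← pow_mul, ← pow_mul]
  have := mu_pos w
  exact pow_le_pow_right₀ (by norm_num) (by nlinarith)

lemma sum_half_le (F : Finset ℕ) : ∑ k ∈ F, (1 / 2 : ℝ) ^ (k + 1) ≤ 1 := by
  have h : ∀ k : ℕ, (1 / 2 : ℝ) ^ (k + 1) = (1 / 2) ^ k * (1 / 2) := fun k => pow_succ _ _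
  simp_rw [h]
  rw [← Finset.sum_mul]
  have := (summable_geometric_two).sum_le_tsum F (fun i _ => by positivity)
  rw [tsum_geometric_two] at this
  linarith

/-- level two vectors -/
structure Good (w₀ : ℕ) (c : AA) : Prop where
  norm : LL c ≤ 8
  lo : ∀ w, w < w₀ → ∀ T, IsNode w T → ‖T c‖ ≤ 24 * (mm w)⁻¹
  hi : ∀ w, w₀ < w → ∀ T, IsNode w T → ‖T c‖ ≤ 4 * (mm w₀)⁻¹

lemma Good.sA {w₀ : ℕ} {c : AA} (h : Good w₀ c) (m : ℤ) : Good w₀ (sA m c) where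
  norm := by rw [LL_isLN.shift]; exact h.norm
  lo w hw T hT := by rw [hT.mem.shift, sK_norm]; exact h.lo w hw T hT
  hi w hw T hT := by rw [hT.mem.shift, sK_norm]; exact h.hi w hw T hT

theorem good_of_ris {w₀ : ℕ} {s : ℕ → ℕ} (hm : StrictMono s) {a : ℕ → AA}
    (ha : ∀ k, Supp (s k) (s (k + 1)) (a k)) {J : ℕ → ℕ} (hJ : StrictMono J) (hJ0 : J 0 = w₀)
    (r1 : ∀ k, ∀ w, w < J k → ∀ T, IsNode w T → ‖T (a k)‖ ≤ 2 * (mm w)⁻¹)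
    (r2 : ∀ k, LL (a k) ≤ 1)
    (r3 : ∀ k, n1 (a k) * 2 ^ (k + 1) ≤ mm (J (k + 1))) :
    Good w₀ ((mm w₀ / nn w₀ : ℝ) • ∑ k ∈ range (nn w₀), a k) := by
  set m := mm w₀ with hmdef
  set n := nn w₀ with hndef
  have hm0 : 0 < m := mm_pos _
  have hn0 : (0 : ℝ) < n := by exact_mod_cast nn_pos _
  have hm4 : 4 ≤ m := mm_ge _
  have hnm : m ^ 2 ≤ n := nn_ge_mm_sq _
  have key : ∀ w, w₀ ≤ w → ∀ T, IsNode w T → ∀ F : Finset ℕ, ‖T (∑ k ∈ F, a k)‖ ≤ 2 + 2 * (mm w)⁻¹ * F.card := by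
    intro w hw T hT F
    have hfin : ∃ k, w < J (k + 1) := ⟨w, (Nat.lt_succ_self w).trans_le (hJ.id_le _)⟩
    classical
    let ks := Nat.find hfin
    have hks : w < J (ks + 1) := Nat.find_spec hfin
    have hlt : ∀ k, k < ks → J (k + 1) ≤ w := fun k hk => not_lt.mp (Nat.find_min hfin hk)
    have hmi : 0 ≤ (mm w)⁻¹ := inv_nonneg.mpr (mm_pos w).le
    have hb : ∀ k ∈ F, ‖T (a k)‖ ≤ 2 * (mm w)⁻¹ + (if k = ks then 1 else 0) + (1 / 2 : ℝ) ^ (k + 1) := by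
      intro k _
      have hp : (0 : ℝ) ≤ (1 / 2 : ℝ) ^ (k + 1) := by positivity
      rcases lt_trichotomy k ks with h | h | h
      · rw [if_neg h.ne]
        have h1 := hT.le_n1 (a k)
        have h2 := (r3 k).trans (mm_mono (hlt k h))
        have h3 : (mm w)⁻¹ * n1 (a k) ≤ (1 / 2 : ℝ) ^ (k + 1) := by
          rw [inv_mul_le_iff₀ (mm_pos w), one_div, inv_pow, ← div_eq_mul_inv, le_div_iff₀ (by positivity)]
          exact h2
        linarith
      · rw [if_pos h]
        have h1 := (hT.mem.le_LL (a k)).trans (r2 k)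
        linarith
      · rw [if_neg h.ne']
        have := r1 k w (hks.trans_le (hJ.monotone h)) T hT
        linarith
    rw [map_sum]
    refine (norm_sum_le _ _).trans ((Finset.sum_le_sum hb).trans ?_)
    rw [Finset.sum_add_distrib, Finset.sum_add_distrib, Finset.sum_const, nsmul_eq_mul]
    have h1 := sum_half_le F
    have h2 : ∑ k ∈ F, (if k = ks then (1 : ℝ) else 0) ≤ 1 := by
      rw [Finset.sum_ite_eq']; split_ifs <;> norm_num
    linarith
  have h1 : ∀ k ∈ range n, ∀ i, ‖a k i‖ ≤ 2 := fun k _ i =>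
    (LL_isLN.low _ _).trans ((r2 k).trans (by norm_num))
  have h2 : ∀ w, w < w₀ → ∀ T, IsNode w T → ∀ k ∈ range n, ‖T (a k)‖ ≤ 2 * (mm w)⁻¹ := by
    intro w hw T hT k _
    exact r1 k w (by rw [← hJ0] at hw; exact hw.trans_le (hJ.monotone (Nat.zero_le k))) T hT
  have h3 : ∀ w, w₀ ≤ w → ∀ T, IsNode w T → ∀ F, F ⊆ range n → OC F →
      ‖T (∑ k ∈ F, a k)‖ ≤ 2 * (1 + m⁻¹ * F.card) := by
    intro w hw T hT F _ _
    refine (key w hw T hT F).trans ?_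
    have : (mm w)⁻¹ ≤ m⁻¹ := inv_anti₀ hm0 (mm_mono hw)
    have := mul_le_mul_of_nonneg_right this (show (0 : ℝ) ≤ F.card by positivity)
    linarith
  have hbd : bd w₀ m⁻¹ (range n) ≤ 2 * n / m := by
    unfold bd
    rw [card_range, nn_rpow_self]
    have : (nn w₀ : ℝ) / mm w₀ ^ 2 ≤ n / m := by
      apply div_le_div_of_nonneg_left hn0.le hm0
      nlinarith
    have e : m⁻¹ * n = n / m := by ring
    rw [e]
    have : 2 * (n : ℝ) / m = n / m + n / m := by ring
    linarith
  have hsc : ∀ (T : Op) (B : ℝ), ‖T (∑ k ∈ range n, a k)‖ ≤ n / m * B →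
      ‖T ((m / n : ℝ) • ∑ k ∈ range n, a k)‖ ≤ B := by
    intro T B h
    rw [map_smul, norm_smul, Real.norm_of_nonneg (by positivity)]
    have := mul_le_mul_of_nonneg_left h (show 0 ≤ m / (n : ℝ) by positivity)
    have e : m / n * (n / m * B) = B := by field_simp
    linarith
  refine ⟨LL_le fun T hT => hsc T 8 ?_, fun w hw T hT => hsc T _ ?_, fun w hw T hT => hsc T _ ?_⟩
  · refine (main_est (j := w₀) hm (fun k _ => ha k) (by norm_num) (by positivity) h1 h2 h3 hT _ (Subset.refl _)
      (OC_range n)).trans ?_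
    have e : (n : ℝ) / m * 8 = 2 * 2 * (2 * n / m) := by ring
    linarith
  · refine (main_est_node (j := w₀) hm (fun k _ => ha k) (by norm_num) (by positivity) h1 h2 h3
      (OC_range n) hw hT).trans ?_
    have e : (n : ℝ) / m * (24 * (mm w)⁻¹) = (mm w)⁻¹ * (6 * 2 * (2 * n / m)) := by ring
    rw [e]
    exact mul_le_mul_of_nonneg_left (by linarith) (inv_nonneg.mpr (mm_pos w).le)
  · refine (key w hw.le T hT _).trans ?_
    rw [card_range]
    have h5 : (mm w)⁻¹ * n ≤ 1 := by
      rw [inv_mul_le_iff₀ (mm_pos w)]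
      have h6 := mm_nn hw
      have : (1 : ℝ) ≤ n := by nlinarith
      nlinarith
    have h6 : (1 : ℝ) ≤ n / m * m⁻¹ := by
      rw [← div_eq_mul_inv, div_div, le_div_iff₀ (by positivity)]
      nlinarith
    nlinarith
end
end GMHI

set_option linter.unusedVariables false
set_option linter.unusedSimpArgs false
namespace GMHI
open Finset
noncomputable section

lemma tt_inj {j : ℕ} {d d' : ℕ → ℕ} {l l' : ℕ} (h : tt j d l = tt j d' l') :
    l = l' ∧ ∀ i, i < l → d i = d' i := by
  unfold tt at h
  have h1 : Encodable.encode ((List.range l).map d) = Encodable.encode ((List.range l').map d') := by omega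
  have h2 := Encodable.encode_injective h1
  have h3 := congrArg List.length h2
  simp only [List.length_map, List.length_range] at h3
  subst h3
  refine ⟨rfl, fun i hi => ?_⟩
  have := List.map_inj_left.mp h2 i (by simpa using hi)
  exact this

lemma tt_congr {j : ℕ} {d d' : ℕ → ℕ} {l : ℕ} (h : ∀ i, i < l → d i = d' i) : tt j d l = tt j d' l := by
  unfold tt
  congr 2
  apply List.map_congr_left
  intro i hi
  exact h i (by simpa using hi)

lemma tt_gt (j : ℕ) (d : ℕ → ℕ) (l : ℕ) : 2 * j + 1 < 2 * tt j d l := by unfold tt; omega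

lemma alt_sum {F : Finset ℕ} (hF : OC F) : |∑ i ∈ F, (-1 : ℝ) ^ i| ≤ 1 := by
  rcases F.eq_empty_or_nonempty with rfl | hne
  · simp
  have e : F = Ico (F.min' hne) (F.max' hne + 1) := by
    ext x
    simp only [mem_Ico]
    constructor
    · intro hx
      have h1 := F.min'_le x hx
      have h2 := F.le_max' x hx
      omega
    · intro hx
      exact hF _ (F.min'_mem hne) _ (F.max'_mem hne) x hx.1 (by omega)
  have hle : F.min' hne ≤ F.max' hne + 1 := by
    have := F.min'_le _ (F.max'_mem hne); omega
  rw [e, Finset.sum_Ico_eq_sub _ hle, neg_one_geom_sum, neg_one_geom_sum]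
  split_ifs <;> norm_num

section
variable {j : ℕ} {d : ℕ → ℕ} {s : ℕ → ℕ} (hm : StrictMono s) {c : ℕ → AA}
  (hc : ∀ i, Supp (s i) (s (i + 1)) (c i)) (hg : ∀ i, Good (2 * tt j d i) (c i))

/-- off weight estimate -/
lemma off_est {w i : ℕ} {c : AA} (hg : Good (2 * tt j d i) c) (hw : 2 * j + 1 < w) (hne : w ≠ 2 * tt j d i)
    {T : Op} (hT : IsNode w T) : ‖T c‖ ≤ 24 * (((nn (2 * j + 1) : ℝ)) ^ 2)⁻¹ := by
  have hn0 : (0 : ℝ) < nn (2 * j + 1) := by exact_mod_cast nn_pos _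
  rcases Nat.lt_or_gt_of_ne hne with h | h
  · refine (hg.lo w h T hT).trans ?_
    apply mul_le_mul_of_nonneg_left _ (by norm_num)
    exact inv_anti₀ (by positivity) (mm_nn hw)
  · refine (hg.hi w h T hT).trans ?_
    have h1 : (mm (2 * tt j d i))⁻¹ ≤ (((nn (2 * j + 1) : ℝ)) ^ 2)⁻¹ :=
      inv_anti₀ (by positivity) (mm_nn (tt_gt j d i))
    have h2 : 0 ≤ (((nn (2 * j + 1) : ℝ)) ^ 2)⁻¹ := by positivity
    linarith

lemma norm_sgn (i : ℕ) (x : KK) : ‖((-1 : ℝ) ^ i) • x‖ = ‖x‖ := by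
  rw [norm_smul]; simp

include hg in
lemma high_est {w : ℕ} (hw : 2 * j + 1 < w) {T : Op} (hT : IsNode w T) {F : Finset ℕ}
    (hF : F ⊆ range (nn (2 * j + 1))) : ‖T (∑ i ∈ F, ((-1 : ℝ) ^ i) • c i)‖ ≤ 36 := by
  classical
  have hn1 : (1 : ℝ) ≤ nn (2 * j + 1) := by exact_mod_cast nn_pos _
  set n : ℝ := (nn (2 * j + 1) : ℝ) with hn
  have hb : ∀ i ∈ F, ‖T (((-1 : ℝ) ^ i) • c i)‖ ≤ 24 * (n ^ 2)⁻¹ + if w = 2 * tt j d i then 8 else 0 := by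
    intro i _
    rw [map_smul, norm_sgn]
    split_ifs with h
    · have := (hT.mem.le_LL (c i)).trans (hg i).norm
      have : 0 ≤ (n ^ 2)⁻¹ := by positivity
      linarith
    · have := off_est (hg i) hw h hT
      linarith
  rw [map_sum]
  refine (norm_sum_le _ _).trans ((Finset.sum_le_sum hb).trans ?_)
  rw [Finset.sum_add_distrib, Finset.sum_const, nsmul_eq_mul]
  have h1 : ∑ i ∈ F, (if w = 2 * tt j d i then (8 : ℝ) else 0) ≤ 8 := by
    rw [← Finset.sum_filter, Finset.sum_const, nsmul_eq_mul]
    have : (filter (fun i => w = 2 * tt j d i) F).card ≤ 1 := by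
      rw [Finset.card_le_one]
      intro x hx y hy
      have h1 := (mem_filter.mp hx).2
      have h2 := (mem_filter.mp hy).2
      exact (tt_inj (show tt j d x = tt j d y by omega)).1
    have : ((filter (fun i => w = 2 * tt j d i) F).card : ℝ) ≤ 1 := by exact_mod_cast this
    linarith
  have h2 : (F.card : ℝ) ≤ n := by
    have := Finset.card_le_card hF
    rw [card_range] at this
    rw [hn]; exact_mod_cast this
  have h3 : (F.card : ℝ) * (24 * (n ^ 2)⁻¹) ≤ 24 := by
    have e : 24 * (n ^ 2)⁻¹ = 24 / n ^ 2 := by ring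
    rw [e, ← mul_div_assoc, div_le_iff₀ (by positivity)]
    nlinarith
  linarith

include hm hc hg in
set_option maxHeartbeats 1000000 in
lemma odd_est (hd : ∀ i, n1 (c i - dd (d i)) ≤ (nn (2 * j + 1) : ℝ)⁻¹) {S : Op} (hS : OddNode j S) {F : Finset ℕ}
    (hF : F ⊆ range (nn (2 * j + 1))) (hFo : OC F) : ‖S (∑ i ∈ F, ((-1 : ℝ) ^ i) • c i)‖ ≤ 36 := by
  classical
  obtain ⟨d', T, p, q, e, e', h1, h2, h3, rfl⟩ := hS
  have hn1 : (1 : ℝ) ≤ nn (2 * j + 1) := by exact_mod_cast nn_pos _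
  have hnode : ∀ l, l < nn (2 * j + 1) → ∀ u v, IsNode (2 * tt j d' l) ((T l).comp (Pr u v)) :=
    fun l hl u v => ((h1 l hl).comp_Pr u v).isNode
  set n : ℕ := nn (2 * j + 1) with hn
  set y : ℕ → ℕ → KK := fun l i => T l (Pr (max (p l) e) (min (q l) e') (c i)) with hy
  have hy8 : ∀ l, l < n → ∀ i, ‖y l i‖ ≤ 8 := by
    intro l hl i
    exact ((hnode l hl _ _).mem.le_LL (c i)).trans (hg i).norm
  have hoff : ∀ l, l < n → ∀ i, tt j d' l ≠ tt j d i → ‖y l i‖ ≤ 24 * ((n : ℝ) ^ 2)⁻¹ := by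
    intro l hl i hne
    exact off_est (hg i) (tt_gt j d' l) (by omega) (hnode l hl (max (p l) e) (min (q l) e'))
  set A := F.filter fun i => tt j d' i = tt j d i with hA
  have hAF : A ⊆ F := filter_subset _ _
  -- diagonal part
  have hdiag : ‖∑ i ∈ A, ((-1 : ℝ) ^ i) • y i i‖ ≤ 35 := by
    rcases A.eq_empty_or_nonempty with hAe | hne
    · rw [hAe]; simp
    set l0 := A.max' hne with hl0
    have hl0A : l0 ∈ A := A.max'_mem hne
    have hl0n : l0 < n := by simpa using hF (hAF hl0A)
    have hagree : ∀ i, i < l0 → d' i = d i := (tt_inj (mem_filter.mp hl0A).2).2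
    set A' := F.filter fun i => i < l0 with hA'
    have hAA' : A.erase l0 = A' := by
      ext i
      simp only [mem_erase, hA', mem_filter, hA]
      constructor
      · rintro ⟨h4, h5, h6⟩
        refine ⟨h5, lt_of_le_of_ne (A.le_max' i (mem_filter.mpr ⟨h5, h6⟩)) h4⟩
      · rintro ⟨h5, h6⟩
        exact ⟨h6.ne, h5, tt_congr fun k hk => hagree k (hk.trans h6)⟩
    rw [← Finset.add_sum_erase A _ hl0A, hAA']
    have hA'n : ∀ i ∈ A', i < n := fun i hi => by simpa using hF (mem_filter.mp hi).1
    -- full blocks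
    set x : ℕ → KK := fun i => T i (Pr (p i) (q i) (c i)) with hx
    set B := A'.filter fun i => e ≤ s i ∧ s (i + 1) ≤ e' with hB
    set Cu := (A'.filter fun k => ∃ l, l < 1 ∧ s k < (fun _ => e) l ∧ (fun _ => e) l < s (k + 1)) ∪
      (A'.filter fun k => ∃ l, l < 1 ∧ s k < (fun _ => e') l ∧ (fun _ => e') l < s (k + 1)) with hCu
    have hCu2 : (Cu.card : ℝ) ≤ 2 := by
      have e1 := card_inside 1 (fun _ => e) hm A'
      have e2 := card_inside 1 (fun _ => e') hm A'
      have e3 := Finset.card_union_le (A'.filter fun k => ∃ l, l < 1 ∧ s k < (fun _ => e) l ∧ (fun _ => e) l < s (k + 1))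
        (A'.filter fun k => ∃ l, l < 1 ∧ s k < (fun _ => e') l ∧ (fun _ => e') l < s (k + 1))
      have : Cu.card ≤ 1 + 1 := e3.trans (add_le_add e1 e2)
      exact_mod_cast this
    have hcase : ∀ i ∈ A', ((-1 : ℝ) ^ i) • y i i = (if e ≤ s i ∧ s (i + 1) ≤ e' then ((-1 : ℝ) ^ i) • x i else 0)
        + (if i ∈ Cu ∧ ¬ (e ≤ s i ∧ s (i + 1) ≤ e') then ((-1 : ℝ) ^ i) • y i i else 0) := by
      intro i hi
      have hPP : Pr (max (p i) e) (min (q i) e') (c i) = Pr (p i) (q i) (Pr e e' (c i)) := (Pr_Pr _ _ _ _ _).symm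
      by_cases hcon : e ≤ s i ∧ s (i + 1) ≤ e'
      · rw [if_pos hcon, if_neg (by tauto), add_zero]
        simp only [hy, hx]
        rw [hPP, Pr_eq_self ((hc i).mono hcon.1 hcon.2)]
      · rw [if_neg hcon, zero_add]
        by_cases hiC : i ∈ Cu
        · rw [if_pos ⟨hiC, hcon⟩]
        · rw [if_neg (by tauto)]
          simp only [hy]
          rw [hPP, Pr_eq_zero (hc i), map_zero, map_zero, smul_zero]
          simp only [hCu, mem_union, mem_filter, hi, true_and, not_or, not_exists, not_and] at hiC
          have h5 := hiC.1 0 (by norm_num)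
          have h6 := hiC.2 0 (by norm_num)
          have h7 := hm (Nat.lt_succ_self i)
          simp only [Nat.succ_eq_add_one] at h7
          omega
    rw [Finset.sum_congr rfl hcase, Finset.sum_add_distrib, ← Finset.sum_filter]
    have hlast : ‖((-1 : ℝ) ^ l0) • y l0 l0‖ ≤ 8 := by rw [norm_sgn]; exact hy8 _ hl0n _
    have hcut : ‖∑ i ∈ A', (if i ∈ Cu ∧ ¬ (e ≤ s i ∧ s (i + 1) ≤ e') then ((-1 : ℝ) ^ i) • y i i else 0)‖ ≤ 16 := by
      rw [← Finset.sum_filter]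
      refine (norm_sum_le _ _).trans ?_
      have hsub : A'.filter (fun i => i ∈ Cu ∧ ¬ (e ≤ s i ∧ s (i + 1) ≤ e')) ⊆ Cu := by
        intro i hi; exact (mem_filter.mp hi).2.1
      refine (Finset.sum_le_sum (g := fun _ => (8 : ℝ)) fun i hi => ?_).trans ?_
      · rw [norm_sgn]; exact hy8 _ (hA'n i (mem_filter.mp hi).1) _
      · rw [Finset.sum_const, nsmul_eq_mul]
        have : ((A'.filter (fun i => i ∈ Cu ∧ ¬ (e ≤ s i ∧ s (i + 1) ≤ e'))).card : ℝ) ≤ Cu.card := by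
          exact_mod_cast Finset.card_le_card hsub
        linarith
    have hfull : ‖∑ i ∈ B, ((-1 : ℝ) ^ i) • x i‖ ≤ 11 := by
      rcases B.eq_empty_or_nonempty with hBe | ⟨i0, hi0⟩
      · rw [hBe]; simp
      have hBA : ∀ i ∈ B, i ∈ A' := fun i hi => (mem_filter.mp hi).1
      have hdx : ∀ i ∈ B, ‖x i - T i (Pr (p i) (q i) (dd (d' i)))‖ ≤ (n : ℝ)⁻¹ := by
        intro i hi
        have hi' := hBA i hi
        rw [hagree i (mem_filter.mp hi').2]
        simp only [hx]
        rw [← map_sub, ← map_sub]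
        refine ((hnode i (hA'n i hi') (p i) (q i)).mem.le_n1 (c i - dd (d i))).trans (hd i)
      have hxx : ∀ i ∈ B, ‖x i - x i0‖ ≤ 3 * (n : ℝ)⁻¹ := by
        intro i hi
        have e1 := hdx i hi
        have e2 := hdx i0 hi0
        have e3 := h3 i i0 (hA'n i (hBA i hi)) (hA'n i0 (hBA i0 hi0))
        have e4 : x i - x i0 = (x i - T i (Pr (p i) (q i) (dd (d' i)))) + (T i (Pr (p i) (q i) (dd (d' i))) -
          T i0 (Pr (p i0) (q i0) (dd (d' i0)))) - (x i0 - T i0 (Pr (p i0) (q i0) (dd (d' i0)))) := by abel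
        rw [e4]
        refine (norm_sub_le _ _).trans ?_
        have := norm_add_le (x i - T i (Pr (p i) (q i) (dd (d' i)))) (T i (Pr (p i) (q i) (dd (d' i))) -
          T i0 (Pr (p i0) (q i0) (dd (d' i0))))
        linarith
      have hx8 : ‖x i0‖ ≤ 8 :=
        ((hnode i0 (hA'n i0 (hBA i0 hi0)) (p i0) (q i0)).mem.le_LL (c i0)).trans (hg i0).norm
      have e5 : ∑ i ∈ B, ((-1 : ℝ) ^ i) • x i = (∑ i ∈ B, (-1 : ℝ) ^ i) • x i0 + ∑ i ∈ B, ((-1 : ℝ) ^ i) • (x i - x i0) := by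
        rw [Finset.sum_smul, ← Finset.sum_add_distrib]
        apply Finset.sum_congr rfl
        intro i _
        rw [smul_sub]; abel
      rw [e5]
      have hBo : OC B := by
        intro u hu v hv w huw hwv
        simp only [hB, hA', mem_filter] at hu hv ⊢
        have g1 := hm.monotone huw
        have g2 := hm.monotone (Nat.succ_le_succ hwv)
        simp only [Nat.succ_eq_add_one] at g2
        exact ⟨⟨hFo u hu.1.1 v hv.1.1 w huw hwv, by omega⟩, by omega, by omega⟩
      have e6 : ‖(∑ i ∈ B, (-1 : ℝ) ^ i) • x i0‖ ≤ 8 := by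
        rw [norm_smul]
        have := alt_sum hBo
        rw [Real.norm_eq_abs]
        nlinarith [norm_nonneg (x i0)]
      have e7 : ‖∑ i ∈ B, ((-1 : ℝ) ^ i) • (x i - x i0)‖ ≤ 3 := by
        refine (norm_sum_le _ _).trans ?_
        refine (Finset.sum_le_sum (g := fun _ => 3 * (n : ℝ)⁻¹) fun i hi => ?_).trans ?_
        · rw [norm_sgn]; exact hxx i hi
        · rw [Finset.sum_const, nsmul_eq_mul]
          have hcard : (B.card : ℝ) ≤ n := by
            have : B ⊆ range n := fun i hi => by simpa using hA'n i (hBA i hi)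
            have := Finset.card_le_card this
            rw [card_range] at this
            exact_mod_cast this
          have e8 : (B.card : ℝ) * (n : ℝ)⁻¹ ≤ 1 := by
            rw [← div_eq_mul_inv]; exact div_le_one_of_le₀ hcard (by positivity)
          linarith
      refine (norm_add_le _ _).trans ?_
      linarith
    refine (norm_add_le _ _).trans ?_
    have := norm_add_le (∑ i ∈ B, ((-1 : ℝ) ^ i) • x i)
      (∑ i ∈ A', (if i ∈ Cu ∧ ¬ (e ≤ s i ∧ s (i + 1) ≤ e') then ((-1 : ℝ) ^ i) • y i i else 0))
    linarith
  -- total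
  have htot : ∑ l ∈ range n, T l (Pr (max (p l) e) (min (q l) e') (∑ i ∈ F, ((-1 : ℝ) ^ i) • c i)) =
      ∑ i ∈ A, ((-1 : ℝ) ^ i) • y i i +
      ∑ l ∈ range n, ∑ i ∈ F, (if l = i ∧ i ∈ A then 0 else ((-1 : ℝ) ^ i) • y l i) := by
    have g1 : ∀ l ∈ range n, T l (Pr (max (p l) e) (min (q l) e') (∑ i ∈ F, ((-1 : ℝ) ^ i) • c i)) =
        ∑ i ∈ F, (if l = i ∧ i ∈ A then ((-1 : ℝ) ^ i) • y l i else 0) +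
        ∑ i ∈ F, (if l = i ∧ i ∈ A then 0 else ((-1 : ℝ) ^ i) • y l i) := by
      intro l _
      rw [← Finset.sum_add_distrib, map_sum, map_sum]
      apply Finset.sum_congr rfl
      intro i _
      rw [map_smul, map_smul]
      split_ifs <;> simp [hy]
    rw [Finset.sum_congr rfl g1, Finset.sum_add_distrib]
    congr 1
    rw [Finset.sum_comm]
    have g2 : ∀ i ∈ F, ∑ l ∈ range n, (if l = i ∧ i ∈ A then ((-1 : ℝ) ^ i) • y l i else 0) =
        if i ∈ A then ((-1 : ℝ) ^ i) • y i i else 0 := by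
      intro i hi
      by_cases hiA : i ∈ A
      · simp only [hiA, and_true, if_true]
        rw [Finset.sum_ite_eq', if_pos (hF hi)]
      · simp [hiA]
    rw [Finset.sum_congr rfl g2, ← Finset.sum_filter]
    congr 1
    ext i
    simp only [mem_filter]
    exact ⟨fun h => h.2, fun h => ⟨hAF h, h⟩⟩
  have hoffsum : ‖∑ l ∈ range n, ∑ i ∈ F, (if l = i ∧ i ∈ A then 0 else ((-1 : ℝ) ^ i) • y l i)‖ ≤ 24 := by
    have g3 : ∀ l ∈ range n, ‖∑ i ∈ F, (if l = i ∧ i ∈ A then 0 else ((-1 : ℝ) ^ i) • y l i)‖ ≤ 24 * (n : ℝ)⁻¹ := by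
      intro l hl
      refine (norm_sum_le _ _).trans ?_
      refine (Finset.sum_le_sum (g := fun _ => 24 * ((n : ℝ) ^ 2)⁻¹) fun i hi => ?_).trans ?_
      · split_ifs with h
        · simp
        · rw [norm_sgn]
          apply hoff l (by simpa using hl) i
          intro heq
          have := (tt_inj heq).1
          subst this
          exact h ⟨rfl, mem_filter.mpr ⟨hi, heq⟩⟩
      · rw [Finset.sum_const, nsmul_eq_mul]
        have hcard : (F.card : ℝ) ≤ n := by
          have := Finset.card_le_card hF
          rw [card_range] at this
          exact_mod_cast this
        have e8 : (F.card : ℝ) * ((n : ℝ) ^ 2)⁻¹ ≤ (n : ℝ)⁻¹ := by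
          rw [← div_eq_mul_inv, div_le_iff₀ (by positivity), sq, ← mul_assoc, inv_mul_cancel₀ (by positivity), one_mul]
          exact hcard
        linarith
    refine (norm_sum_le _ _).trans ((Finset.sum_le_sum g3).trans ?_)
    rw [Finset.sum_const, nsmul_eq_mul, card_range]
    have : (n : ℝ) * (n : ℝ)⁻¹ = 1 := mul_inv_cancel₀ (by positivity)
    linarith
  rw [node_apply, norm_smul, norm_inv, Real.norm_of_nonneg (mm_pos _).le, inv_mul_le_iff₀ (mm_pos _), htot]
  refine (norm_add_le _ _).trans ?_
  have := mm_ge (2 * j + 1)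
  linarith

include hm hc hg in
theorem special_est (hd : ∀ i, n1 (c i - dd (d i)) ≤ (nn (2 * j + 1) : ℝ)⁻¹) :
    LL (∑ i ∈ range (nn (2 * j + 1)), ((-1 : ℝ) ^ i) • c i) ≤
      72 * (nn (2 * j + 1) / mm (2 * j + 1) ^ 2) := by
  apply LL_le
  intro T hT
  have := main_est (j := 2 * j + 1) hm (a := fun i => ((-1 : ℝ) ^ i) • c i) (G := range (nn (2 * j + 1)))
    (fun k _ => (hc k).smul _) (C := 36) (θ := 0) (by norm_num) le_rfl
    (fun k _ n => by
      rw [Finsupp.smul_apply, norm_sgn]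
      exact (LL_isLN.low _ _).trans ((hg k).norm.trans (by norm_num)))
    (fun w hw T hT k _ => by
      rw [map_smul, norm_sgn]
      refine ((hg k).lo w (hw.trans (tt_gt j d k)) T hT).trans ?_
      have : 0 ≤ (mm w)⁻¹ := inv_nonneg.mpr (mm_pos w).le
      linarith)
    (fun w hw T hT F hF hFo => by
      rw [zero_mul, add_zero, mul_one]
      rcases hw.eq_or_lt with h | h
      · rcases hT with ⟨j', h', _⟩ | ⟨j', h', hO⟩
        · omega
        · have : j' = j := by omega
          subst this
          exact odd_est hm hc hg hd hO hF hFo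
      · exact high_est hg h hT hF) hT _ (Subset.refl _) (OC_range _)
  refine this.trans ?_
  unfold bd
  rw [card_range, nn_rpow_self]
  linarith
end
end
end GMHI

set_option linter.unusedVariables false
set_option linter.unusedSimpArgs false
namespace GMHI
open Finset
noncomputable section

lemma ip_disj {p q p' q' : ℕ} {a b : AA} (ha : Supp p q a) (hb : Supp p' q' b) (h : q ≤ p' ∨ q' ≤ p) : ip a b = 0 := by
  rw [← Pr_eq_self hb, ← ip_Pr_left, Pr_eq_zero ha, map_zero, LinearMap.zero_apply]
  tauto

lemma supp_order {s : ℕ → ℕ} (hm : StrictMono s) {i l : ℕ} (h : i ≠ l) :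
    s (i + 1) ≤ s l ∨ s (l + 1) ≤ s i := by
  rcases Nat.lt_or_gt_of_ne h with h | h
  · exact Or.inl (hm.monotone h)
  · exact Or.inr (hm.monotone h)

lemma ip_sum_disj {s : ℕ → ℕ} (hm : StrictMono s) {b : ℕ → AA} {M : ℕ} (hb : ∀ i, i < M → Supp (s i) (s (i + 1)) (b i)) :
    ip (∑ i ∈ range M, b i) (∑ i ∈ range M, b i) = ∑ i ∈ range M, ip (b i) (b i) := by
  rw [map_sum]
  apply Finset.sum_congr rfl
  intro i hi
  rw [map_sum, LinearMap.sum_apply, Finset.sum_eq_single i]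
  · intro l hl hli
    exact ip_disj (hb l (mem_range.mp hl)) (hb i (mem_range.mp hi)) (supp_order hm hli)
  · intro h; exact absurd hi h

lemma ip_Pr_sum_le {s : ℕ → ℕ} (hm : StrictMono s) (M : ℕ) (b : AA) :
    ∑ i ∈ range M, ip (Pr (s i) (s (i + 1)) b) (Pr (s i) (s (i + 1)) b) ≤ ip b b := by
  set c := ∑ i ∈ range M, Pr (s i) (s (i + 1)) b with hc
  have h1 : ip c c = ∑ i ∈ range M, ip (Pr (s i) (s (i + 1)) b) (Pr (s i) (s (i + 1)) b) :=
    ip_sum_disj hm fun i _ => supp_Pr _ _ _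
  have h2 : ip c b = ip c c := by
    rw [h1, hc, map_sum, LinearMap.sum_apply]
    apply Finset.sum_congr rfl
    intro i _
    conv_rhs => rw [← ip_Pr_left, Pr_idem]
  have h3 := ip_nonneg (b - c)
  have h4 : ip b c = ip c b := ip_symm b c
  simp only [map_sub, LinearMap.sub_apply] at h3
  rw [← h1]
  linarith

lemma norm_sum_B {s : ℕ → ℕ} (hm : StrictMono s) {M : ℕ} {B : ℕ → Op}
    (hBp : ∀ i, i < M → ∀ b, B i (Pr (s i) (s (i + 1)) b) = B i b) (hB : ∀ i, i < M → ∀ b, ‖B i b‖ ≤ √(ip b b)) (b : AA) :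
    ‖∑ i ∈ range M, B i b‖ ≤ √M * √(ip b b) := by
  set r : ℕ → ℝ := fun i => √(ip (Pr (s i) (s (i + 1)) b) (Pr (s i) (s (i + 1)) b)) with hr
  have h1 : ‖∑ i ∈ range M, B i b‖ ≤ ∑ i ∈ range M, r i := by
    refine (norm_sum_le _ _).trans (Finset.sum_le_sum fun i hi => ?_)
    rw [← hBp i (mem_range.mp hi)]
    exact hB i (mem_range.mp hi) _
  refine h1.trans ?_
  rw [← Real.sqrt_mul (by positivity)]
  apply Real.le_sqrt_of_sq_le
  have h2 := sq_sum_le_card_mul_sum_sq (s := range M) (f := r)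
  rw [card_range] at h2
  refine h2.trans ?_
  apply mul_le_mul_of_nonneg_left _ (by positivity)
  refine le_trans (le_of_eq ?_) (ip_Pr_sum_le hm M b)
  apply Finset.sum_congr rfl
  intro i _
  exact Real.sq_sqrt (ip_nonneg _)

lemma sqrt_16 (e : ℕ) : √((16 ^ e : ℕ) : ℝ) = 4 ^ e := by
  have : ((16 ^ e : ℕ) : ℝ) = (4 ^ e) ^ 2 := by
    push_cast
    rw [← pow_mul, mul_comm, pow_mul]; norm_num
  rw [this, Real.sqrt_sq (by positivity)]

lemma IsMor.g_disj {T B : Op} {g : (ℕ →₀ ℝ) →ₗ[ℝ] ℝ} (h : IsMor T B g) {p q p' q' : ℕ}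
    (hT : ∀ a, T (Pr p q a) = T a) (hB : ∀ a, B (Pr p q a) = B a) {x : ℕ →₀ ℝ} (hx : Supp p' q' x) (hd : q ≤ p' ∨ q' ≤ p) :
    g x = 0 := by
  have h1 := (cp_path x).Pr p' q'
  rw [Pr_eq_self hx] at h1
  have h2 := h.eq x _ _ h1 0
  rw [← h2, ← hT, ← hB, Pr_eq_zero (supp_Pr _ _ _) hd, map_zero, map_zero]
  simp

lemma IsMor.g_sum {s : ℕ → ℕ} (hm : StrictMono s) {M : ℕ} {T B : ℕ → Op} {g : ℕ → (ℕ →₀ ℝ) →ₗ[ℝ] ℝ}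
    (h : ∀ i, i < M → IsMor (T i) (B i) (g i))
    (hT : ∀ i, i < M → ∀ b, T i (Pr (s i) (s (i + 1)) b) = T i b)
    (hB : ∀ i, i < M → ∀ b, B i (Pr (s i) (s (i + 1)) b) = B i b)
    {x : ℕ → ℕ →₀ ℝ} (hx : ∀ i, i < M → Supp (s i) (s (i + 1)) (x i)) :
    (∑ i ∈ range M, g i) (∑ i ∈ range M, x i) = ∑ i ∈ range M, g i (x i) := by
  rw [LinearMap.sum_apply]
  apply Finset.sum_congr rfl
  intro i hi
  rw [map_sum, Finset.sum_eq_single i]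
  · intro l hl hli
    exact (h i (mem_range.mp hi)).g_disj (hT i (mem_range.mp hi)) (hB i (mem_range.mp hi)) (hx l (mem_range.mp hl))
      (supp_order hm hli.symm)
  · intro h; exact absurd hi h

lemma lower_bd {s : ℕ → ℕ} (hm : StrictMono s) {w e : ℕ} {T B : ℕ → Op} {g : ℕ → (ℕ →₀ ℝ) →ₗ[ℝ] ℝ}
    (h : ∀ i, i < 16 ^ e → IsMor (T i) (B i) (g i))
    (hT : ∀ a, ‖(mm w)⁻¹ • ∑ i ∈ range (16 ^ e), T i a‖ ≤ LL a)
    (hBp : ∀ i, i < 16 ^ e → ∀ b, B i (Pr (s i) (s (i + 1)) b) = B i b)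
    (hB : ∀ i, i < 16 ^ e → ∀ b, ‖B i b‖ ≤ √(ip b b)) (x : ℕ →₀ ℝ) :
    (∑ i ∈ range (16 ^ e), g i) x ≤ 2 ^ (mu w + e + 1) * NN LL x := by
  set k : ℤ := (e : ℤ) - mu w with hk
  have hM := ((IsMor.sum (s := range (16 ^ e)) fun i hi => h i (mem_range.mp hi)).dil k).smul ((2 : ℝ) ^ (-k) * (mm w)⁻¹)
  have h2 : (2 : ℝ) ^ (-k) * 2 ^ k = 1 := by rw [← zpow_add₀ two_ne_zero]; simp
  have hb := hM.g_le LL_isLN (fun a => by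
    have := hT a
    have e1 : (((2 : ℝ) ^ (-k) * (mm w)⁻¹) • (2 : ℝ) ^ k • sK k ∘ₗ ∑ i ∈ range (16 ^ e), T i) a =
        sK k ((mm w)⁻¹ • ∑ i ∈ range (16 ^ e), T i a) := by
      simp only [LinearMap.smul_apply, LinearMap.comp_apply, LinearMap.sum_apply, map_smul, smul_smul]
      congr 1
      linear_combination (mm w)⁻¹ * h2
    rw [e1, sK_norm]; exact this) (fun b => by
    have := norm_sum_B hm hBp hB b
    rw [sqrt_16] at this
    have e1 : (((2 : ℝ) ^ (-k) * (mm w)⁻¹) • (2 : ℝ) ^ (-k) • sK k ∘ₗ ∑ i ∈ range (16 ^ e), B i) b =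
        ((4 : ℝ) ^ e)⁻¹ • sK k (∑ i ∈ range (16 ^ e), B i b) := by
      simp only [LinearMap.smul_apply, LinearMap.comp_apply, LinearMap.sum_apply, map_smul, smul_smul]
      congr 1
      have : (2 : ℝ) ^ (-k) = 2 ^ (mu w) * (2 ^ e)⁻¹ := by
        rw [hk, neg_sub, zpow_sub₀ two_ne_zero]; simp [div_eq_mul_inv]
      rw [this, mm]
      have e4 : ∀ n : ℕ, (4 : ℝ) ^ n = 2 ^ n * 2 ^ n := fun n => by rw [← mul_pow]; norm_num
      rw [e4, e4]
      field_simp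
    rw [e1, norm_smul, sK_norm, norm_inv, Real.norm_of_nonneg (by positivity), inv_mul_le_iff₀ (by positivity)]
    exact this) x
  simp only [LinearMap.smul_apply, smul_eq_mul] at hb ⊢
  have e5 : (2 : ℝ) ^ (-k) * (mm w)⁻¹ = (2 ^ (mu w + e))⁻¹ := by
    rw [hk, neg_sub, zpow_sub₀ two_ne_zero, mm]
    have e4 : ∀ n : ℕ, (4 : ℝ) ^ n = 2 ^ n * 2 ^ n := fun n => by rw [← mul_pow]; norm_num
    rw [e4, pow_add]
    simp only [zpow_natCast]
    field_simp
  rw [e5, inv_mul_le_iff₀ (by positivity)] at hb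
  rw [pow_succ]
  linarith

lemma even_node_le {s : ℕ → ℕ} (hm : StrictMono s) {j M : ℕ} (hM : M ≤ nn (2 * j)) {T : ℕ → Op}
    (hT : ∀ i, i < M → ∀ a, ‖T i a‖ ≤ LL a) (hs : ∀ i, i < M → ∀ m a, T i (sA m a) = sK m (T i a))
    (hTp : ∀ i, i < M → ∀ b, T i (Pr (s i) (s (i + 1)) b) = T i b) (a : AA) :
    ‖(mm (2 * j))⁻¹ • ∑ i ∈ range M, T i a‖ ≤ LL a := by
  have h1 : Mem (node (2 * j) (fun i => if i < M then T i else 0) (fun i => s i) (fun i => s (i + 1))) := by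
    refine Mem.even j _ _ _ (fun l l' h _ => hm.monotone h) (fun l _ => ?_)
    split_ifs with h
    · exact mem_of_le (hs l h) (hT l h)
    · exact Mem.zero
  have h2 := h1.le_LL a
  rw [node_apply, ← Finset.sum_subset (range_subset_range.mpr hM)] at h2
  · convert h2 using 3
    apply Finset.sum_congr rfl
    intro i hi
    rw [if_pos (mem_range.mp hi), hTp i (mem_range.mp hi)]
  · intro i _ hi
    rw [if_neg (fun h => hi (mem_range.mpr h))]
    simp

end
end GMHI

set_option linter.unusedVariables false
set_option linter.unusedSimpArgs false
namespace GMHI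
open Finset
noncomputable section

/-- asymptotic subspaces: contain nonzero vectors supported arbitrarily far -/
def Asy (V : Submodule ℝ (ℕ →₀ ℝ)) : Prop := ∀ n, ∃ v ∈ V, v ≠ 0 ∧ ∀ k, k < n → v k = 0

structure Blk (V : Submodule ℝ (ℕ →₀ ℝ)) (n0 : ℕ) (s : ℕ → ℕ) (y : ℕ → ℕ →₀ ℝ) : Prop where
  mono : StrictMono s
  start : n0 ≤ s 0
  mem : ∀ i, y i ∈ V
  supp : ∀ i, Supp (s i) (s (i + 1)) (y i)
  lt : ∀ i, NN LL (y i) < 1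

lemma asy_one {V : Submodule ℝ (ℕ →₀ ℝ)} (hV : Asy V) {r : ℝ} (hr : 0 < r) (n : ℕ) :
    ∃ q v, n < q ∧ v ∈ V ∧ Supp n q v ∧ NN LL v = r := by
  obtain ⟨v, hv, h0, hk⟩ := hV n
  obtain ⟨q, hq⟩ := exists_supp v
  have hN : 0 < NN LL v := lt_of_le_of_ne (NN_nonneg _ _) fun h => h0 (NN_eq_zero LL_isLN h.symm)
  refine ⟨max q (n + 1), (r / NN LL v) • v, by omega, V.smul_mem _ hv, Supp.smul _ ?_, ?_⟩
  · intro i hi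
    have h1 := hq i hi
    refine ⟨?_, by omega⟩
    by_contra h
    exact hi (hk i (by omega))
  · rw [NN_smul LL_isLN, abs_of_pos (by positivity)]
    field_simp

lemma exists_blk {V : Submodule ℝ (ℕ →₀ ℝ)} (hV : Asy V) (n0 : ℕ) :
    ∃ s y, Blk V n0 s y ∧ ∀ i, NN LL (y i) = 9 / 10 := by
  choose Q v h1 h2 h3 h4 using fun n => asy_one hV (r := 9 / 10) (by norm_num) n
  refine ⟨fun i => Q^[i] n0, fun i => v (Q^[i] n0), ⟨?_, by simp, fun i => h2 _, ?_, ?_⟩, fun i => h4 _⟩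
  · apply strictMono_nat_of_lt_succ
    intro i
    rw [Function.iterate_succ_apply']
    exact h1 _
  · intro i
    simp only [Function.iterate_succ_apply']
    exact h3 _
  · intro i
    rw [h4]; norm_num

lemma sum_blocks {M : Type} [AddCommMonoid M] (m n : ℕ) (f : ℕ → M) :
    ∑ l ∈ range (m * n), f l = ∑ i ∈ range n, ∑ l ∈ range m, f (m * i + l) := by
  induction n with
  | zero => simp
  | succ n ih => rw [Nat.mul_succ, Finset.sum_range_add, ih, Finset.sum_range_succ]

lemma blk_group {V : Submodule ℝ (ℕ →₀ ℝ)} {n0 : ℕ} {s : ℕ → ℕ} {y : ℕ → ℕ →₀ ℝ} {r : ℕ} {C : ℝ} (hC : 0 < C)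
    (H : ∀ s y, Blk V n0 s y → NN LL (∑ i ∈ range (16 ^ r), y i) < C) (hb : Blk V n0 s y) :
    Blk V n0 (fun i => s (16 ^ r * i)) (fun i => C⁻¹ • ∑ l ∈ range (16 ^ r), y (16 ^ r * i + l)) := by
  have h16 : 0 < 16 ^ r := by positivity
  have hmono : StrictMono fun i => s (16 ^ r * i) := fun i j h => hb.mono (Nat.mul_lt_mul_of_pos_left h h16)
  refine ⟨hmono, by simpa using hb.start, ?_, ?_, ?_⟩
  · intro i
    exact V.smul_mem _ (V.sum_mem fun l _ => hb.mem _)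
  · intro i
    refine Supp.smul _ (Supp.sum fun l hl => (hb.supp _).mono (hb.mono.monotone (by omega)) (hb.mono.monotone ?_))
    have := mem_range.mp hl
    rw [Nat.mul_succ]; omega
  · intro i
    rw [NN_smul LL_isLN, abs_of_pos (by positivity), inv_mul_lt_iff₀ hC, mul_one]
    apply H (fun l => s (16 ^ r * i + l))
    refine ⟨fun a b h => hb.mono (by omega), hb.start.trans (hb.mono.monotone (by omega)), fun l => hb.mem _,
      fun l => ?_, fun l => hb.lt _⟩
    exact hb.supp _

lemma blk_iter {V : Submodule ℝ (ℕ →₀ ℝ)} {n0 : ℕ} {r : ℕ} {C : ℝ} (hC : 0 < C)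
    (H : ∀ s y, Blk V n0 s y → NN LL (∑ i ∈ range (16 ^ r), y i) < C) (k : ℕ) :
    ∀ s y, Blk V n0 s y → NN LL (∑ i ∈ range (16 ^ (r * k)), y i) < C ^ k := by
  induction k with
  | zero => intro s y h; simpa using h.lt 0
  | succ k ih =>
    intro s y h
    have h1 := ih _ _ (blk_group hC H h)
    rw [← Finset.smul_sum, ← sum_blocks, NN_smul LL_isLN, abs_of_pos (by positivity), inv_mul_lt_iff₀ hC] at h1
    have e1 : 16 ^ (r * (k + 1)) = 16 ^ r * 16 ^ (r * k) := by rw [Nat.mul_succ, pow_add, mul_comm]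
    rw [e1, pow_succ, mul_comm _ C]
    exact h1

lemma blk_lower {s : ℕ → ℕ} (hm : StrictMono s) {y : ℕ → ℕ →₀ ℝ} (hs : ∀ i, Supp (s i) (s (i + 1)) (y i))
    (hy : ∀ i, NN LL (y i) = 9 / 10) {j e : ℕ} (he : e ≤ mu (2 * j) ^ 2) :
    (1 / 3) * 16 ^ e ≤ 2 ^ (mu (2 * j) + e + 1) * NN LL (∑ i ∈ range (16 ^ e), y i) := by
  have := fun i => morph LL_isLN (hs i) (ε := 1 / 10) (by norm_num) (by norm_num) (by rw [hy]; norm_num)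
    (by rw [hy]; norm_num)
  choose T B g t h1 h2 h3 h4 h5 h6 h7 h8 using this
  have hT2 : ∀ i, ∀ a, ((1 / 2 : ℝ) • T i) (Pr (s i) (s (i + 1)) a) = ((1 / 2 : ℝ) • T i) a := by
    intro i a; simp [h2]
  have hB2 : ∀ i, ∀ a, ((1 / 2 : ℝ) • B i) (Pr (s i) (s (i + 1)) a) = ((1 / 2 : ℝ) • B i) a := by
    intro i a; simp [h3]
  have hM : ∀ i, IsMor ((1 / 2 : ℝ) • T i) ((1 / 2 : ℝ) • B i) ((1 / 2 : ℝ) • g i) := fun i => (h1 i).smul _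
  have hTn : ∀ i a, ‖((1 / 2 : ℝ) • T i) a‖ ≤ LL a := by
    intro i a
    rw [LinearMap.smul_apply, norm_smul]
    have := h4 i a
    norm_num; linarith
  have hBn : ∀ i b, ‖((1 / 2 : ℝ) • B i) b‖ ≤ √(ip b b) := by
    intro i a
    rw [LinearMap.smul_apply, norm_smul]
    have := h5 i a
    norm_num; linarith
  have key := lower_bd hm (w := 2 * j) (e := e) (fun i _ => hM i)
    (even_node_le hm (Nat.pow_le_pow_right (by norm_num) he) (fun i _ => hTn i) (fun i _ => (hM i).ts) (fun i _ => hT2 i))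
    (fun i _ => hB2 i) (fun i _ => hBn i) (∑ i ∈ range (16 ^ e), y i)
  rw [IsMor.g_sum hm (fun i _ => hM i) (fun i _ => hT2 i) (fun i _ => hB2 i) (fun i _ => hs i)] at key
  refine le_trans ?_ key
  have : ∀ i ∈ range (16 ^ e), (1 / 3 : ℝ) ≤ ((1 / 2 : ℝ) • g i) (y i) := by
    intro i _
    have := h7 i
    rw [LinearMap.smul_apply, smul_eq_mul]
    linarith
  have h9 := Finset.sum_le_sum this
  rw [Finset.sum_const, card_range, nsmul_eq_mul] at h9
  push_cast at h9
  linarith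

theorem blk_good {V : Submodule ℝ (ℕ →₀ ℝ)} (hV : Asy V) (n0 r : ℕ) {ρ : ℝ} (hρ : 0 < ρ) (hρ1 : ρ < 1) :
    ∃ s y, Blk V n0 s y ∧ ρ * 8 ^ r ≤ NN LL (∑ i ∈ range (16 ^ r), y i) := by
  by_contra hcon
  push Not at hcon
  obtain ⟨h, hh⟩ := exists_pow_lt_of_lt_one (show (0 : ℝ) < 1 / 16 by norm_num) hρ1
  obtain ⟨s, y, hb, hy⟩ := exists_blk hV n0
  set j := r * h with hj
  set μ := mu (2 * j) with hμ
  have hμj : r * h ≤ μ := by have := lt_mu (2 * j); omega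
  have hμ1 : 1 ≤ μ := mu_pos _
  have h1 := blk_iter (C := ρ * 8 ^ r) (by positivity) hcon (h * μ) s y hb
  have he : r * (h * μ) ≤ mu (2 * j) ^ 2 := by
    rw [← mul_assoc, ← hμ, sq]; exact Nat.mul_le_mul_right _ hμj
  have h2 := blk_lower hb.mono hb.supp hy he
  set e := r * (h * μ) with hee
  have h3 : (ρ * 8 ^ r) ^ (h * μ) = (ρ ^ h) ^ μ * 8 ^ e := by
    rw [mul_pow, ← pow_mul, ← pow_mul]
  have h4 : (ρ ^ h) ^ μ ≤ (1 / 16) ^ μ := pow_le_pow_left₀ (by positivity) hh.le _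
  rw [h3] at h1
  have h5 : (0 : ℝ) < 8 ^ e := by positivity
  have h6 : NN LL (∑ i ∈ range (16 ^ e), y i) < (1 / 16) ^ μ * 8 ^ e := by nlinarith
  have h7 : (16 : ℝ) ^ e = 2 ^ e * 8 ^ e := by rw [← mul_pow]; norm_num
  rw [← hμ, pow_add, pow_add, pow_one, h7] at h2
  have h8 : (0 : ℝ) < 2 ^ e := by positivity
  have h9 : (0 : ℝ) < 2 ^ μ := by positivity
  have h10 : (1 / 3 : ℝ) * (2 ^ e * 8 ^ e) < (2 ^ μ * 2 ^ e * 2) * ((1 / 16) ^ μ * 8 ^ e) := by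
    refine h2.trans_lt ?_
    exact mul_lt_mul_of_pos_left h6 (by positivity)
  have h11 : (2 : ℝ) ^ μ * (1 / 16) ^ μ ≤ 1 / 8 := by
    rw [← mul_pow]
    calc ((2 : ℝ) * (1 / 16)) ^ μ ≤ (2 * (1 / 16)) ^ 1 := pow_le_pow_of_le_one (by norm_num) (by norm_num) hμ1
      _ = 1 / 8 := by norm_num
  have h12 : (0 : ℝ) < 2 ^ e * 8 ^ e := by positivity
  have h13 : (2 ^ μ * 2 ^ e * 2) * ((1 / 16 : ℝ) ^ μ * 8 ^ e) = (2 ^ μ * (1 / 16 : ℝ) ^ μ) * 2 * (2 ^ e * 8 ^ e) := by ring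
  rw [h13] at h10
  nlinarith

/-- level one data -/
def Dat (V : Submodule ℝ (ℕ →₀ ℝ)) (n0 R : ℕ) (γ ε : ℝ) (π : KK) : Prop :=
  ∃ (q : ℕ) (x : ℕ →₀ ℝ) (a b : AA) (T B : Op) (g : (ℕ →₀ ℝ) →ₗ[ℝ] ℝ), n0 < q ∧ x ∈ V ∧ Supp n0 q x ∧ Supp n0 q a ∧ Supp n0 q b ∧
    IsPath x a b ∧ LL a ≤ 1 ∧ ip b b ≤ 1 ∧ (∀ w, w < R → ∀ S, IsNode w S → ‖S a‖ ≤ 2 * (mm w)⁻¹) ∧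
    IsMor T B g ∧ (∀ a, T (Pr n0 q a) = T a) ∧ (∀ a, B (Pr n0 q a) = B a) ∧ (∀ a, ‖T a‖ ≤ LL a) ∧
    (∀ b, ‖B b‖ ≤ √(ip b b)) ∧ γ ≤ g x ∧ ‖T a - π‖ ≤ ε

lemma exists_r (R : ℕ) : ∃ r : ℕ, ∀ w, w < R → (2 * nn w * mm w : ℝ) ≤ ((16 ^ r : ℕ) : ℝ) := by
  have h : ∃ r : ℕ, (2 * nn R * mm R : ℝ) ≤ (16 : ℝ) ^ r := by
    obtain ⟨r, hr⟩ := pow_unbounded_of_one_lt (2 * nn R * mm R : ℝ) (show (1 : ℝ) < 16 by norm_num)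
    exact ⟨r, hr.le⟩
  obtain ⟨r, hr⟩ := h
  refine ⟨r, fun w hw => ?_⟩
  push_cast
  refine le_trans ?_ hr
  have h1 : (nn w : ℝ) ≤ nn R := by exact_mod_cast nn_mono hw.le
  have h2 := mm_mono hw.le
  have h3 := mm_pos w
  apply mul_le_mul _ h2 h3.le (mul_nonneg (by norm_num) (Nat.cast_nonneg _))
  linarith

set_option maxHeartbeats 1000000 in
lemma raw_dat {V : Submodule ℝ (ℕ →₀ ℝ)} (hV : Asy V) (n0 R : ℕ) {ε : ℝ} (hε : 0 < ε) :
    ∃ t : ℝ, |t| ≤ 1 ∧ Dat V n0 R (1 / 4) ε ((1 / 2 : ℝ) • (uK + t • dK)) := by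
  obtain ⟨r, hr⟩ := exists_r R
  obtain ⟨η, hη, hη1, hηε⟩ : ∃ η : ℝ, 0 < η ∧ η ≤ 1 / 10 ∧ 11 * √η ≤ ε := by
    refine ⟨min (1 / 10) ((ε / 11) ^ 2), by positivity, min_le_left _ _, ?_⟩
    have : √(min (1 / 10) ((ε / 11) ^ 2)) ≤ ε / 11 := by
      rw [Real.sqrt_le_left (by positivity)]; exact min_le_right _ _
    linarith
  obtain ⟨s, y, hb, hy⟩ := blk_good hV n0 r (ρ := 1 - η) (by linarith) (by linarith)
  have hp := fun i => exists_path_supp LL_isLN (hb.lt i) (hb.supp i)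
  choose α β p1 p2 p3 p4 using hp
  have hα1 : ∀ i, LL (α i) ≤ 1 ∧ ip (β i) (β i) ≤ 1 ∧ LL (α i) ^ 2 + ip (β i) (β i) ≤ 1 := by
    intro i
    have e1 := p2 i
    unfold cost at e1
    have e2 := ip_nonneg (β i)
    have e3 := LL_isLN.nonneg (α i)
    refine ⟨?_, by nlinarith, by nlinarith⟩
    nlinarith
  set M := 16 ^ r with hM
  set x := ((8 : ℝ) ^ r)⁻¹ • ∑ i ∈ range M, y i with hx
  have hpath := ((IsPath.sum (s := range M) fun i _ => p1 i).dil (-(r : ℤ))).smul ((8 : ℝ) ^ r)⁻¹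
  have e4 : (4 : ℝ) ^ r = 2 ^ r * 2 ^ r := by rw [← mul_pow]; norm_num
  have e8 : (8 : ℝ) ^ r = 2 ^ r * 2 ^ r * 2 ^ r := by rw [← mul_pow, ← mul_pow]; norm_num
  have e16 : ((M : ℕ) : ℝ) = 2 ^ r * 2 ^ r * 2 ^ r * 2 ^ r := by
    rw [← mul_pow, ← mul_pow, ← mul_pow, hM]; push_cast; norm_num
  set a := sA (-(r : ℤ)) ((M : ℝ)⁻¹ • ∑ i ∈ range M, α i) with ha
  set b := sA (-(r : ℤ)) (((4 : ℝ) ^ r)⁻¹ • ∑ i ∈ range M, β i) with hbd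
  have hpab : IsPath x a b := by
    convert hpath using 1
    · rw [ha, map_smul, smul_smul]
      congr 1
      rw [e16, e8]; simp only [zpow_neg, zpow_natCast]; field_simp
    · rw [hbd, map_smul, smul_smul]
      congr 1
      rw [e4, e8]; simp only [neg_neg, zpow_natCast]; field_simp
  have hM0 : (0 : ℝ) < M := by rw [e16]; positivity
  set q := s M with hq
  have hsub : ∀ i ∈ range M, n0 ≤ s i ∧ s (i + 1) ≤ q := fun i hi =>
    ⟨hb.start.trans (hb.mono.monotone (Nat.zero_le _)), hb.mono.monotone (mem_range.mp hi)⟩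
  have sx : Supp n0 q x := Supp.smul _ (Supp.sum fun i hi => (hb.supp i).mono (hsub i hi).1 (hsub i hi).2)
  have sa : Supp n0 q a := (Supp.smul _ (Supp.sum fun i hi => (p3 i).mono (hsub i hi).1 (hsub i hi).2)).sA _
  have sb : Supp n0 q b := (Supp.smul _ (Supp.sum fun i hi => (p4 i).mono (hsub i hi).1 (hsub i hi).2)).sA _
  have hip : ip b b = (M : ℝ)⁻¹ * ∑ i ∈ range M, ip (β i) (β i) := by
    rw [hbd, ip_sA, map_smul, map_smul, LinearMap.smul_apply, smul_eq_mul, smul_eq_mul, ip_sum_disj hb.mono (fun i _ => p4 i), ← mul_assoc]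
    congr 1
    rw [e4, e16]; field_simp
  have hLa : LL a ≤ (M : ℝ)⁻¹ * ∑ i ∈ range M, LL (α i) := by
    rw [ha, LL_isLN.shift, LL_isLN.smul, abs_of_pos (by positivity)]
    exact mul_le_mul_of_nonneg_left (LL_isLN.sum _ _) (by positivity)
  have havg : ∀ f : ℕ → ℝ, (∀ i, f i ≤ 1) → (M : ℝ)⁻¹ * ∑ i ∈ range M, f i ≤ 1 := by
    intro f hf
    rw [inv_mul_le_iff₀ hM0]
    have := Finset.sum_le_sum fun i (_ : i ∈ range M) => hf i
    simpa using this
  have hcost : cost LL a b ≤ 1 := by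
    unfold cost
    have e1 : LL a ^ 2 ≤ (M : ℝ)⁻¹ * ∑ i ∈ range M, LL (α i) ^ 2 := by
      have e2 := sq_sum_le_card_mul_sum_sq (s := range M) (f := fun i => LL (α i))
      rw [card_range] at e2
      have e3 : LL a ^ 2 ≤ ((M : ℝ)⁻¹ * ∑ i ∈ range M, LL (α i)) ^ 2 := pow_le_pow_left₀ (LL_isLN.nonneg _) hLa 2
      refine e3.trans ?_
      rw [mul_pow, sq (M : ℝ)⁻¹, mul_assoc]
      apply mul_le_mul_of_nonneg_left _ (by positivity)
      rw [inv_mul_le_iff₀ hM0]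
      exact e2
    have e5 := havg (fun i => LL (α i) ^ 2 + ip (β i) (β i)) (fun i => (hα1 i).2.2)
    rw [Finset.sum_add_distrib, mul_add] at e5
    rw [hip]; linarith
  have hN1 : NN LL x ≤ 1 := NN_le_of LL hpab (by norm_num) (by simpa using hcost)
  have hN2 : 1 - η ≤ NN LL x := by
    rw [hx, NN_smul LL_isLN, abs_of_pos (by positivity), le_inv_mul_iff₀ (by positivity), mul_comm]
    exact hy
  obtain ⟨T, B, g, t, m1, m2, m3, m4, m5, m6, m7, m8⟩ := morph LL_isLN sx hη (by linarith) hN2 hN1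
  refine ⟨t, m6, q, x, a, b, (1 / 2 : ℝ) • T, (1 / 2 : ℝ) • B, (1 / 2 : ℝ) • g, ?_, ?_, sx, sa, sb, hpab, ?_, ?_, ?_, m1.smul _, ?_, ?_, ?_, ?_, ?_, ?_⟩
  · exact lt_of_le_of_lt hb.start (hb.mono (by positivity))
  · exact V.smul_mem _ (V.sum_mem fun i _ => hb.mem i)
  · exact hLa.trans (havg _ fun i => (hα1 i).1)
  · rw [hip]; exact havg _ fun i => (hα1 i).2.1
  · intro w hw S hS
    rw [ha, hS.mem.shift, sK_norm]
    exact avg_est hS hb.mono (fun k _ => p3 k) (fun k _ => (hα1 k).1) (hr w hw)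
  · intro a; simp [m2]
  · intro a; simp [m3]
  · intro a
    rw [LinearMap.smul_apply, norm_smul]
    have := m4 a
    norm_num; linarith
  · intro a
    rw [LinearMap.smul_apply, norm_smul]
    have := m5 a
    norm_num; linarith
  · rw [LinearMap.smul_apply, smul_eq_mul]; linarith
  · rw [LinearMap.smul_apply, ← smul_sub, norm_smul]
    have := m8 a b hpab hcost
    norm_num
    have := norm_nonneg (T a - (uK + t • dK))
    linarith

lemma Dat.mono {V : Submodule ℝ (ℕ →₀ ℝ)} {n0 n0' R R' : ℕ} {γ ε ε' : ℝ} {π π' : KK} (h : Dat V n0 R γ ε π)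
    (h1 : n0' ≤ n0) (h2 : R' ≤ R) (h3 : ε + ‖π - π'‖ ≤ ε') : Dat V n0' R' γ ε' π' := by
  obtain ⟨q, x, a, b, T, B, g, k1, k2, k3, k4, k5, k6, k7, k8, k9, k10, k11, k12, k13, k14, k15, k16⟩ := h
  have hP : ∀ c : AA, Pr n0 q (Pr n0' q c) = Pr n0 q c := by
    intro c; rw [Pr_Pr, max_eq_left h1, min_self]
  refine ⟨q, x, a, b, T, B, g, by omega, k2, k3.mono h1 le_rfl, k4.mono h1 le_rfl, k5.mono h1 le_rfl, k6, k7, k8,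
    fun w hw => k9 w (by omega), k10, ?_, ?_, k13, k14, k15, ?_⟩
  · intro c; rw [← k11, hP, k11]
  · intro c; rw [← k12, hP, k12]
  · have : T a - π' = (T a - π) + (π - π') := by abel
    rw [this]
    exact (norm_add_le _ _).trans (by linarith)

lemma dK_norm : ‖dK‖ ≤ 1 := by
  have : ‖dK‖ ^ 2 ≤ 1 := by
    apply normK_sq_le
    intro s
    simp only [dK_apply]
    have : ∀ k ∈ s, ((if k = 0 then (1 : ℝ) else 0)) ^ 2 = if k = 0 then 1 else 0 := by
      intro k _; split_ifs <;> norm_num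
    rw [Finset.sum_congr rfl this, Finset.sum_ite_eq']
    split_ifs <;> norm_num
  nlinarith [norm_nonneg dK]

theorem limit_dat {V : Submodule ℝ (ℕ →₀ ℝ)} (hV : Asy V) :
    ∃ t : ℝ, |t| ≤ 1 ∧ ∀ n0 R (ε : ℝ), 0 < ε → Dat V n0 R (1 / 4) ε ((1 / 2 : ℝ) • (uK + t • dK)) := by
  have := fun n : ℕ => raw_dat hV n n (ε := 1 / ((n : ℝ) + 1)) (by positivity)
  choose t h1 h2 using this
  have hc : IsCompact (Set.Icc (-1 : ℝ) 1) := isCompact_Icc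
  obtain ⟨t0, ht0, φ, hφ, hlim⟩ := hc.tendsto_subseq (x := t) fun n => abs_le.mp (h1 n)
  refine ⟨t0, abs_le.mpr ht0, fun n0 R ε hε => ?_⟩
  rw [Metric.tendsto_atTop] at hlim
  obtain ⟨N1, hN1⟩ := hlim (ε / 2) (by positivity)
  obtain ⟨N2, hN2⟩ := exists_nat_one_div_lt (show 0 < ε / 2 by positivity)
  set N := max (max N1 N2) (max n0 R) with hN
  have hNφ : N ≤ φ N := hφ.id_le N
  refine (h2 (φ N)).mono (by omega) (by omega) ?_
  have e1 := hN1 N (by omega)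
  rw [Function.comp_apply, Real.dist_eq] at e1
  have e2 : 1 / ((φ N : ℝ) + 1) ≤ 1 / ((N2 : ℝ) + 1) := by
    apply one_div_le_one_div_of_le (by positivity)
    have : (N2 : ℝ) ≤ φ N := by exact_mod_cast (show N2 ≤ φ N by omega)
    linarith
  have e3 : ((1 / 2 : ℝ) • (uK + t (φ N) • dK)) - ((1 / 2 : ℝ) • (uK + t0 • dK)) = ((1 / 2 : ℝ) * (t (φ N) - t0)) • dK := by
    module
  rw [e3, norm_smul, norm_mul, Real.norm_eq_abs, Real.norm_eq_abs]
  have e4 := dK_norm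
  have e5 := abs_nonneg (t (φ N) - t0)
  have e6 : |(1 / 2 : ℝ)| = 1 / 2 := by norm_num
  rw [e6]
  nlinarith [norm_nonneg dK]
end
end GMHI

set_option linter.unusedVariables false
set_option linter.unusedSimpArgs false
namespace GMHI
open Finset
noncomputable section

def vf (j : ℤ) : ℝ := uf j - 2 * uf (j - 1)

lemma vf_eq (j : ℤ) : vf j = -(3 * ((2 : ℝ) ^ j) ^ 3 / ((((2 : ℝ) ^ j) ^ 2 + 1) * (((2 : ℝ) ^ j) ^ 2 + 4))) := by
  have hz : (0 : ℝ) < (2 : ℝ) ^ j := by positivity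
  unfold vf uf
  rw [zpow_neg, zpow_neg, zpow_sub₀ two_ne_zero, zpow_one]
  set z := (2 : ℝ) ^ j
  have h1 : z + z⁻¹ = (z ^ 2 + 1) / z := by field_simp
  have h2 : z / 2 + (z / 2)⁻¹ = (z ^ 2 + 4) / (2 * z) := by field_simp; ring
  rw [h1, h2, inv_div, inv_div]
  have : z ^ 2 + 1 ≠ 0 := by positivity
  have : z ^ 2 + 4 ≠ 0 := by positivity
  field_simp
  ring

lemma half_natAbs (j : ℤ) : (2 : ℝ)⁻¹ ^ j.natAbs = (2 : ℝ) ^ j ∨ (2 : ℝ)⁻¹ ^ j.natAbs = ((2 : ℝ) ^ j)⁻¹ := by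
  rcases le_total 0 j with h | h
  · right
    lift j to ℕ using h
    simp
  · left
    obtain ⟨k, rfl⟩ : ∃ k : ℕ, j = -(k : ℤ) := ⟨j.natAbs, by omega⟩
    simp

lemma vf_bd (j : ℤ) : |vf j| ≤ 3 * (2 : ℝ)⁻¹ ^ j.natAbs := by
  have hz : (0 : ℝ) < (2 : ℝ) ^ j := by positivity
  rw [vf_eq, abs_neg, abs_of_nonneg (by positivity)]
  rcases half_natAbs j with h | h <;> rw [h] <;> set z := (2 : ℝ) ^ j
  · rw [div_le_iff₀ (by positivity)]
    have : 3 * z * ((z ^ 2 + 1) * (z ^ 2 + 4)) - 3 * z ^ 3 = 3 * z * (z ^ 4 + 4 * z ^ 2 + 4) := by ring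
    have : 0 ≤ 3 * z * (z ^ 4 + 4 * z ^ 2 + 4) := by positivity
    linarith
  · rw [div_le_iff₀ (by positivity)]
    have : 3 * z⁻¹ * ((z ^ 2 + 1) * (z ^ 2 + 4)) - 3 * z ^ 3 = 3 * z⁻¹ * (5 * z ^ 2 + 4) := by field_simp; ring
    have : 0 ≤ 3 * z⁻¹ * (5 * z ^ 2 + 4) := by positivity
    linarith

lemma vf_bd4 (j : ℤ) : |vf j * (2 : ℝ) ^ (-j) * (2 : ℝ) ^ (-j)| ≤ 3 * (2 : ℝ)⁻¹ ^ j.natAbs := by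
  have hz : (0 : ℝ) < (2 : ℝ) ^ j := by positivity
  rw [zpow_neg, mul_assoc, abs_mul, vf_eq, abs_neg, abs_of_nonneg (by positivity), abs_of_nonneg (by positivity)]
  rcases half_natAbs j with h | h <;> rw [h] <;> set z := (2 : ℝ) ^ j
  · rw [div_mul_eq_mul_div, div_le_iff₀ (by positivity)]
    have : 3 * z * ((z ^ 2 + 1) * (z ^ 2 + 4)) - 3 * z ^ 3 * (z⁻¹ * z⁻¹) = 3 * z * (z ^ 4 + 5 * z ^ 2 + 3) := by field_simp; ring
    have : 0 ≤ 3 * z * (z ^ 4 + 5 * z ^ 2 + 3) := by positivity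
    linarith
  · rw [div_mul_eq_mul_div, div_le_iff₀ (by positivity)]
    have : 3 * z⁻¹ * ((z ^ 2 + 1) * (z ^ 2 + 4)) - 3 * z ^ 3 * (z⁻¹ * z⁻¹) = 3 * z⁻¹ * (z ^ 4 + 4 * z ^ 2 + 4) := by field_simp; ring
    have : 0 ≤ 3 * z⁻¹ * (z ^ 4 + 4 * z ^ 2 + 4) := by positivity
    linarith

lemma vf_sum {J : ℕ} (hJ : 1 ≤ J) : ∑ j ∈ Icc (-(J : ℤ)) J, vf j * (2 : ℝ) ^ (-j) ≤ -(1 / 2) := by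
  have h1 : ∑ j ∈ ({0, 1} : Finset ℤ), -(vf j * (2 : ℝ) ^ (-j)) ≤ ∑ j ∈ Icc (-(J : ℤ)) J, -(vf j * (2 : ℝ) ^ (-j)) := by
    apply Finset.sum_le_sum_of_subset_of_nonneg
    · intro j hj
      simp only [mem_insert, mem_singleton] at hj
      rw [mem_Icc]
      omega
    · intro j _ _
      rw [vf_eq, neg_mul, neg_neg]; positivity
  have h2 : ∑ j ∈ ({0, 1} : Finset ℤ), -(vf j * (2 : ℝ) ^ (-j)) = 3 / 5 := by
    rw [Finset.sum_pair (by norm_num), vf_eq, vf_eq]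
    norm_num
  rw [h2, Finset.sum_neg_distrib] at h1
  linarith

/-- the alignment kernel -/
def Ker (J : ℕ) (t : ℝ) : KK →ₗ[ℝ] KK :=
  (-(1 / 12) : ℝ) • (∑ j ∈ Icc (-(J : ℤ)) J, vf j • sK j + t • (LinearMap.id - (2 : ℝ) • sK 1))

lemma kern_norm {J : ℕ} {t r : ℝ} (ht : |t| ≤ 1) (hr : |r| ≤ 2) {v : ℤ → ℝ} (hv : ∀ j, |v j| ≤ 3 * (2 : ℝ)⁻¹ ^ j.natAbs) (y : KK) :
    ‖(-(1 / 12) : ℝ) • (∑ j ∈ Icc (-(J : ℤ)) J, v j • sK j y + t • (y - r • sK 1 y))‖ ≤ ‖y‖ := by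
  have h1 : ‖∑ j ∈ Icc (-(J : ℤ)) J, v j • sK j y‖ ≤ 9 * ‖y‖ := by
    refine (norm_sum_le _ _).trans ?_
    refine (Finset.sum_le_sum (g := fun j : ℤ => (2 : ℝ)⁻¹ ^ j.natAbs * (3 * ‖y‖)) fun j _ => ?_).trans ?_
    · rw [norm_smul, sK_norm, Real.norm_eq_abs]
      have := mul_le_mul_of_nonneg_right (hv j) (norm_nonneg y)
      linarith
    · rw [← Finset.sum_mul]
      have := mul_le_mul_of_nonneg_right (sum_half_natAbs (Icc (-(J : ℤ)) J)) (show 0 ≤ 3 * ‖y‖ by positivity)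
      linarith
  have h2 : ‖t • (y - r • sK 1 y)‖ ≤ 3 * ‖y‖ := by
    rw [norm_smul, Real.norm_eq_abs]
    have e1 : ‖y - r • sK 1 y‖ ≤ 3 * ‖y‖ := by
      refine (norm_sub_le _ _).trans ?_
      rw [norm_smul, sK_norm, Real.norm_eq_abs]
      have := mul_le_mul_of_nonneg_right hr (norm_nonneg y)
      linarith
    have := mul_le_mul_of_nonneg_right ht (norm_nonneg (y - r • sK 1 y))
    linarith
  rw [norm_smul]
  have h3 := norm_add_le (∑ j ∈ Icc (-(J : ℤ)) J, v j • sK j y) (t • (y - r • sK 1 y))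
  have h4 : ‖(-(1 / 12) : ℝ)‖ = 1 / 12 := by norm_num
  rw [h4]
  linarith

lemma Ker_apply (J : ℕ) (t : ℝ) (y : KK) : Ker J t y =
    (-(1 / 12) : ℝ) • (∑ j ∈ Icc (-(J : ℤ)) J, vf j • sK j y + t • (y - (2 : ℝ) • sK 1 y)) := by
  simp [Ker, LinearMap.sum_apply]

lemma Ker_norm {J : ℕ} {t : ℝ} (ht : |t| ≤ 1) (y : KK) : ‖Ker J t y‖ ≤ ‖y‖ := by
  rw [Ker_apply]
  exact kern_norm ht (by norm_num) vf_bd y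

lemma Dat.ker {V : Submodule ℝ (ℕ →₀ ℝ)} {n0 R : ℕ} {ε : ℝ} {π : KK} (h : Dat V n0 R (1 / 4) ε π)
    {J : ℕ} (hJ : 1 ≤ J) {t : ℝ} (ht : |t| ≤ 1) : Dat V n0 R (1 / 100) ε (Ker J t π) := by
  obtain ⟨q, x, a, b, T, B, g, k1, k2, k3, k4, k5, k6, k7, k8, k9, k10, k11, k12, k13, k14, k15, k16⟩ := h
  have hM := ((IsMor.sum (s := Icc (-(J : ℤ)) J) fun j _ => (k10.dil j).smul (vf j * (2 : ℝ) ^ (-j))).add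
    ((k10.add ((k10.dil 1).smul (-1))).smul t)).smul (-(1 / 12))
  set T' := (-(1 / 12) : ℝ) • (∑ j ∈ Icc (-(J : ℤ)) J, (vf j * (2 : ℝ) ^ (-j)) • (2 : ℝ) ^ j • (sK j).comp T +
    t • (T + (-1 : ℝ) • (2 : ℝ) ^ (1 : ℤ) • (sK 1).comp T)) with hT'
  set B' := (-(1 / 12) : ℝ) • (∑ j ∈ Icc (-(J : ℤ)) J, (vf j * (2 : ℝ) ^ (-j)) • (2 : ℝ) ^ (-j) • (sK j).comp B +
    t • (B + (-1 : ℝ) • (2 : ℝ) ^ (-1 : ℤ) • (sK 1).comp B)) with hB'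
  have hTa : ∀ a, T' a = Ker J t (T a) := by
    intro a
    rw [Ker_apply]
    simp only [hT', LinearMap.smul_apply, LinearMap.add_apply, LinearMap.sum_apply, LinearMap.comp_apply]
    congr 2
    · apply Finset.sum_congr rfl
      intro j _
      rw [smul_smul, mul_assoc, ← zpow_add₀ two_ne_zero]
      simp
    · congr 1
      rw [zpow_one]; module
  have hBa : ∀ b, B' b = (-(1 / 12) : ℝ) • (∑ j ∈ Icc (-(J : ℤ)) J, (vf j * (2 : ℝ) ^ (-j) * (2 : ℝ) ^ (-j)) • sK j (B b) +
      t • (B b - (1 / 2 : ℝ) • sK 1 (B b))) := by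
    intro b
    simp only [hB', LinearMap.smul_apply, LinearMap.add_apply, LinearMap.sum_apply, LinearMap.comp_apply]
    congr 2
    · apply Finset.sum_congr rfl
      intro j _
      rw [smul_smul]
    · congr 1
      have : (2 : ℝ) ^ (-1 : ℤ) = 1 / 2 := by norm_num
      rw [this]; module
  refine ⟨q, x, a, b, T', B', _, k1, k2, k3, k4, k5, k6, k7, k8, k9, hM, ?_, ?_, ?_, ?_, ?_, ?_⟩
  · intro c; rw [hTa, hTa, k11]
  · intro c; rw [hBa, hBa, k12]
  · intro c; rw [hTa]; exact (Ker_norm ht _).trans (k13 c)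
  · intro c
    rw [hBa]
    exact (kern_norm ht (by rw [abs_of_pos] <;> norm_num) vf_bd4 (B c)).trans (k14 c)
  · simp only [LinearMap.smul_apply, LinearMap.add_apply, LinearMap.sum_apply, smul_eq_mul]
    rw [← Finset.sum_mul]
    have := vf_sum hJ
    nlinarith
  · rw [hTa, ← map_sub]
    exact (Ker_norm ht _).trans k16

lemma ker_tail {η : ℝ} (hη : 0 < η) : ∃ J : ℕ, 1 ≤ J ∧
    ‖(∑ j ∈ Icc (-(J : ℤ)) J, vf j • sK j dK) - (uK - (2 : ℝ) • sK 1 uK)‖ ≤ η := by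
  set y := uK - (2 : ℝ) • sK 1 uK with hy
  have hyk : ∀ k, y k = vf (-k) := by
    intro k
    simp only [hy, lp.coeFn_sub, Pi.sub_apply, lp.coeFn_smul, Pi.smul_apply, smul_eq_mul, sK_apply, uK_apply, vf]
    rw [uf_neg, ← uf_neg (k + 1)]
    congr 3
    ring
  obtain ⟨s, hs⟩ := summable_iff_vanishing_norm.mp (summK_sq y) (η ^ 2) (by positivity)
  set J := max 1 (s.sup Int.natAbs) with hJ
  refine ⟨J, le_max_left _ _, ?_⟩
  have hsJ : ∀ k ∈ s, k.natAbs ≤ J := fun k hk => (Finset.le_sup (f := Int.natAbs) hk).trans (le_max_right _ _)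
  have hz : ∀ k, ((∑ j ∈ Icc (-(J : ℤ)) J, vf j • sK j dK) - y) k = if -k ∈ Icc (-(J : ℤ)) J then 0 else - y k := by
    intro k
    simp only [lp.coeFn_sub, Pi.sub_apply, lp.coeFn_sum, Finset.sum_apply, lp.coeFn_smul, Pi.smul_apply, smul_eq_mul, sK_apply,
      dK_apply]
    have : ∀ j : ℤ, vf j * (if k + j = 0 then 1 else 0) = if j = -k then vf j else 0 := by
      intro j
      by_cases h : j = -k
      · subst h; simp
      · rw [if_neg h, if_neg (by omega), mul_zero]
    simp only [this]
    rw [Finset.sum_ite_eq']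
    split_ifs
    · rw [hyk]; ring
    · ring
  have : ‖(∑ j ∈ Icc (-(J : ℤ)) J, vf j • sK j dK) - y‖ ^ 2 ≤ η ^ 2 := by
    apply normK_sq_le
    intro t
    have e1 : ∀ k ∈ t, (((∑ j ∈ Icc (-(J : ℤ)) J, vf j • sK j dK) - y) k) ^ 2 =
        if ¬ (-k ∈ Icc (-(J : ℤ)) J) then (y k) ^ 2 else 0 := by
      intro k _
      rw [hz]
      split_ifs <;> simp
    rw [Finset.sum_congr rfl e1, ← Finset.sum_filter]
    have := hs (t.filter fun k => ¬ (-k ∈ Icc (-(J : ℤ)) J)) (by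
      rw [Finset.disjoint_left]
      intro k hk hks
      have h1 := (mem_filter.mp hk).2
      have h2 := hsJ k hks
      rw [mem_Icc] at h1
      omega)
    exact (le_abs_self _).trans this.le
  exact le_of_sq_le_sq this hη.le

theorem align {V W : Submodule ℝ (ℕ →₀ ℝ)} (hV : Asy V) (hW : Asy W) {ε : ℝ} (hε : 0 < ε) :
    ∃ π : KK, (∀ n0 R, Dat V n0 R (1 / 100) ε π) ∧ (∀ n0 R, Dat W n0 R (1 / 100) ε π) := by
  obtain ⟨t, ht, h1⟩ := limit_dat hV
  obtain ⟨t', ht', h2⟩ := limit_dat hW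
  obtain ⟨J, hJ, hJ2⟩ := ker_tail (show 0 < ε / 2 by positivity)
  refine ⟨Ker J t' ((1 / 2 : ℝ) • (uK + t • dK)), fun n0 R => (h1 n0 R ε hε).ker hJ ht', fun n0 R => ?_⟩
  refine ((h2 n0 R (ε / 2) (by positivity)).ker hJ ht).mono le_rfl le_rfl ?_
  have e1 : Ker J t ((1 / 2 : ℝ) • (uK + t' • dK)) - Ker J t' ((1 / 2 : ℝ) • (uK + t • dK)) =
      (-(1 / 24) * (t' - t)) • ((∑ j ∈ Icc (-(J : ℤ)) J, vf j • sK j dK) - (uK - (2 : ℝ) • sK 1 uK)) := by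
    rw [Ker_apply, Ker_apply]
    simp only [map_smul, map_add, smul_add, Finset.sum_add_distrib]
    have e2 : ∀ (c : ℝ) (y : KK), ∑ j ∈ Icc (-(J : ℤ)) J, vf j • c • sK j y = c • ∑ j ∈ Icc (-(J : ℤ)) J, vf j • sK j y := by
      intro c y
      rw [Finset.smul_sum]
      exact Finset.sum_congr rfl fun j _ => smul_comm _ _ _
    have e2' : ∀ (c c' : ℝ) (y : KK), ∑ j ∈ Icc (-(J : ℤ)) J, vf j • c • c' • sK j y =
        (c * c') • ∑ j ∈ Icc (-(J : ℤ)) J, vf j • sK j y := by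
      intro c c' y
      rw [← e2]
      exact Finset.sum_congr rfl fun j _ => by rw [smul_smul c c']
    simp only [e2, e2']
    module
  rw [e1, norm_smul]
  have e3 : ‖-(1 / 24 : ℝ) * (t' - t)‖ ≤ 1 := by
    rw [Real.norm_eq_abs, abs_le]
    rw [abs_le] at ht ht'
    constructor <;> linarith
  have := mul_le_mul_of_nonneg_right e3 (norm_nonneg ((∑ j ∈ Icc (-(J : ℤ)) J, vf j • sK j dK) - (uK - (2 : ℝ) • sK 1 uK)))
  linarith
end
end GMHI

set_option linter.unusedVariables false
set_option linter.unusedSimpArgs false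
namespace GMHI
open Finset
noncomputable section

/-- level two data -/
def Dat2 (V : Submodule ℝ (ℕ →₀ ℝ)) (n0 i : ℕ) (γ ε : ℝ) (π : KK) : Prop :=
  ∃ (q : ℕ) (z : ℕ →₀ ℝ) (c b : AA) (T B : Op) (g : (ℕ →₀ ℝ) →ₗ[ℝ] ℝ), n0 < q ∧ z ∈ V ∧ Supp n0 q z ∧ Supp n0 q c ∧ Supp n0 q b ∧
    IsPath z c b ∧ Good (2 * i) c ∧ ip b b ≤ 1 ∧ EvenNode i T ∧
    IsMor T B g ∧ (∀ a, T (Pr n0 q a) = T a) ∧ (∀ a, B (Pr n0 q a) = B a) ∧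
    (∀ b, ‖B b‖ ≤ √(ip b b)) ∧ γ ≤ g z ∧ ‖T c - π‖ ≤ ε

lemma mm_unb (C : ℝ) : ∃ w, ∀ w', w ≤ w' → C ≤ mm w' := by
  obtain ⟨r, hr⟩ := pow_unbounded_of_one_lt C (show (1 : ℝ) < 4 by norm_num)
  refine ⟨r, fun w' h => hr.le.trans ?_⟩
  exact pow_le_pow_right₀ (by norm_num) (h.trans (lt_mu w').le)

lemma nn_real (w : ℕ) : (nn w : ℝ) = 2 ^ (mu w ^ 2) * 2 ^ (mu w ^ 2) * 2 ^ (mu w ^ 2) * 2 ^ (mu w ^ 2) := by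
  rw [← mul_pow, ← mul_pow, ← mul_pow, nn]; push_cast; norm_num
lemma mm_real (w : ℕ) : mm w = 2 ^ mu w * 2 ^ mu w := by
  rw [← mul_pow, mm]; norm_num
lemma sqrt_nn (w : ℕ) : √(nn w : ℝ) = 4 ^ (mu w ^ 2) := sqrt_16 _

set_option maxHeartbeats 1000000 in
theorem level_two {V : Submodule ℝ (ℕ →₀ ℝ)} {γ ε : ℝ} {π : KK} (hD : ∀ n0 R, Dat V n0 R γ ε π) (n0 i : ℕ) :
    Dat2 V n0 i γ ε π := by
  choose Q x a b T B g k1 k2 k3 k4 k5 k6 k7 k8 k9 k10 k11 k12 k13 k14 k15 k16 using hD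
  choose F hF using mm_unb
  set w := 2 * i with hw
  set st : ℕ → ℕ × ℕ := fun k => Nat.rec (n0, w) (fun k p => (Q p.1 p.2, max (p.2 + 1) (F (n1 (a p.1 p.2) * 2 ^ (k + 1))))) k with hst
  have st0 : st 0 = (n0, w) := rfl
  have stS : ∀ k, st (k + 1) = (Q (st k).1 (st k).2, max ((st k).2 + 1) (F (n1 (a (st k).1 (st k).2) * 2 ^ (k + 1)))) := fun k => rfl
  set s : ℕ → ℕ := fun k => (st k).1 with hs
  set J : ℕ → ℕ := fun k => (st k).2 with hJ
  have sS : ∀ k, Q (s k) (J k) = s (k + 1) := fun k => by simp only [hs, hJ, stS]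
  have JS : ∀ k, J (k + 1) = max (J k + 1) (F (n1 (a (s k) (J k)) * 2 ^ (k + 1))) := fun k => by simp only [hs, hJ, stS]
  clear_value st
  have hm : StrictMono s := strictMono_nat_of_lt_succ fun k => by rw [← sS]; exact k1 _ _
  have hJm : StrictMono J := strictMono_nat_of_lt_succ fun k => by rw [JS]; omega
  have hJ0 : J 0 = w := by simp only [hJ, st0]
  have hs0 : s 0 = n0 := by simp only [hs, st0]
  clear_value s J
  set X := fun k => x (s k) (J k) with hX
  set A := fun k => a (s k) (J k) with hA
  set Bb := fun k => b (s k) (J k) with hBb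
  set TT := fun k => T (s k) (J k) with hTT
  set BB := fun k => B (s k) (J k) with hBB
  set G := fun k => g (s k) (J k) with hG
  have sX : ∀ k, Supp (s k) (s (k + 1)) (X k) := fun k => by rw [← sS]; exact k3 _ _
  have sAk : ∀ k, Supp (s k) (s (k + 1)) (A k) := fun k => by rw [← sS]; exact k4 _ _
  have sBk : ∀ k, Supp (s k) (s (k + 1)) (Bb k) := fun k => by rw [← sS]; exact k5 _ _
  have tP : ∀ k c, TT k (Pr (s k) (s (k + 1)) c) = TT k c := fun k c => by rw [← sS]; exact k11 _ _ _
  have bP : ∀ k c, BB k (Pr (s k) (s (k + 1)) c) = BB k c := fun k c => by rw [← sS]; exact k12 _ _ _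
  have hMor : ∀ k, IsMor (TT k) (BB k) (G k) := fun k => k10 _ _
  have hgood := good_of_ris hm sAk hJm hJ0 (fun k w' hw' S hS => k9 _ _ w' hw' S hS) (fun k => k7 _ _)
    (fun k => hF _ _ (by rw [JS]; exact le_max_right _ _))
  set n := nn w with hn
  set μ := mu w with hμ
  set e := μ ^ 2 with he
  have hn0 : (0 : ℝ) < n := by rw [hn]; exact_mod_cast nn_pos w
  have hm0 := mm_pos w
  have en : (n : ℝ) = 2 ^ e * 2 ^ e * 2 ^ e * 2 ^ e := nn_real w
  have em : mm w = 2 ^ μ * 2 ^ μ := mm_real w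
  set σ : ℤ := (μ : ℤ) - e with hσ
  have eσ : (2 : ℝ) ^ σ = 2 ^ μ / 2 ^ e := by rw [hσ, zpow_sub₀ two_ne_zero]; simp
  have eσ' : (2 : ℝ) ^ (-σ) = 2 ^ e / 2 ^ μ := by rw [zpow_neg, eσ, inv_div]
  set κ : ℝ := mm w / n * (2 : ℝ) ^ (-σ) with hκ
  have hκ0 : 0 < κ := by positivity
  have hpath := ((IsPath.sum (s := range n) (x := X) (a := A) (b := Bb) fun k _ => k6 _ _).dil σ).smul κ
  have hmor := ((IsMor.sum (s := range n) fun k _ => hMor k).dil (-σ)).smul ((2 : ℝ) ^ σ * (mm w)⁻¹)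
  set Tz := node w (fun k => (sK (-σ)).comp (TT k)) s (fun k => s (k + 1)) with hTz
  have hTza : ∀ c, Tz c = (mm w)⁻¹ • ∑ k ∈ range n, sK (-σ) (TT k c) := by
    intro c
    rw [hTz, node_apply]
    simp only [LinearMap.comp_apply, tP, ← hn]
  have h2σ : (2 : ℝ) ^ σ * 2 ^ (-σ) = 1 := by rw [← zpow_add₀ two_ne_zero]; simp
  have hTeq : ((2 : ℝ) ^ σ * (mm w)⁻¹) • (2 : ℝ) ^ (-σ) • (sK (-σ)).comp (∑ k ∈ range n, TT k) = Tz := by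
    apply LinearMap.ext
    intro c
    rw [hTza]
    simp only [LinearMap.smul_apply, LinearMap.comp_apply, LinearMap.sum_apply, map_sum, smul_smul]
    congr 1
    linear_combination (mm w)⁻¹ * h2σ
  rw [hTeq] at hmor
  set Bz := ((2 : ℝ) ^ σ * (mm w)⁻¹) • (2 : ℝ) ^ (- -σ) • (sK (-σ)).comp (∑ k ∈ range n, BB k) with hBz
  have hBza : ∀ c, Bz c = ((4 : ℝ) ^ e)⁻¹ • sK (-σ) (∑ k ∈ range n, BB k c) := by
    intro c
    simp only [hBz, LinearMap.smul_apply, LinearMap.comp_apply, LinearMap.sum_apply, smul_smul]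
    congr 1
    have : (4 : ℝ) ^ e = 2 ^ e * 2 ^ e := by rw [← mul_pow]; norm_num
    rw [neg_neg, eσ, em, this]; field_simp
  set C := (mm w / n : ℝ) • ∑ k ∈ range n, A k with hC
  set z := κ • ∑ k ∈ range n, X k with hz
  set b' := κ • (2 : ℝ) ^ (-σ) • sA σ (∑ k ∈ range n, Bb k) with hb'
  have hsub : ∀ k ∈ range n, n0 ≤ s k ∧ s (k + 1) ≤ s n := fun k hk =>
    ⟨by rw [← hs0]; exact hm.monotone (Nat.zero_le _), hm.monotone (mem_range.mp hk)⟩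
  have hPP : ∀ k, k < n → ∀ c : AA, Pr (s k) (s (k + 1)) (Pr n0 (s n) c) = Pr (s k) (s (k + 1)) c := by
    intro k hk c
    have := hsub k (mem_range.mpr hk)
    rw [Pr_Pr, max_eq_left this.1, min_eq_left this.2]
  have hCpath : κ • (2 : ℝ) ^ σ • sA σ (∑ k ∈ range n, A k) = sA σ C := by
    rw [hC, map_smul, smul_smul]
    congr 1
    rw [hκ]; linear_combination mm w / n * h2σ
  rw [hCpath] at hpath
  refine ⟨s n, z, sA σ C, b', Tz, Bz, _, ?_, ?_, ?_, ?_, ?_, hpath, hgood.sA σ, ?_, ?_, hmor, ?_, ?_, ?_, ?_, ?_⟩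
  · rw [← hs0]; exact hm (by rw [hn]; exact nn_pos w)
  · exact V.smul_mem _ (V.sum_mem fun k _ => k2 _ _)
  · exact Supp.smul _ (Supp.sum fun k hk => (sX k).mono (hsub k hk).1 (hsub k hk).2)
  · exact Supp.sA _ (Supp.smul _ (Supp.sum fun k hk => (sAk k).mono (hsub k hk).1 (hsub k hk).2))
  · exact Supp.smul _ (Supp.smul _ (Supp.sA _ (Supp.sum fun k hk => (sBk k).mono (hsub k hk).1 (hsub k hk).2)))
  · have e1 : ip b' b' = (κ * (2 : ℝ) ^ (-σ)) ^ 2 * ∑ k ∈ range n, ip (Bb k) (Bb k) := by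
      rw [hb', smul_smul]
      simp only [map_smul, LinearMap.smul_apply, smul_eq_mul]
      rw [ip_sA, ip_sum_disj hm (fun k _ => sBk k)]
      ring
    have e2 : ∑ k ∈ range n, ip (Bb k) (Bb k) ≤ n := by
      have := Finset.sum_le_sum fun k (_ : k ∈ range n) => k8 (s k) (J k)
      simpa using this
    have e3 : (κ * (2 : ℝ) ^ (-σ)) ^ 2 * n = 1 := by
      rw [hκ, eσ', en, em]; field_simp
    rw [e1, ← e3]
    exact mul_le_mul_of_nonneg_left e2 (by positivity)
  · refine ⟨_, s, fun k => s (k + 1), fun l l' h _ => hm.monotone h, fun l _ => ?_, hTz⟩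
    refine mem_of_le (fun m c => ?_) (fun c => ?_)
    · rw [LinearMap.comp_apply, (hMor l).ts, LinearMap.comp_apply, sK_sK, sK_sK, add_comm]
    · rw [LinearMap.comp_apply, sK_norm]; exact k13 _ _ _
  · intro c
    rw [hTza, hTza]
    congr 1
    apply Finset.sum_congr rfl
    intro k hk
    rw [← tP k (Pr n0 (s n) c), hPP k (mem_range.mp hk), tP]
  · intro c
    rw [hBza, hBza]
    congr 2
    apply Finset.sum_congr rfl
    intro k hk
    rw [← bP k (Pr n0 (s n) c), hPP k (mem_range.mp hk), bP]
  · intro c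
    have := norm_sum_B hm (M := n) (fun k _ => bP k) (fun k _ => k14 _ _) c
    rw [hn, sqrt_nn] at this
    rw [hBza, norm_smul, sK_norm, norm_inv, Real.norm_of_nonneg (by positivity), inv_mul_le_iff₀ (by positivity)]
    exact this
  · have e1 := IsMor.g_sum hm (M := n) (fun k _ => hMor k) (fun k _ => tP k) (fun k _ => bP k) (x := X) (fun k _ => sX k)
    rw [LinearMap.smul_apply, hz, map_smul, e1, smul_eq_mul, smul_eq_mul]
    have e2 : (n : ℝ) * γ ≤ ∑ k ∈ range n, G k (X k) := by
      have := Finset.sum_le_sum fun k (_ : k ∈ range n) => k15 (s k) (J k)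
      simpa using this
    have e3 : (2 : ℝ) ^ σ * (mm w)⁻¹ * κ = (n : ℝ)⁻¹ := by
      rw [hκ, eσ, eσ', em, en]; field_simp
    rw [← mul_assoc, e3, le_inv_mul_iff₀ hn0]
    exact e2
  · have e1 : Tz (sA σ C) = (n : ℝ)⁻¹ • ∑ k ∈ range n, TT k (A k) := by
      rw [hTza, hC, map_smul]
      have : ∀ k ∈ range n, sK (-σ) (TT k ((mm w / n : ℝ) • sA σ (∑ l ∈ range n, A l))) = (mm w / n : ℝ) • TT k (A k) := by
        intro k hk
        rw [map_smul, map_smul, (hMor k).ts, sK_sK]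
        rw [show -σ + σ = 0 by ring, sK_zero]
        congr 1
        rw [map_sum, Finset.sum_eq_single k]
        · intro l _ hlk
          rw [← tP, Pr_eq_zero (sAk l) (supp_order hm hlk.symm), map_zero]
        · intro h; exact absurd hk h
      rw [Finset.sum_congr rfl this, ← Finset.smul_sum, smul_smul]
      congr 1
      field_simp
    have e2 : Tz (sA σ C) - π = (n : ℝ)⁻¹ • ∑ k ∈ range n, (TT k (A k) - π) := by
      rw [e1, Finset.sum_sub_distrib, Finset.sum_const, card_range, smul_sub, ← Nat.cast_smul_eq_nsmul ℝ, smul_smul,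
        inv_mul_cancel₀ hn0.ne', one_smul]
    rw [e2, norm_smul, norm_inv, Real.norm_of_nonneg hn0.le, inv_mul_le_iff₀ hn0]
    refine (norm_sum_le _ _).trans ?_
    have := Finset.sum_le_sum fun k (_ : k ∈ range n) => k16 (s k) (J k)
    simpa using this
end
end GMHI

set_option linter.unusedVariables false
set_option linter.unusedSimpArgs false
namespace GMHI
open Finset
noncomputable section

set_option maxHeartbeats 1000000 in
lemma special_vec {V W : Submodule ℝ (ℕ →₀ ℝ)} (hV : Asy V) (hW : Asy W) (j : ℕ) :
    ∃ v ∈ V, ∃ w ∈ W, 0 < NN LL (v + w) ∧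
      NN LL (v - w) ≤ 14600 / 2 ^ mu (2 * j + 1) * NN LL (v + w) := by
  set ω := 2 * j + 1 with hω
  have hn0 : (0 : ℝ) < nn ω := by exact_mod_cast nn_pos ω
  set ε : ℝ := (nn ω : ℝ)⁻¹ / 4 with hε
  have hε0 : 0 < ε := by positivity
  obtain ⟨π, hDV, hDW⟩ := align hV hW hε0
  have hU : ∀ k n0 i : ℕ, Dat2 (if Even k then V else W) n0 i (1 / 100) ε π := by
    intro k n0 i
    split_ifs
    · exact level_two hDV n0 i
    · exact level_two hDW n0 i
  choose Q z c b T B g k1 k2 k3 k4 k5 k6 k7 k8 k9 k10 k11 k12 k13 k14 k15 using hU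
  have hdense : ∀ a : AA, ∃ i, n1 (a - dd i) < ε := fun a => dd_dense a hε0
  choose D hD using hdense
  set wt : List ℕ → ℕ := fun l => j + 1 + Encodable.encode l with hwt
  set st : ℕ → ℕ × List ℕ := fun k => Nat.rec (0, []) (fun k p => (Q k p.1 (wt p.2), p.2 ++ [D (c k p.1 (wt p.2))])) k with hst
  have st0 : st 0 = (0, []) := rfl
  have stS : ∀ k, st (k + 1) = (Q k (st k).1 (wt (st k).2), (st k).2 ++ [D (c k (st k).1 (wt (st k).2))]) := fun k => rfl
  clear_value st
  set s : ℕ → ℕ := fun k => (st k).1 with hs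
  set d : ℕ → ℕ := fun k => D (c k (st k).1 (wt (st k).2)) with hd
  have hl : ∀ k, (st k).2 = (List.range k).map d := by
    intro k
    induction k with
    | zero => simp [st0]
    | succ k ih => rw [stS, List.range_succ, List.map_append, ← ih]; simp [hd]
  have hJ : ∀ k, wt (st k).2 = tt j d k := fun k => by rw [hl]; rfl
  have sS : ∀ k, Q k (s k) (tt j d k) = s (k + 1) := fun k => by rw [← hJ]; simp only [hs, stS]
  have hdk : ∀ k, d k = D (c k (s k) (tt j d k)) := fun k => by rw [← hJ]
  clear_value s d
  clear hl hJ stS st0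
  have hm : StrictMono s := strictMono_nat_of_lt_succ fun k => by rw [← sS]; exact k1 _ _ _
  set X := fun k => z k (s k) (tt j d k) with hX
  set A := fun k => c k (s k) (tt j d k) with hA
  set Bb := fun k => b k (s k) (tt j d k) with hBb
  set TT := fun k => T k (s k) (tt j d k) with hTT
  set BB := fun k => B k (s k) (tt j d k) with hBB
  set G := fun k => g k (s k) (tt j d k) with hG
  have sX : ∀ k, Supp (s k) (s (k + 1)) (X k) := fun k => by rw [← sS]; exact k3 _ _ _
  have sAk : ∀ k, Supp (s k) (s (k + 1)) (A k) := fun k => by rw [← sS]; exact k4 _ _ _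
  have sBk : ∀ k, Supp (s k) (s (k + 1)) (Bb k) := fun k => by rw [← sS]; exact k5 _ _ _
  have hpa : ∀ k, IsPath (X k) (A k) (Bb k) := fun k => k6 _ _ _
  have hgood : ∀ k, Good (2 * tt j d k) (A k) := fun k => k7 _ _ _
  have hbb : ∀ k, ip (Bb k) (Bb k) ≤ 1 := fun k => k8 _ _ _
  have hev : ∀ k, EvenNode (tt j d k) (TT k) := fun k => k9 _ _ _
  have hMor : ∀ k, IsMor (TT k) (BB k) (G k) := fun k => k10 _ _ _
  have tP : ∀ k c, TT k (Pr (s k) (s (k + 1)) c) = TT k c := fun k c => by rw [← sS]; exact k11 _ _ _ _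
  have bP : ∀ k c, BB k (Pr (s k) (s (k + 1)) c) = BB k c := fun k c => by rw [← sS]; exact k12 _ _ _ _
  have hBn : ∀ k b, ‖BB k b‖ ≤ √(ip b b) := fun k => k13 _ _ _
  have hgX : ∀ k, 1 / 100 ≤ G k (X k) := fun k => k14 _ _ _
  have hTA : ∀ k, ‖TT k (A k) - π‖ ≤ ε := fun k => k15 _ _ _
  have hXU : ∀ k, X k ∈ (if Even k then V else W) := fun k => k2 _ _ _
  have hAd : ∀ k, n1 (A k - dd (d k)) ≤ ε := fun k => by rw [hdk k]; exact (hD _).le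
  clear_value X A Bb TT BB G
  clear k1 k2 k3 k4 k5 k6 k7 k8 k9 k10 k11 k12 k13 k14 k15
  have hAd' : ∀ k, n1 (A k - dd (d k)) ≤ (nn ω : ℝ)⁻¹ := fun k => (hAd k).trans (by
    have : (0 : ℝ) < (nn ω : ℝ)⁻¹ := by positivity
    rw [hε]; linarith)
  have hSE := special_est hm sAk hgood hAd'
  rw [← hω] at hSE
  -- the odd node
  have hTd : ∀ k, ‖TT k (dd (d k)) - π‖ ≤ ε + ε := by
    intro k
    have e1 : TT k (dd (d k)) - π = (TT k (A k) - π) - TT k (A k - dd (d k)) := by rw [map_sub]; abel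
    rw [e1]
    exact (norm_sub_le _ _).trans (add_le_add (hTA k) (((hev k).mem.le_n1 _).trans (hAd k)))
  have hodd : OddNode j (node ω TT (fun l => max (s l) 0) (fun l => min (s (l + 1)) (s (nn ω)))) := by
    refine ⟨d, TT, s, fun l => s (l + 1), 0, s (nn ω), fun l _ => hev l, fun l l' h _ => hm.monotone h, ?_, rfl⟩
    intro l l' _ _
    rw [tP, tP]
    have e1 : TT l (dd (d l)) - TT l' (dd (d l')) = (TT l (dd (d l)) - π) - (TT l' (dd (d l')) - π) := by abel
    rw [e1]
    refine (norm_sub_le _ _).trans ((add_le_add (hTd l) (hTd l')).trans (le_of_eq ?_))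
    rw [hε, hω]; ring
  have hodd2 : ∀ a, ‖(mm ω)⁻¹ • ∑ i ∈ range (16 ^ (mu ω ^ 2)), TT i a‖ ≤ LL a := by
    intro a
    have := hodd.mem.le_LL a
    rw [node_apply] at this
    refine le_trans (le_of_eq ?_) this
    congr 2
    apply Finset.sum_congr rfl
    intro i hi
    have hi2 : s (i + 1) ≤ s (nn ω) := hm.monotone (mem_range.mp hi)
    rw [max_eq_left (Nat.zero_le _), min_eq_left hi2, tP]
  have hlow := lower_bd hm (w := ω) (e := mu ω ^ 2) (fun i _ => hMor i) hodd2 (fun i _ => bP i) (fun i _ => hBn i)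
    (∑ i ∈ range (nn ω), X i)
  have hgs := IsMor.g_sum hm (M := nn ω) (fun k _ => hMor k) (fun k _ => tP k) (fun k _ => bP k) (x := X) (fun k _ => sX k)
  have hlow2 : (nn ω : ℝ) * (1 / 100) ≤ 2 ^ (mu ω + mu ω ^ 2 + 1) * NN LL (∑ i ∈ range (nn ω), X i) := by
    refine le_trans ?_ hlow
    refine le_trans ?_ (le_of_eq hgs.symm)
    have := Finset.sum_le_sum fun k (_ : k ∈ range (nn ω)) => hgX k
    rw [sum_const, card_range, nsmul_eq_mul] at this
    exact this
  -- upper estimate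
  have hpath := IsPath.sum (s := range (nn ω)) (x := fun i => ((-1 : ℝ) ^ i) • X i) (a := fun i => ((-1 : ℝ) ^ i) • A i)
    (b := fun i => ((-1 : ℝ) ^ i) • Bb i) fun k _ => (hpa k).smul _
  have hup := NN_le_dil LL_isLN hpath (2 * (mu ω : ℤ) - (mu ω ^ 2 : ℕ))
  have hib : √(ip (∑ i ∈ range (nn ω), ((-1 : ℝ) ^ i) • Bb i) (∑ i ∈ range (nn ω), ((-1 : ℝ) ^ i) • Bb i)) ≤ 4 ^ (mu ω ^ 2) := by
    rw [← sqrt_nn]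
    apply Real.sqrt_le_sqrt
    rw [ip_sum_disj hm (fun k _ => (sBk k).smul _)]
    have h1 : ∀ k ∈ range (nn ω), ip (((-1 : ℝ) ^ k) • Bb k) (((-1 : ℝ) ^ k) • Bb k) ≤ 1 := by
      intro k _
      simp only [map_smul, LinearMap.smul_apply, smul_eq_mul]
      rw [← mul_assoc, ← mul_pow]; simpa using hbb k
    have := Finset.sum_le_sum h1
    rw [sum_const, card_range, nsmul_eq_mul, mul_one] at this
    exact this
  -- splitting
  set v := ∑ i ∈ (range (nn ω)).filter Even, X i with hv
  set w := ∑ i ∈ (range (nn ω)).filter (fun i => ¬ Even i), X i with hw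
  have hvw : ∑ i ∈ range (nn ω), X i = v + w := (Finset.sum_filter_add_sum_filter_not _ _ _).symm
  have hvw' : ∑ i ∈ range (nn ω), ((-1 : ℝ) ^ i) • X i = v - w := by
    rw [← Finset.sum_filter_add_sum_filter_not _ Even, sub_eq_add_neg, hw, ← Finset.sum_neg_distrib]
    congr 1
    · apply Finset.sum_congr rfl
      intro i hi
      rw [(mem_filter.mp hi).2.neg_one_pow, one_smul]
    · apply Finset.sum_congr rfl
      intro i hi
      rw [(Nat.not_even_iff_odd.mp (mem_filter.mp hi).2).neg_one_pow, neg_smul, one_smul]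
  refine ⟨v, V.sum_mem fun i hi => ?_, w, W.sum_mem fun i hi => ?_, ?_⟩
  · have := hXU i; rwa [if_pos (mem_filter.mp hi).2] at this
  · have := hXU i; rwa [if_neg (mem_filter.mp hi).2] at this
  rw [hvw] at hlow2
  rw [hvw'] at hup
  clear_value v w
  have hup2 : NN LL (v - w) ≤ (2 : ℝ) ^ (2 * (mu ω : ℤ) - (mu ω ^ 2 : ℕ)) * (72 * (nn ω / mm ω ^ 2)) +
      (2 : ℝ) ^ (-(2 * (mu ω : ℤ) - (mu ω ^ 2 : ℕ))) * 4 ^ (mu ω ^ 2) :=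
    hup.trans (add_le_add (mul_le_mul_of_nonneg_left hSE (by positivity)) (mul_le_mul_of_nonneg_left hib (by positivity)))
  have e4 : (4 : ℝ) ^ (mu ω ^ 2) = 2 ^ (mu ω ^ 2) * 2 ^ (mu ω ^ 2) := by rw [← mul_pow]; norm_num
  have ez : (2 : ℝ) ^ (2 * (mu ω : ℤ) - (mu ω ^ 2 : ℕ)) = 2 ^ mu ω * 2 ^ mu ω / 2 ^ (mu ω ^ 2) := by
    rw [zpow_sub₀ two_ne_zero, zpow_natCast, two_mul, zpow_add₀ two_ne_zero, zpow_natCast]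
  rw [zpow_neg, ez, mm_real, nn_real, e4] at hup2
  rw [nn_real, pow_add, pow_add] at hlow2
  generalize mu ω ^ 2 = e at *
  generalize mu ω = μ at *
  have hE : (0 : ℝ) < 2 ^ e := by positivity
  have hM : (0 : ℝ) < 2 ^ μ := by positivity
  generalize (2 : ℝ) ^ e = E at *
  generalize (2 : ℝ) ^ μ = M at *
  have h1 : E ^ 3 / (200 * M) ≤ NN LL (v + w) := by
    rw [div_le_iff₀ (by positivity)]
    have : E * (E ^ 3) ≤ E * (NN LL (v + w) * (200 * M)) := by nlinarith
    exact le_of_mul_le_mul_left this hE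
  refine ⟨lt_of_lt_of_le (by positivity) h1, ?_⟩
  have h2 : NN LL (v - w) ≤ 14600 / M * (E ^ 3 / (200 * M)) := by
    refine hup2.trans (le_of_eq ?_)
    field_simp
    ring
  exact h2.trans (mul_le_mul_of_nonneg_left h1 (by positivity))

theorem HI_core {V W : Submodule ℝ (ℕ →₀ ℝ)} (hV : Asy V) (hW : Asy W) {δ : ℝ} (hδ : 0 < δ) :
    ∃ v ∈ V, ∃ w ∈ W, 0 < NN LL (v + w) ∧ NN LL (v - w) ≤ δ * NN LL (v + w) := by
  obtain ⟨j, hj⟩ := pow_unbounded_of_one_lt (14600 / δ) (show (1 : ℝ) < 2 by norm_num)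
  obtain ⟨v, hv, w, hw, h0, h1⟩ := special_vec hV hW j
  refine ⟨v, hv, w, hw, h0, h1.trans (mul_le_mul_of_nonneg_right ?_ h0.le)⟩
  have h2 : (2 : ℝ) ^ j ≤ 2 ^ mu (2 * j + 1) :=
    pow_le_pow_right₀ (by norm_num) (by have := lt_mu (2 * j + 1); omega)
  rw [div_le_iff₀ (by positivity)]
  rw [div_lt_iff₀ hδ] at hj
  nlinarith
end
end GMHI

set_option linter.unusedVariables false
set_option linter.unusedSimpArgs false
namespace GMHI
open Finset
noncomputable section

/-- the finitely supported sequences, normed by `NN LL` -/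
def X0 : Type := ℕ →₀ ℝ
instance : AddCommGroup X0 := inferInstanceAs (AddCommGroup (ℕ →₀ ℝ))
instance : Module ℝ X0 := inferInstanceAs (Module ℝ (ℕ →₀ ℝ))
instance : Norm X0 := ⟨fun x => NN LL x⟩

lemma X0_core : NormedSpace.Core ℝ X0 where
  norm_nonneg x := NN_nonneg LL x
  norm_smul c x := NN_smul LL_isLN c x
  norm_triangle x y := NN_add LL_isLN x y
  norm_eq_zero_iff x := ⟨fun h => NN_eq_zero LL_isLN h, fun h => by rw [h]; exact NN_zero LL_isLN⟩

instance : NormedAddCommGroup X0 := NormedAddCommGroup.ofCore X0_core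
instance : NormedSpace ℝ X0 := NormedSpace.ofCore X0_core

def toX0 : (ℕ →₀ ℝ) →ₗ[ℝ] X0 := LinearMap.id

abbrev XC : Type := UniformSpace.Completion X0

def iC : (ℕ →₀ ℝ) →ₗ[ℝ] XC := (UniformSpace.Completion.toComplL (𝕜 := ℝ) (E := X0)).toLinearMap.comp toX0

lemma iC_norm (x : ℕ →₀ ℝ) : ‖iC x‖ = NN LL x := UniformSpace.Completion.norm_coe (E := X0) x

lemma iC_dense : DenseRange iC := UniformSpace.Completion.denseRange_coe (α := X0)

section gen
variable {X : Type} [NormedAddCommGroup X] [NormedSpace ℝ X] {ι : (ℕ →₀ ℝ) →ₗ[ℝ] X}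

lemma gen_uc_ineq (hι : ∀ x, ‖ι x‖ = NN LL x) (hd : DenseRange ι) (m : ℕ) (x y : X) :
    (1 - (16 : ℝ)⁻¹ ^ m) * ‖x‖ ^ 2 + (4 : ℝ)⁻¹ ^ m * ‖y‖ ^ 2 ≤ (‖x + y‖ ^ 2 + ‖x - y‖ ^ 2) / 2 := by
  refine hd.induction_on₂ (p := fun x y => (1 - (16 : ℝ)⁻¹ ^ m) * ‖x‖ ^ 2 + (4 : ℝ)⁻¹ ^ m * ‖y‖ ^ 2 ≤ (‖x + y‖ ^ 2 + ‖x - y‖ ^ 2) / 2)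
    ?_ ?_ x y
  · exact isClosed_le (by fun_prop) (by fun_prop)
  · intro a b
    rw [← map_add, ← map_sub, hι, hι, hι, hι]
    exact uc_ineq LL_isLN a b m

lemma gen_uc (hι : ∀ x, ‖ι x‖ = NN LL x) (hd : DenseRange ι) (ε : ℝ) (hε : 0 < ε) :
    ∃ δ : ℝ, 0 < δ ∧ ∀ x y : X, ‖x‖ ≤ 1 → ‖y‖ ≤ 1 → ε ≤ ‖x - y‖ → ‖(2 : ℝ)⁻¹ • (x + y)‖ ≤ 1 - δ := by
  obtain ⟨m, hm⟩ := exists_pow_lt_of_lt_one (show 0 < ε ^ 2 / 8 by positivity) (show (4 : ℝ)⁻¹ < 1 by norm_num)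
  set h : ℝ := (4 : ℝ)⁻¹ ^ m with hh
  have h0 : 0 < h := by positivity
  have hη : (16 : ℝ)⁻¹ ^ m = h ^ 2 := by rw [hh, ← pow_mul, mul_comm, pow_mul]; norm_num
  refine ⟨h * ε ^ 2 / 16, by positivity, fun x y hx hy hxy => ?_⟩
  have key := gen_uc_ineq hι hd m ((2 : ℝ)⁻¹ • (x + y)) ((2 : ℝ)⁻¹ • (x - y))
  have e1 : (2 : ℝ)⁻¹ • (x + y) + (2 : ℝ)⁻¹ • (x - y) = x := by module
  have e2 : (2 : ℝ)⁻¹ • (x + y) - (2 : ℝ)⁻¹ • (x - y) = y := by module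
  rw [e1, e2, hη, ← hh] at key
  have e3 : ‖(2 : ℝ)⁻¹ • (x - y)‖ = ‖x - y‖ / 2 := by rw [norm_smul]; norm_num; ring
  have hu1 : ‖(2 : ℝ)⁻¹ • (x + y)‖ ≤ 1 := by
    rw [norm_smul]; have := norm_add_le x y; norm_num; linarith
  rw [e3] at key
  set u := ‖(2 : ℝ)⁻¹ • (x + y)‖ with hu
  have hu0 : 0 ≤ u := norm_nonneg _
  have hx2 : ‖x‖ ^ 2 ≤ 1 := by have := norm_nonneg x; nlinarith
  have hy2 : ‖y‖ ^ 2 ≤ 1 := by have := norm_nonneg y; nlinarith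
  have hu2 : u ^ 2 ≤ 1 := by nlinarith
  have hd2 : ε ^ 2 ≤ ‖x - y‖ ^ 2 := by nlinarith
  have h3 : h ^ 2 * u ^ 2 ≤ h ^ 2 := by nlinarith [sq_nonneg h]
  have h4 : h * ε ^ 2 ≤ h * ‖x - y‖ ^ 2 := mul_le_mul_of_nonneg_left hd2 h0.le
  have h5 : h ^ 2 ≤ h * (ε ^ 2 / 8) := by rw [sq]; exact mul_le_mul_of_nonneg_left hm.le h0.le
  have h6 : u ^ 2 ≤ 1 - h * ε ^ 2 / 8 := by nlinarith
  have h7 : h * ε ^ 2 / 8 ≤ 1 := by nlinarith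
  nlinarith [sq_nonneg (h * ε ^ 2 / 16), sq_nonneg (u - (1 - h * ε ^ 2 / 16))]

lemma gen_inf (hι : ∀ x, ‖ι x‖ = NN LL x) : ¬ FiniteDimensional ℝ X := by
  intro h
  have hinj : Function.Injective ι := by
    rw [injective_iff_map_eq_zero]
    intro a ha
    apply NN_eq_zero LL_isLN
    rw [← hι, ha, norm_zero]
  have := Module.Finite.of_injective ι hinj
  have h2 := Module.Finite.finite_basis (Finsupp.basisSingleOne (R := ℝ) (ι := ℕ))
  exact not_finite ℕ

lemma Pr_split (n : ℕ) (x : ℕ →₀ ℝ) : Pr 0 n x = ∑ k ∈ range n, x k • Finsupp.single k (1 : ℝ) := by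
  ext i
  rw [Finsupp.finsetSum_apply, Pr_apply]
  simp [Finsupp.single_apply]

lemma gen_approx (hι : ∀ x, ‖ι x‖ = NN LL x) (hd : DenseRange ι) {Y : Submodule ℝ X} (hY : ¬ FiniteDimensional ℝ Y)
    (n : ℕ) {ε : ℝ} (hε : 0 < ε) :
    ∃ y ∈ Y, ∃ x : ℕ →₀ ℝ, ‖y‖ = 1 ∧ ‖ι x - y‖ ≤ ε ∧ ∀ k, k < n → x k = 0 := by
  have hb : ∀ k : ℕ, ∃ C, ∀ x, ‖(Finsupp.lapply k : (ℕ →₀ ℝ) →ₗ[ℝ] ℝ) x‖ ≤ C * ‖ι x‖ := fun k =>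
    ⟨2, fun x => by rw [hι]; exact NN_coord LL_isLN x k⟩
  set f : ℕ → X →L[ℝ] ℝ := fun k => (Finsupp.lapply k : (ℕ →₀ ℝ) →ₗ[ℝ] ℝ).extendOfNorm ι with hf
  have hfx : ∀ k x, f k (ι x) = x k := fun k x => LinearMap.extendOfNorm_eq hd (hb k) x
  have hfn : ∀ k x, |f k x| ≤ 2 * ‖x‖ := by
    intro k x
    refine hd.induction_on (p := fun x => |f k x| ≤ 2 * ‖x‖) x (isClosed_le (by fun_prop) (by fun_prop)) ?_
    intro a
    rw [hfx, hι]; exact NN_coord LL_isLN a k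
  have h1 : ∃ y ∈ Y, y ≠ 0 ∧ ∀ k, k < n → f k y = 0 := by
    by_contra! hcon
    apply hY
    set F : Y →ₗ[ℝ] (Fin n → ℝ) := LinearMap.pi fun k => (f k).toLinearMap.comp Y.subtype with hF
    apply Module.Finite.of_injective F
    rw [injective_iff_map_eq_zero]
    intro y hy
    by_contra hne
    obtain ⟨k, hk, hk2⟩ := hcon y y.2 (fun h => hne (Subtype.ext h))
    exact hk2 (congrFun hy ⟨k, hk⟩)
  obtain ⟨y0, hy0, hne, hz⟩ := h1
  have hy0n : 0 < ‖y0‖ := norm_pos_iff.mpr hne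
  set y := ‖y0‖⁻¹ • y0 with hy
  have hyn : ‖y‖ = 1 := by rw [hy, norm_smul, norm_inv, norm_norm, inv_mul_cancel₀ hy0n.ne']
  have hyz : ∀ k, k < n → f k y = 0 := fun k hk => by rw [hy, map_smul, hz k hk, smul_zero]
  set C : ℝ := ∑ k ∈ range n, NN LL (Finsupp.single k (1 : ℝ)) with hC
  have hC0 : 0 ≤ C := Finset.sum_nonneg fun k _ => NN_nonneg LL _
  set η : ℝ := ε / (1 + 2 * C) with hη
  have hη0 : 0 < η := by positivity
  obtain ⟨x, hx⟩ := Metric.denseRange_iff.mp hd y η hη0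
  rw [dist_eq_norm, norm_sub_rev] at hx
  have hxk : ∀ k, k < n → |x k| ≤ 2 * η := by
    intro k hk
    have := hfn k (ι x - y)
    rw [map_sub, hfx, hyz k hk, sub_zero] at this
    linarith
  have hPr : NN LL (Pr 0 n x) ≤ 2 * η * C := by
    rw [Pr_split]
    refine (NN_sum LL_isLN _ _).trans ?_
    rw [hC, Finset.mul_sum]
    apply Finset.sum_le_sum
    intro k hk
    rw [NN_smul LL_isLN]
    exact mul_le_mul_of_nonneg_right (hxk k (mem_range.mp hk)) (NN_nonneg LL _)
  refine ⟨y, Y.smul_mem _ hy0, x - Pr 0 n x, hyn, ?_, ?_⟩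
  · have e1 : ι (x - Pr 0 n x) - y = (ι x - y) - ι (Pr 0 n x) := by rw [map_sub]; abel
    rw [e1]
    refine (norm_sub_le _ _).trans ?_
    rw [hι]
    have : η * (1 + 2 * C) = ε := by rw [hη]; field_simp
    nlinarith
  · intro k hk
    rw [Finsupp.sub_apply, Pr_apply]
    simp [hk]

lemma gen_block (hι : ∀ x, ‖ι x‖ = NN LL x) (hd : DenseRange ι) {Y : Submodule ℝ X} (hY : ¬ FiniteDimensional ℝ Y)
    {η : ℝ} (hη : 0 < η) (hη1 : η ≤ 1) :
    ∃ V : Submodule ℝ (ℕ →₀ ℝ), Asy V ∧ ∀ v ∈ V, ∃ y ∈ Y, ‖ι v - y‖ ≤ η * NN LL v := by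
  have hq : ∀ x : ℕ →₀ ℝ, ∃ q, Supp 0 q x := exists_supp
  choose q hq using hq
  have ha : ∀ n i : ℕ, ∃ y ∈ Y, ∃ x : ℕ →₀ ℝ, ‖y‖ = 1 ∧ ‖ι x - y‖ ≤ η / 4 * (1 / 2) ^ i ∧ ∀ k, k < n → x k = 0 :=
    fun n i => gen_approx hι hd hY n (by positivity)
  choose y hy x hy1 hxy hx0 using ha
  set s : ℕ → ℕ := fun k => Nat.rec 0 (fun k p => max (p + 1) (q (x p k))) k with hs
  have sS : ∀ k, s (k + 1) = max (s k + 1) (q (x (s k) k)) := fun k => rfl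
  clear_value s
  have hm : StrictMono s := strictMono_nat_of_lt_succ fun k => by rw [sS]; omega
  set u := fun k => x (s k) k with hu
  have su : ∀ k, Supp (s k) (s (k + 1)) (u k) := by
    intro k n hn
    refine ⟨?_, ?_⟩
    · by_contra! h
      exact hn (hx0 (s k) k n h)
    · rw [sS]; exact lt_of_lt_of_le (hq _ n hn).2 (le_max_right _ _)
  set t := fun k => y (s k) k with ht
  have hut : ∀ k, ‖ι (u k) - t k‖ ≤ η / 4 * (1 / 2) ^ k := fun k => hxy _ _
  have htY : ∀ k, t k ∈ Y := fun k => hy _ _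
  have hu12 : ∀ k, 1 / 2 ≤ NN LL (u k) := by
    intro k
    have h1 : ‖t k‖ = 1 := hy1 _ _
    have h2 := norm_sub_norm_le (t k) (ι (u k))
    rw [norm_sub_rev, h1, hι] at h2
    have h3 := hut k
    have h4 : ((1 : ℝ) / 2) ^ k ≤ 1 := pow_le_one₀ (by norm_num) (by norm_num)
    nlinarith
  clear_value u t
  refine ⟨Submodule.span ℝ (Set.range u), ?_, ?_⟩
  · intro n
    refine ⟨u n, Submodule.subset_span ⟨n, rfl⟩, ?_, ?_⟩
    · intro h
      have := hu12 n
      rw [h, NN_zero LL_isLN] at this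
      norm_num at this
    · intro k hk
      by_contra h
      have := (su n k h).1
      have := hm.id_le n
      simp only [id] at this
      omega
  · intro v hv
    obtain ⟨l, rfl⟩ := (Finsupp.mem_span_range_iff_exists_finsupp).mp hv
    refine ⟨l.sum fun i a => a • t i, Y.sum_mem fun i _ => Y.smul_mem _ (htY i), ?_⟩
    set v := l.sum fun i a => a • u i with hv
    have hl : ∀ i ∈ l.support, |l i| ≤ 2 * NN LL v := by
      intro i hi
      have e1 : Pr (s i) (s (i + 1)) v = l i • u i := by
        rw [hv, Finsupp.sum, map_sum, Finset.sum_eq_single i]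
        · rw [map_smul, Pr_eq_self (su i)]
        · intro k _ hk
          rw [map_smul, Pr_eq_zero (su k) (supp_order hm hk.symm), smul_zero]
        · intro h; exact absurd hi h
      have e2 := NN_Pr LL_isLN (s i) (s (i + 1)) v
      rw [e1, NN_smul LL_isLN] at e2
      have := mul_le_mul_of_nonneg_left (hu12 i) (abs_nonneg (l i))
      linarith
    have hN := NN_nonneg LL v
    have e3 : ι v - (l.sum fun i a => a • t i) = ∑ i ∈ l.support, l i • (ι (u i) - t i) := by
      rw [hv, Finsupp.sum, Finsupp.sum, map_sum, ← Finset.sum_sub_distrib]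
      apply Finset.sum_congr rfl
      intro i _
      rw [map_smul, smul_sub]
    rw [e3]
    have e4 : ∑ i ∈ l.support, ((1 : ℝ) / 2) ^ i ≤ 2 := by
      exact (summable_geometric_two.sum_le_tsum _ (fun i _ => by positivity)).trans (le_of_eq tsum_geometric_two)
    calc ‖∑ i ∈ l.support, l i • (ι (u i) - t i)‖ ≤ ∑ i ∈ l.support, 2 * NN LL v * (η / 4 * (1 / 2) ^ i) := by
          refine (norm_sum_le _ _).trans (Finset.sum_le_sum fun i hi => ?_)
          rw [norm_smul]
          exact mul_le_mul (hl i hi) (hut i) (norm_nonneg _) (by positivity)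
      _ = NN LL v * η / 2 * ∑ i ∈ l.support, ((1 : ℝ) / 2) ^ i := by
          rw [Finset.mul_sum]; apply Finset.sum_congr rfl; intro i _; ring
      _ ≤ NN LL v * η / 2 * 2 := mul_le_mul_of_nonneg_left e4 (by positivity)
      _ = η * NN LL v := by ring

lemma gen_angle [CompleteSpace X] {Y Z : Submodule ℝ X} (hY : IsClosed (Y : Set X)) (hZ : IsClosed (Z : Set X))
    (hYZ : Y ⊓ Z = ⊥) (hc : IsClosed ((Y ⊔ Z : Submodule ℝ X) : Set X)) :
    ∃ κ : ℝ, 0 ≤ κ ∧ ∀ y ∈ Y, ∀ z ∈ Z, ‖y‖ ≤ κ * ‖y - z‖ := by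
  have : CompleteSpace Y := hY.completeSpace_coe
  have : CompleteSpace Z := hZ.completeSpace_coe
  set f : Y × Z →L[ℝ] X := Y.subtypeL.comp (ContinuousLinearMap.fst ℝ Y Z) - Z.subtypeL.comp (ContinuousLinearMap.snd ℝ Y Z) with hf
  have hfa : ∀ y z, f (y, z) = (y : X) - z := fun y z => rfl
  have hinj : Function.Injective f := by
    rw [injective_iff_map_eq_zero]
    rintro ⟨y, z⟩ h
    rw [hfa, sub_eq_zero] at h
    have h1 : (y : X) ∈ Y ⊓ Z := ⟨y.2, by rw [h]; exact z.2⟩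
    rw [hYZ, Submodule.mem_bot] at h1
    have h2 : (z : X) = 0 := by rw [← h, h1]
    exact Prod.ext (Subtype.ext h1) (Subtype.ext h2)
  have hr : Set.range f = ((Y ⊔ Z : Submodule ℝ X) : Set X) := by
    ext x
    constructor
    · rintro ⟨⟨y, z⟩, rfl⟩
      rw [hfa]
      exact Submodule.sub_mem _ (Submodule.mem_sup_left y.2) (Submodule.mem_sup_right z.2)
    · intro hx
      obtain ⟨y, hy, z, hz, rfl⟩ := Submodule.mem_sup.mp hx
      refine ⟨(⟨y, hy⟩, ⟨-z, Z.neg_mem hz⟩), ?_⟩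
      rw [hfa]; simp
  obtain ⟨K, hK⟩ := f.antilipschitz_of_injective_of_isClosed_range hinj (by rw [hr]; exact hc)
  refine ⟨K, K.2, fun y hy z hz => ?_⟩
  have h1 := hK.le_mul_dist (⟨y, hy⟩, ⟨z, hz⟩) 0
  rw [map_zero, dist_zero_right, dist_zero_right, hfa] at h1
  exact (norm_fst_le ((⟨y, hy⟩, ⟨z, hz⟩) : Y × Z)).trans h1

theorem gen_HI [CompleteSpace X] (hι : ∀ x, ‖ι x‖ = NN LL x) (hd : DenseRange ι) (Y Z : Submodule ℝ X)
    (hY : IsClosed (Y : Set X)) (hZ : IsClosed (Z : Set X))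
    (hY2 : ¬ FiniteDimensional ℝ Y) (hZ2 : ¬ FiniteDimensional ℝ Z)
    (hYZ : Y ⊓ Z = ⊥) : ¬ IsClosed ((Y ⊔ Z : Submodule ℝ X) : Set X) := by
  intro hc
  obtain ⟨κ, hκ, hang⟩ := gen_angle hY hZ hYZ hc
  set η : ℝ := 1 / (20 * (κ + 1)) with hη
  have hη0 : 0 < η := by positivity
  have hηκ : η * (κ + 1) = 1 / 20 := by rw [hη]; field_simp
  have hη1 : η ≤ 1 := by nlinarith
  obtain ⟨V, hV, hVY⟩ := gen_block hι hd hY2 hη0 hη1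
  obtain ⟨W, hW, hWZ⟩ := gen_block hι hd hZ2 hη0 hη1
  obtain ⟨v, hv, w, hw, h0, h1⟩ := HI_core hV hW hη0
  obtain ⟨y, hy, hvy⟩ := hVY v hv
  obtain ⟨z, hz, hwz⟩ := hWZ w hw
  have hyz := hang y hy z hz
  set N := NN LL (v + w) with hN
  have hv2 : NN LL v ≤ N := by
    have e : v = (2 : ℝ)⁻¹ • ((v + w) + (v - w)) := by module
    have h3 := NN_add LL_isLN (v + w) (v - w)
    rw [e, NN_smul LL_isLN, abs_of_pos (by norm_num)]
    nlinarith
  have hw2 : NN LL w ≤ N := by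
    have e : w = (2 : ℝ)⁻¹ • ((v + w) + (-1 : ℝ) • (v - w)) := by module
    have h3 := NN_add LL_isLN (v + w) ((-1 : ℝ) • (v - w))
    rw [NN_smul LL_isLN (-1) (v - w), abs_neg, abs_one, one_mul] at h3
    rw [e, NN_smul LL_isLN, abs_of_pos (by norm_num)]
    nlinarith
  have hvy2 : ‖ι v - y‖ ≤ η * N := hvy.trans (mul_le_mul_of_nonneg_left hv2 hη0.le)
  have hwz2 : ‖ι w - z‖ ≤ η * N := hwz.trans (mul_le_mul_of_nonneg_left hw2 hη0.le)
  have e1 : ‖y - z‖ ≤ 3 * η * N := by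
    have : y - z = ι (v - w) - (ι v - y) + (ι w - z) := by rw [map_sub]; abel
    rw [this]
    refine (norm_add_le _ _).trans ?_
    have h4 := norm_sub_le (ι (v - w)) (ι v - y)
    rw [hι] at h4
    linarith
  have e2 : ‖z‖ ≤ ‖y‖ + ‖y - z‖ := by
    have : z = y - (y - z) := by abel
    conv_lhs => rw [this]
    exact norm_sub_le _ _
  have e3 : N ≤ ‖y‖ + ‖z‖ + 2 * η * N := by
    have h5 : N = ‖ι (v + w)‖ := (hι _).symm
    have h6 : ι (v + w) = (y + z) + ((ι v - y) + (ι w - z)) := by rw [map_add]; abel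
    rw [h6] at h5
    have h7 := norm_add_le (y + z) ((ι v - y) + (ι w - z))
    have h8 := norm_add_le (ι v - y) (ι w - z)
    have h9 := norm_add_le y z
    linarith
  have e4 : ‖y‖ ≤ κ * (3 * η * N) := hyz.trans (mul_le_mul_of_nonneg_left e1 hκ)
  have e5 : η * N * (κ + 1) = N / 20 := by linear_combination N * hηκ
  nlinarith [mul_pos hη0 h0]
end gen
end
end GMHI

/-- There exists an infinite-dimensional uniformly convex Banach space `X` which is
hereditarily indecomposable: whenever `Y` and `Z` are closed infinite-dimensional
subspaces of `X` with `Y ∩ Z = {0}`, the subspace `Y + Z` is not closed in `X`. -/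
theorem exists_uniformly_convex_HI_banach_space :
    ∃ (X : Type) (_ : NormedAddCommGroup X) (_ : NormedSpace ℝ X),
      CompleteSpace X ∧
      ¬FiniteDimensional ℝ X ∧
      -- uniform convexity
      (∀ ε : ℝ, 0 < ε → ∃ δ : ℝ, 0 < δ ∧ ∀ x y : X,
        ‖x‖ ≤ 1 → ‖y‖ ≤ 1 → ε ≤ ‖x - y‖ → ‖(2 : ℝ)⁻¹ • (x + y)‖ ≤ 1 - δ) ∧
      -- hereditary indecomposability
      (∀ Y Z : Submodule ℝ X,
        IsClosed (Y : Set X) → IsClosed (Z : Set X) →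
        ¬FiniteDimensional ℝ Y → ¬FiniteDimensional ℝ Z →
        Y ⊓ Z = ⊥ → ¬IsClosed ((Y ⊔ Z : Submodule ℝ X) : Set X)) := by
  exact ⟨GMHI.XC, inferInstance, inferInstance, inferInstance, GMHI.gen_inf GMHI.iC_norm,
    fun ε hε => GMHI.gen_uc GMHI.iC_norm GMHI.iC_dense ε hε,
    fun Y Z h1 h2 h3 h4 h5 => GMHI.gen_HI GMHI.iC_norm GMHI.iC_dense Y Z h1 h2 h3 h4 h5⟩
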